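/- Under the standing assumptions, for each (p,r)∈ℝⁿ×ℝ, δ>0 and ω∈Ω, the approximate macroscopic system admits a unique viscosity solution v^δ=(v^δ_1,…,v^δ_m). Moreover there exists C=C(p,r,n)>0, independent of δ and ω, such that max_{1≤k≤m}‖δv^δ_k‖_{L^∞(ℝⁿ)} ≤ C and max_{1≤k≤m}‖Dv^δ_k‖_{L^∞(ℝⁿ)} ≤ C; for each R>0 there exists C=C(p,r,n,R)>0, independent of δ and ω, such that max_{1≤j,k≤m}‖v^δ_k−v^δ_j‖_{L^∞(B_R)} ≤ C; and v^δ is stationary, i.e. v^δ(y+z,ω)=v^δ(y,τ_zω) for all y,z∈ℝⁿ and ω∈Ω. -/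

import Mathlib

open Filter Topology Matrix

noncomputable section

/-- Euclidean space ℝⁿ. -/
abbrev Euc (n : ℕ) := EuclideanSpace ℝ (Fin n)

/-- The Hessian matrix of a (test) function `φ : ℝⁿ → ℝ` at a point `y`. -/
def hess {n : ℕ} (φ : Euc n → ℝ) (y : Euc n) : Matrix (Fin n) (Fin n) ℝ :=
  fun i j =>
    iteratedFDeriv ℝ 2 φ y ![EuclideanSpace.single i (1 : ℝ), EuclideanSpace.single j (1 : ℝ)]

/-- `max_{i ≠ k} (s i)₊`, the positive-part maximum over the indices other than `k`. -/
def posMaxOff {m : ℕ} (k : Fin m) (s : Fin m → ℝ) : ℝ :=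
  (((Finset.univ.erase k).sup fun i => (s i).toNNReal : NNReal) : ℝ)

/-- `v` is a viscosity subsolution on `U` of the system `G_k(y, v(y), Dv_k, D²v_k) = 0`,
`k = 1, …, m`. -/
def IsViscSubOn {n m : ℕ}
    (G : Fin m → Euc n → (Fin m → ℝ) → Euc n → Matrix (Fin n) (Fin n) ℝ → ℝ)
    (U : Set (Euc n)) (v : Fin m → Euc n → ℝ) : Prop :=
  ∀ k : Fin m, ∀ φ : Euc n → ℝ, ContDiff ℝ 2 φ →
    ∀ y₀ ∈ U, IsLocalMaxOn (fun y => v k y - φ y) U y₀ →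
      G k y₀ (fun j => v j y₀) (gradient φ y₀) (hess φ y₀) ≤ 0

/-- `v` is a viscosity supersolution on `U` of the system `G_k(y, v(y), Dv_k, D²v_k) = 0`. -/
def IsViscSupOn {n m : ℕ}
    (G : Fin m → Euc n → (Fin m → ℝ) → Euc n → Matrix (Fin n) (Fin n) ℝ → ℝ)
    (U : Set (Euc n)) (v : Fin m → Euc n → ℝ) : Prop :=
  ∀ k : Fin m, ∀ φ : Euc n → ℝ, ContDiff ℝ 2 φ →
    ∀ y₀ ∈ U, IsLocalMinOn (fun y => v k y - φ y) U y₀ →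
      0 ≤ G k y₀ (fun j => v j y₀) (gradient φ y₀) (hess φ y₀)

/-- Viscosity solution of the system `G_k = 0` on `U`. -/
def IsViscSolnOn {n m : ℕ}
    (G : Fin m → Euc n → (Fin m → ℝ) → Euc n → Matrix (Fin n) (Fin n) ℝ → ℝ)
    (U : Set (Euc n)) (v : Fin m → Euc n → ℝ) : Prop :=
  IsViscSubOn G U v ∧ IsViscSupOn G U v

/-- The standing assumptions: a probability space `(Ω, 𝓕, P)` with an ergodic group
`(τ_y)` of measure-preserving transformations, diffusion matrices `A_k = Σ_k Σ_kᵗ` and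
Hamiltonians `H_k(p, r, s, y, ω)`, stationary, convex and coercive in `(p, s)`, monotone,
bounded on bounded sets and locally Lipschitz continuous.  The difference variable
`s ∈ ℝ^{m-1}` is encoded as a vector `s : Fin m → ℝ` whose `k`-th entry is irrelevant
(it is always `0 = v_k - v_k` when evaluated on differences). -/
structure Setting (n m : ℕ) where
  Ω : Type
  [mΩ : MeasurableSpace Ω]
  P : MeasureTheory.Measure Ω
  [probP : MeasureTheory.IsProbabilityMeasure P]
  τ : Euc n → Ω → Ω
  A : Fin m → Euc n → Ω → Matrix (Fin n) (Fin n) ℝ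
  Sig : Fin m → Euc n → Ω → Matrix (Fin n) (Fin n) ℝ
  H : Fin m → Euc n → (Fin m → ℝ) → (Fin m → ℝ) → Euc n → Ω → ℝ
  γ : Fin m → ℝ
  τ_zero : τ 0 = id
  τ_add : ∀ y z : Euc n, τ (y + z) = τ y ∘ τ z
  τ_measurePreserving : ∀ y, MeasureTheory.MeasurePreserving (τ y) P P
  ergodic : ∀ E : Set Ω, MeasurableSet E → (∀ y, τ y ⁻¹' E = E) → P E = 0 ∨ P E = 1
  A_stat : ∀ k y z ω, A k (y + z) ω = A k y (τ z ω)
  H_stat : ∀ k p r s y z ω, H k p r s (y + z) ω = H k p r s y (τ z ω)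
  H_convex_p : ∀ k r s y ω, ConvexOn ℝ Set.univ fun p => H k p r s y ω
  H_convex_s : ∀ k p r y ω, ConvexOn ℝ Set.univ fun s => H k p r s y ω
  γ_gt_one : ∀ k, 1 < γ k
  coercive : ∀ R : ℝ, 0 < R → ∃ C₁ C₂ C₃ : ℝ, 0 < C₁ ∧ 0 < C₂ ∧ 0 < C₃ ∧
    ∀ k p r s y ω, ‖r‖ ≤ R →
      C₁ * ‖p‖ ^ γ k + C₂ * posMaxOff k s - C₃ ≤ H k p r s y ω
  A_sq : ∀ k y ω, A k y ω = Sig k y ω * (Sig k y ω)ᵀ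
  Sig_lip : ∃ C : ℝ, 0 < C ∧ ∀ k ω i j, (∀ y, |Sig k y ω i j| ≤ C) ∧
    ∀ y₁ y₂, |Sig k y₁ ω i j - Sig k y₂ ω i j| ≤ C * ‖y₁ - y₂‖
  H_mono_rk : ∀ k p r s y ω t t', t ≤ t' →
    H k p (Function.update r k t) s y ω ≤ H k p (Function.update r k t') s y ω
  H_mono_s : ∀ k p r s y ω i t t', t ≤ t' →
    H k p r (Function.update s i t) y ω ≤ H k p r (Function.update s i t') y ω
  H_antitone_r : ∀ k p r s y ω i t t', i ≠ k → t ≤ t' →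
    H k p (Function.update r i t') s y ω ≤ H k p (Function.update r i t) s y ω
  H_bounded : ∀ R : ℝ, 0 < R → ∃ C₄ : ℝ, 0 < C₄ ∧ ∀ k p r s y ω,
    ‖p‖ ≤ R → ‖r‖ ≤ R → ‖s‖ ≤ R → |H k p r s y ω| ≤ C₄
  H_cont : ∀ R : ℝ, 0 < R → ∃ C₅ : ℝ, 0 < C₅ ∧ ∀ k p₁ p₂ r₁ r₂ s₁ s₂ y₁ y₂ ω,
    ‖r₁‖ ≤ R → ‖r₂‖ ≤ R → ‖s₁‖ ≤ R → ‖s₂‖ ≤ R →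
    |H k p₁ r₁ s₁ y₁ ω - H k p₂ r₂ s₂ y₂ ω| ≤
      C₅ * ((1 + ‖p₁‖ + ‖p₂‖) ^ (γ k - 1) * ‖p₁ - p₂‖ + ‖r₁ - r₂‖ + ‖s₁ - s₂‖ + ‖y₁ - y₂‖)
  H_colmon : ∀ k p (r q : Fin m → ℝ) s y ω, (∀ i, |r i - q i| ≤ r k - q k) →
    H k p q s y ω ≤ H k p r s y ω

attribute [instance] Setting.mΩ Setting.probP

open MeasureTheory

/-- The operator of the approximate macroscopic system
`δ v_k − tr(A_k(y,ω) D²v_k) + H_k(p + Dv_k, r̂, v_k − v_j, y, ω) = 0`. -/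
def macroOp {n m : ℕ} (S : Setting n m) (p : Euc n) (r δ : ℝ) (ω : S.Ω) :
    Fin m → Euc n → (Fin m → ℝ) → Euc n → Matrix (Fin n) (Fin n) ℝ → ℝ :=
  fun k y vals q X =>
    δ * vals k - (S.A k y ω * X).trace +
      S.H k (p + q) (fun _ => r) (fun j => vals k - vals j) y ω

/-- `v` is "the" solution of the approximate macroscopic system: a continuous, bounded,
Lipschitz (i.e. bounded-gradient) viscosity solution on all of `ℝⁿ`. -/
def IsMacroSoln {n m : ℕ} (S : Setting n m) (p : Euc n) (r δ : ℝ) (ω : S.Ω)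
    (v : Fin m → Euc n → ℝ) : Prop :=
  (∀ k, Continuous (v k)) ∧ (∃ B : ℝ, ∀ k y, |v k y| ≤ B) ∧
  (∃ L : NNReal, ∀ k, LipschitzWith L (v k)) ∧
  IsViscSolnOn (macroOp S p r δ ω) Set.univ v

/-- The stationary cell/metric operator at level `μ`:
`−tr(A_k(y,ω) D²v_k) + H_k(p + Dv_k, r̂, v_k − v_j, y, ω) − μ = 0`. -/
def statOp {n m : ℕ} (S : Setting n m) (p : Euc n) (r μ : ℝ) (ω : S.Ω) :
    Fin m → Euc n → (Fin m → ℝ) → Euc n → Matrix (Fin n) (Fin n) ℝ → ℝ :=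
  fun k y vals q X =>
    -(S.A k y ω * X).trace +
      S.H k (p + q) (fun _ => r) (fun j => vals k - vals j) y ω - μ

/-- `u` grows at most linearly at infinity (`limsup_{|y|→∞} u(y)/|y| < ∞`). -/
def SublinearAbove {n : ℕ} (u : Euc n → ℝ) : Prop :=
  ∃ C : ℝ, ∀ᶠ y in Bornology.cobounded (Euc n), u y ≤ C * ‖y‖

/-- `liminf_{|y|→∞} u(y)/|y| ≥ 0`. -/
def SublinearBelow {n : ℕ} (u : Euc n → ℝ) : Prop :=
  ∀ ε : ℝ, 0 < ε → ∀ᶠ y in Bornology.cobounded (Euc n), -(ε * ‖y‖) ≤ u y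

/-- A Lipschitz, sublinearly growing global viscosity subsolution of the cell problem at
level `lam`. -/
def IsCellSub {n m : ℕ} (S : Setting n m) (p : Euc n) (r lam : ℝ) (ω : S.Ω)
    (w : Fin m → Euc n → ℝ) : Prop :=
  (∃ L : NNReal, ∀ k, LipschitzWith L (w k)) ∧
  IsViscSubOn (statOp S p r lam ω) Set.univ w ∧
  ∀ k, Tendsto (fun y => w k y / ‖y‖) (Bornology.cobounded (Euc n)) (𝓝 0)

/-- `γ = min_k γ_k`. -/
def gammaMin {n m : ℕ} (S : Setting n (m + 1)) : ℝ :=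
  Finset.univ.inf' ⟨0, Finset.mem_univ 0⟩ S.γ

/-- The case distinction: every `A_k` vanishes identically, or `γ > 2`. -/
def degenCase {n m : ℕ} (S : Setting n (m + 1)) : Prop :=
  (∀ k y ω, S.A k y ω = 0) ∨ 2 < gammaMin S

open Classical in
/-- The excised set `D₁(x)`: the point `{x}` if every `A_k ≡ 0` or `γ > 2`, and the
closed unit ball `B̄₁(x)` otherwise. -/
def Dset {n m : ℕ} (S : Setting n (m + 1)) (x : Euc n) : Set (Euc n) :=
  if degenCase S then {x} else Metric.closedBall x 1

/-- `mm` solves the metric system at level `μ`, excised at `x`, with boundary data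
`w(·) − w(x)` and the natural growth conditions at infinity. -/
def IsMetricSoln {n m : ℕ} (S : Setting n (m + 1)) (p : Euc n) (r μ : ℝ) (ω : S.Ω)
    (x : Euc n) (wb : Fin (m + 1) → Euc n → ℝ) (mm : Fin (m + 1) → Euc n → ℝ) : Prop :=
  (∀ k, Continuous (mm k)) ∧
  IsViscSolnOn (statOp S p r μ ω) (Dset S x)ᶜ mm ∧
  (∀ y ∈ frontier (Dset S x), ∀ k, mm k y = wb k y - wb k x) ∧
  (∀ k, SublinearBelow (mm k)) ∧ (∀ k, SublinearAbove (mm k))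

/-- `M k y x = m_{k,μ}(y, x, ω)`, the metric solution excised at `x`, extended (in the case
`A_k ≠ 0` for some `k` and `γ ≤ 2`) by `w(y) − w(x)` for `|x − y| < 1`. -/
def IsExtMetric {n m : ℕ} (S : Setting n (m + 1)) (p : Euc n) (r μ : ℝ) (ω : S.Ω)
    (wb : Fin (m + 1) → Euc n → ℝ) (M : Fin (m + 1) → Euc n → Euc n → ℝ) : Prop :=
  (∀ x : Euc n, IsMetricSoln S p r μ ω x wb fun k y => M k y x) ∧
  (¬ degenCase S → ∀ k x y, ‖x - y‖ < 1 → M k y x = wb k y - wb k x)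

/-- Scalar first-order viscosity subsolution on `U` of `G(y, u, Du) = 0`. -/
def IsViscSubOn1 {n : ℕ} (G : Euc n → ℝ → Euc n → ℝ) (U : Set (Euc n))
    (u : Euc n → ℝ) : Prop :=
  ∀ φ : Euc n → ℝ, ContDiff ℝ 2 φ → ∀ y₀ ∈ U,
    IsLocalMaxOn (fun y => u y - φ y) U y₀ → G y₀ (u y₀) (gradient φ y₀) ≤ 0

/-- Scalar first-order viscosity supersolution on `U` of `G(y, u, Du) = 0`. -/
def IsViscSupOn1 {n : ℕ} (G : Euc n → ℝ → Euc n → ℝ) (U : Set (Euc n))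
    (u : Euc n → ℝ) : Prop :=
  ∀ φ : Euc n → ℝ, ContDiff ℝ 2 φ → ∀ y₀ ∈ U,
    IsLocalMinOn (fun y => u y - φ y) U y₀ → 0 ≤ G y₀ (u y₀) (gradient φ y₀)

/-- `M` solves the effective metric problem `H̄(p + DM, r) = μ` on `ℝⁿ ∖ {0}`, `M(0) = 0`,
subject to the growth conditions `0 ≤ liminf M/|y| ≤ limsup M/|y| < ∞`. -/
def IsEffMetricSoln {n : ℕ} (Hbar : Euc n → ℝ → ℝ) (p : Euc n) (r μ : ℝ)
    (M : Euc n → ℝ) : Prop :=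
  Continuous M ∧
  IsViscSubOn1 (fun _y _val q => Hbar (p + q) r - μ) {(0 : Euc n)}ᶜ M ∧
  IsViscSupOn1 (fun _y _val q => Hbar (p + q) r - μ) {(0 : Euc n)}ᶜ M ∧
  M 0 = 0 ∧ SublinearBelow M ∧ SublinearAbove M

/-- Spatial gradient of a space-time test function. -/
def gradX {n : ℕ} (φ : Euc n × ℝ → ℝ) (x : Euc n) (t : ℝ) : Euc n :=
  gradient (fun x' => φ (x', t)) x

/-- Spatial Hessian of a space-time test function. -/
def hessX {n : ℕ} (φ : Euc n × ℝ → ℝ) (x : Euc n) (t : ℝ) : Matrix (Fin n) (Fin n) ℝ :=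
  hess (fun x' => φ (x', t)) x

/-- Time derivative of a space-time test function. -/
def derT {n : ℕ} (φ : Euc n × ℝ → ℝ) (x : Euc n) (t : ℝ) : ℝ :=
  deriv (fun t' => φ (x, t')) t

/-- Parabolic viscosity subsolution on `U ⊆ ℝⁿ × ℝ` of the system
`G_k(x, t, u(x,t), ∂_t u_k, Du_k, D²u_k) = 0`. -/
def IsParSubOn {n m : ℕ}
    (G : Fin m → Euc n → ℝ → (Fin m → ℝ) → ℝ → Euc n → Matrix (Fin n) (Fin n) ℝ → ℝ)
    (U : Set (Euc n × ℝ)) (u : Fin m → Euc n × ℝ → ℝ) : Prop :=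
  ∀ k : Fin m, ∀ φ : Euc n × ℝ → ℝ, ContDiff ℝ 2 φ → ∀ z ∈ U,
    IsLocalMaxOn (fun w => u k w - φ w) U z →
      G k z.1 z.2 (fun j => u j z) (derT φ z.1 z.2) (gradX φ z.1 z.2) (hessX φ z.1 z.2) ≤ 0

/-- Parabolic viscosity supersolution on `U ⊆ ℝⁿ × ℝ`. -/
def IsParSupOn {n m : ℕ}
    (G : Fin m → Euc n → ℝ → (Fin m → ℝ) → ℝ → Euc n → Matrix (Fin n) (Fin n) ℝ → ℝ)
    (U : Set (Euc n × ℝ)) (u : Fin m → Euc n × ℝ → ℝ) : Prop :=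
  ∀ k : Fin m, ∀ φ : Euc n × ℝ → ℝ, ContDiff ℝ 2 φ → ∀ z ∈ U,
    IsLocalMinOn (fun w => u k w - φ w) U z →
      0 ≤ G k z.1 z.2 (fun j => u j z) (derT φ z.1 z.2) (gradX φ z.1 z.2) (hessX φ z.1 z.2)

/-- Scalar first-order parabolic viscosity subsolution on `U` of `G(x, t, u, u_t, Du) = 0`. -/
def IsParSubOn1 {n : ℕ} (G : Euc n → ℝ → ℝ → ℝ → Euc n → ℝ)
    (U : Set (Euc n × ℝ)) (u : Euc n × ℝ → ℝ) : Prop :=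
  ∀ φ : Euc n × ℝ → ℝ, ContDiff ℝ 2 φ → ∀ z ∈ U,
    IsLocalMaxOn (fun w => u w - φ w) U z →
      G z.1 z.2 (u z) (derT φ z.1 z.2) (gradX φ z.1 z.2) ≤ 0

/-- Scalar first-order parabolic viscosity supersolution on `U`. -/
def IsParSupOn1 {n : ℕ} (G : Euc n → ℝ → ℝ → ℝ → Euc n → ℝ)
    (U : Set (Euc n × ℝ)) (u : Euc n × ℝ → ℝ) : Prop :=
  ∀ φ : Euc n × ℝ → ℝ, ContDiff ℝ 2 φ → ∀ z ∈ U,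
    IsLocalMinOn (fun w => u w - φ w) U z →
      0 ≤ G z.1 z.2 (u z) (derT φ z.1 z.2) (gradX φ z.1 z.2)

/-- `u` is "the" solution of the effective scalar equation
`u_t + H̄(Du, u) = 0` on `ℝⁿ × (0,∞)`, `u = u₀` on `ℝⁿ × {0}`: bounded and uniformly
continuous on every strip `ℝⁿ × [0, T)`, a viscosity solution for `t > 0`, attaining the
initial data. -/
def IsEffSoln {n : ℕ} (Hbar : Euc n → ℝ → ℝ) (u₀ : Euc n → ℝ) (u : Euc n × ℝ → ℝ) : Prop :=
  (∀ T : ℝ, 0 < T → (∃ B : ℝ, ∀ x t, t ∈ Set.Ico (0 : ℝ) T → |u (x, t)| ≤ B) ∧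
      UniformContinuousOn u (Set.univ ×ˢ Set.Ico (0 : ℝ) T)) ∧
  IsParSubOn1 (fun _x _t val ut q => ut + Hbar q val) (Set.univ ×ˢ Set.Ioi (0 : ℝ)) u ∧
  IsParSupOn1 (fun _x _t val ut q => ut + Hbar q val) (Set.univ ×ˢ Set.Ioi (0 : ℝ)) u ∧
  ∀ x, u (x, 0) = u₀ x

/-- The operator of the oscillating ε-system:
`u_t − ε tr(A_k(x/ε,ω) D²u_k) + H_k(Du_k, u, (u_k − u_j)/ε, x/ε, ω) = 0`. -/
def epsOp {n m : ℕ} (S : Setting n (m + 1)) (ε : ℝ) (ω : S.Ω) :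
    Fin (m + 1) → Euc n → ℝ → (Fin (m + 1) → ℝ) → ℝ → Euc n →
      Matrix (Fin n) (Fin n) ℝ → ℝ :=
  fun k x _t vals ut q X =>
    ut - ε * (S.A k (ε⁻¹ • x) ω * X).trace +
      S.H k q vals (fun j => (vals k - vals j) / ε) (ε⁻¹ • x) ω

/-- `u` is the (bounded, continuous) viscosity solution of the ε-system with initial
datum `u₀`. -/
def IsEpsSoln {n m : ℕ} (S : Setting n (m + 1)) (ε : ℝ) (ω : S.Ω)
    (u₀ : Fin (m + 1) → Euc n → ℝ) (u : Fin (m + 1) → Euc n × ℝ → ℝ) : Prop :=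
  (∀ k, Continuous (u k)) ∧
  (∀ T : ℝ, 0 < T → ∃ B : ℝ, ∀ k x t, t ∈ Set.Icc (0 : ℝ) T → |u k (x, t)| ≤ B) ∧
  IsParSubOn (epsOp S ε ω) (Set.univ ×ˢ Set.Ioi (0 : ℝ)) u ∧
  IsParSupOn (epsOp S ε ω) (Set.univ ×ˢ Set.Ioi (0 : ℝ)) u ∧
  ∀ k x, u k (x, 0) = u₀ k x

/-! ### Jensen lemma for semiconvex functions -/

section Jensen

variable {E : Type*} [NormedAddCommGroup E] [InnerProductSpace ℝ E]

theorem contact_estimate {f : E → ℝ} {P : E → E} {lam : ℝ} (hlam : 0 < lam)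
    (hP : ∀ x y, f x + inner ℝ (P x) (y - x) - lam / 2 * ‖y - x‖ ^ 2 ≤ f y)
    {x q : E} (hq : ∀ y, f y ≤ f x + inner ℝ q (y - x)) (z : E) :
    ‖P z - q‖ ≤ lam * ‖z - x‖ := by
  have key : ∀ z : E, ∀ c : ℝ, f x + inner ℝ q (z - x) - c ≤ f z →
      ‖P z - q‖ ^ 2 ≤ 2 * lam * c := by
    intro z c hc
    have h1 := hP z (z + lam⁻¹ • (P z - q))
    have h2 := hq (z + lam⁻¹ • (P z - q))
    have e1 : z + lam⁻¹ • (P z - q) - z = lam⁻¹ • (P z - q) := by abel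
    have e2 : z + lam⁻¹ • (P z - q) - x = (z - x) + lam⁻¹ • (P z - q) := by abel
    rw [e1, inner_smul_right, norm_smul, mul_pow, Real.norm_eq_abs, sq_abs] at h1
    rw [e2, inner_add_right, inner_smul_right] at h2
    have e3 : inner ℝ (P z) (P z - q) - inner ℝ q (P z - q) = ‖P z - q‖ ^ 2 := by
      rw [← inner_sub_left, real_inner_self_eq_norm_sq]
    have h3 : lam⁻¹ * ‖P z - q‖ ^ 2 - lam / 2 * (lam⁻¹ ^ 2 * ‖P z - q‖ ^ 2) ≤ c := by
      rw [← e3] at h1 ⊢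
      linarith [mul_sub lam⁻¹ (inner ℝ (P z) (P z - q)) (inner ℝ q (P z - q))]
    have e4 : lam⁻¹ * ‖P z - q‖ ^ 2 - lam / 2 * (lam⁻¹ ^ 2 * ‖P z - q‖ ^ 2)
        = ‖P z - q‖ ^ 2 / (2 * lam) := by
      field_simp; ring
    rw [e4, div_le_iff₀ (by positivity)] at h3
    linarith
  have hx : P x = q := by
    have := key x 0 (by simp)
    have h0 : ‖P x - q‖ = 0 := by
      have := sq_nonneg ‖P x - q‖
      exact pow_eq_zero_iff (two_ne_zero) |>.1 (by linarith)
    exact sub_eq_zero.1 (norm_eq_zero.1 h0)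
  have h := key z (lam / 2 * ‖z - x‖ ^ 2) (by have := hP x z; rw [hx] at this; linarith)
  exact abs_le_of_sq_le_sq' (by rw [mul_pow]; linarith [h]) (by positivity) |>.2

theorem le_of_sub_le_sq {g : ℝ → ℝ} {C : ℝ}
    (h : ∀ s t, 0 ≤ s → s ≤ t → t ≤ 1 → g t - g s ≤ C * (t - s) ^ 2) : g 1 ≤ g 0 := by
  have hN : ∀ N : ℕ, g 1 - g 0 ≤ C * (1 / ((N : ℝ) + 1)) := by
    intro N
    have hpos : (0 : ℝ) < N + 1 := by positivity
    have hi : ∀ i : ℕ, i ≤ N + 1 →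
        g (i / ((N : ℝ) + 1)) - g 0 ≤ i * (C * (1 / ((N : ℝ) + 1)) ^ 2) := by
      intro i
      induction i with
      | zero => intro _; simp
      | succ i ih =>
        intro hiN
        have h1 := ih (by omega)
        have hle : ((i : ℝ) + 1) ≤ N + 1 := by exact_mod_cast hiN
        have h2 := h (i / ((N : ℝ) + 1)) ((i + 1) / ((N : ℝ) + 1)) (by positivity)
          (by gcongr; linarith) (by rw [div_le_one hpos]; exact hle)
        have e : ((i : ℝ) + 1) / ((N : ℝ) + 1) - i / ((N : ℝ) + 1) = 1 / ((N : ℝ) + 1) := by ring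
        rw [e] at h2
        push_cast
        linarith
    have h3 := hi (N + 1) le_rfl
    push_cast at h3
    rw [div_self hpos.ne'] at h3
    calc g 1 - g 0 ≤ _ := h3
      _ = C * (1 / ((N : ℝ) + 1)) := by field_simp
  have hlim : Tendsto (fun N : ℕ => C * (1 / ((N : ℝ) + 1))) atTop (𝓝 (C * 0)) :=
    tendsto_one_div_add_atTop_nhds_zero_nat.const_mul C
  rw [mul_zero] at hlim
  have := ge_of_tendsto' hlim hN
  linarith

theorem taylor_of_hasFDerivAt {f : E → ℝ} {P : E → E} {lam : ℝ}
    (hP : ∀ x y, f x + inner ℝ (P x) (y - x) - lam / 2 * ‖y - x‖ ^ 2 ≤ f y)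
    {x₀ : E} {B : E →L[ℝ] E} (hB : HasFDerivAt P B x₀) {η : ℝ} (hη : 0 < η) :
    ∀ᶠ h in 𝓝 (0 : E),
      |f (x₀ + h) - f x₀ - inner ℝ (P x₀) h - 1 / 2 * inner ℝ (B h) h| ≤ η * ‖h‖ ^ 2 := by
  rw [hasFDerivAt_iff_isLittleO_nhds_zero] at hB
  have h1 := hB.def hη
  rw [Metric.eventually_nhds_iff] at h1 ⊢
  obtain ⟨ρ, hρ, h1⟩ := h1
  refine ⟨ρ, hρ, fun h hh => ?_⟩
  rw [dist_zero_right] at hh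
  have hp : ∀ t, 0 ≤ t → t ≤ 1 →
      |inner ℝ (P (x₀ + t • h)) h - inner ℝ (P x₀) h - t * inner ℝ (B h) h| ≤ η * ‖h‖ ^ 2 := by
    intro t ht0 ht1
    have hth : ‖t • h‖ ≤ ‖h‖ := by
      rw [norm_smul, Real.norm_eq_abs, abs_of_nonneg ht0]
      exact mul_le_of_le_one_left (norm_nonneg _) ht1
    have h2 := h1 (y := t • h) (by rw [dist_zero_right]; linarith)
    have e : inner ℝ (P (x₀ + t • h)) h - inner ℝ (P x₀) h - t * inner ℝ (B h) h
        = inner ℝ (P (x₀ + t • h) - P x₀ - B (t • h)) h := by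
      rw [inner_sub_left, inner_sub_left, map_smul, real_inner_smul_left]
    rw [e]
    calc _ ≤ ‖P (x₀ + t • h) - P x₀ - B (t • h)‖ * ‖h‖ := abs_real_inner_le_norm _ _
      _ ≤ (η * ‖h‖) * ‖h‖ := by gcongr; exact h2.trans (by gcongr)
      _ = _ := by ring
  have hf : ∀ s t : ℝ, f (x₀ + s • h) + inner ℝ (P (x₀ + s • h)) h * (t - s)
      - lam / 2 * ‖h‖ ^ 2 * (t - s) ^ 2 ≤ f (x₀ + t • h) := by
    intro s t
    have := hP (x₀ + s • h) (x₀ + t • h)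
    have e : x₀ + t • h - (x₀ + s • h) = (t - s) • h := by rw [sub_smul]; abel
    rw [e, inner_smul_right, norm_smul, mul_pow, Real.norm_eq_abs, sq_abs] at this
    linarith
  set a := inner ℝ (P x₀) h
  set b := inner ℝ (B h) h
  set e := η * ‖h‖ ^ 2
  rw [abs_le]
  constructor
  · have := le_of_sub_le_sq (g := fun t => (a - e) * t + b * t ^ 2 / 2 - f (x₀ + t • h))
      (C := lam / 2 * ‖h‖ ^ 2 + b / 2) (by
        intro s t hs hst ht
        have h3 := (abs_le.1 (hp s hs (hst.trans ht))).1
        have h4 := hf s t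
        have h5 := mul_le_mul_of_nonneg_right h3 (sub_nonneg.2 hst)
        nlinarith)
    simp only [one_smul, zero_smul, add_zero] at this
    linarith
  · have := le_of_sub_le_sq (g := fun t => f (x₀ + t • h) - (a + e) * t - b * t ^ 2 / 2)
      (C := lam / 2 * ‖h‖ ^ 2 + b / 2) (by
        intro s t hs hst ht
        have h3 := (abs_le.1 (hp t (hs.trans hst) ht)).2
        have h4 := hf t s
        have h5 := mul_le_mul_of_nonneg_right h3 (sub_nonneg.2 hst)
        nlinarith)
    simp only [one_smul, zero_smul, add_zero] at this
    linarith

open scoped NNReal in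
theorem exists_contact_twice_differentiable [FiniteDimensional ℝ E] {f : E → ℝ} {P : E → E}
    {lam r : ℝ} (hlam : 0 < lam) (hr : 0 < r)
    (hP : ∀ x y, f x + inner ℝ (P x) (y - x) - lam / 2 * ‖y - x‖ ^ 2 ≤ f y)
    (ht : ∀ q : E, ‖q‖ ≤ r → ∃ x, ∀ y, f y ≤ f x + inner ℝ q (y - x)) :
    ∃ (x₀ : E) (B : E →L[ℝ] E), ‖P x₀‖ ≤ r ∧
      (∀ y, f y ≤ f x₀ + inner ℝ (P x₀) (y - x₀)) ∧ HasFDerivAt P B x₀ := by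
  borelize E
  set S : Set E := {x | ‖P x‖ ≤ r ∧ ∀ y, f y ≤ f x + inner ℝ (P x) (y - x)} with hS
  have hlip : ∀ x ∈ S, ∀ z, ‖P z - P x‖ ≤ lam * ‖z - x‖ := fun x hx z =>
    contact_estimate hlam hP hx.2 z
  have hL : LipschitzOnWith lam.toNNReal P S := by
    refine LipschitzOnWith.of_dist_le_mul fun z _ x hx => ?_
    rw [dist_eq_norm, dist_eq_norm, Real.coe_toNNReal _ hlam.le]
    exact hlip x hx z
  have himg : Metric.closedBall (0 : E) r ⊆ P '' S := by
    intro q hq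
    rw [mem_closedBall_zero_iff] at hq
    obtain ⟨x, hx⟩ := ht q hq
    have h := contact_estimate hlam hP hx x
    rw [sub_self, norm_zero, mul_zero] at h
    have hxq : P x = q := sub_eq_zero.1 (norm_eq_zero.1 (le_antisymm h (norm_nonneg _)))
    exact ⟨x, ⟨by rw [hxq]; exact hq, by rw [hxq]; exact hx⟩, hxq⟩
  obtain ⟨Q, hQ, hQS⟩ := hL.extend_finite_dimension
  set μ : Measure E := Measure.hausdorffMeasure (Module.finrank ℝ E : ℝ) with hμ
  have hd1 := hQ.ae_differentiableAt (μ := μ)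
  have hd2 := (Metric.lipschitz_infDist_pt S).ae_differentiableAt (μ := μ)
  have hμS : μ S ≠ 0 := by
    intro h0
    have h1 := hL.hausdorffMeasure_image_le (d := (Module.finrank ℝ E : ℝ)) (by positivity)
    rw [← hμ, h0, mul_zero] at h1
    have h2 := (measure_mono himg).trans h1
    exact (Metric.measure_closedBall_pos μ (0 : E) hr).ne' (le_antisymm h2 bot_le)
  have hne : ∃ x ∈ S, DifferentiableAt ℝ Q x ∧
      DifferentiableAt ℝ (fun x => Metric.infDist x S) x := by
    by_contra hcon
    push Not at hcon
    apply hμS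
    refine measure_mono_null (fun x hx => ?_) (hd1.and hd2)
    exact fun h => hcon x hx h.1 h.2
  obtain ⟨x₀, hx₀, hQd, hDd⟩ := hne
  refine ⟨x₀, fderiv ℝ Q x₀, hx₀.1, hx₀.2, ?_⟩
  have hD0 : HasFDerivAt (fun x => Metric.infDist x S) (0 : E →L[ℝ] ℝ) x₀ := by
    have hmin : IsLocalMin (fun x => Metric.infDist x S) x₀ :=
      Filter.Eventually.of_forall fun y =>
        (Metric.infDist_zero_of_mem hx₀).trans_le Metric.infDist_nonneg
    have := hDd.hasFDerivAt
    rwa [hmin.hasFDerivAt_eq_zero this] at this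
  set K : ℝ := ((lipschitzExtensionConstant E * lam.toNNReal : ℝ≥0) : ℝ)
  have hK : 0 ≤ K := NNReal.coe_nonneg _
  have hPQ : ∀ z, ‖P z - Q z‖ ≤ (lam + K) * Metric.infDist z S := by
    intro z
    refine le_of_forall_pos_le_add fun ε hε => ?_
    have hc : 0 < lam + K := by positivity
    obtain ⟨e, he, hze⟩ := (Metric.infDist_lt_iff ⟨x₀, hx₀⟩).1
      (lt_add_of_pos_right (Metric.infDist z S) (div_pos hε hc))
    have h1 := hlip e he z
    have h2 : ‖Q z - Q e‖ ≤ K * ‖z - e‖ := by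
      rw [← dist_eq_norm, ← dist_eq_norm]; exact hQ.dist_le_mul z e
    have h3 : P z - Q z = (P z - P e) - (Q z - Q e) := by rw [hQS he]; abel
    rw [dist_eq_norm] at hze
    calc ‖P z - Q z‖ ≤ ‖P z - P e‖ + ‖Q z - Q e‖ := by rw [h3]; exact norm_sub_le _ _
      _ ≤ (lam + K) * ‖z - e‖ := by linarith
      _ ≤ (lam + K) * (Metric.infDist z S + ε / (lam + K)) := by gcongr
      _ = _ := by field_simp
  have hdiff : HasFDerivAt (fun z => P z - Q z) (0 : E →L[ℝ] E) x₀ := by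
    rw [hasFDerivAt_iff_isLittleO_nhds_zero] at hD0 ⊢
    simp only [_root_.zero_apply, sub_zero, Metric.infDist_zero_of_mem hx₀] at hD0 ⊢
    have hz : P x₀ - Q x₀ = 0 := by rw [hQS hx₀]; simp
    simp only [hz, sub_zero]
    refine Asymptotics.IsBigO.trans_isLittleO ?_ hD0
    refine Asymptotics.IsBigO.of_bound (lam + K) (Eventually.of_forall fun h => ?_)
    rw [Real.norm_eq_abs, abs_of_nonneg Metric.infDist_nonneg]
    exact hPQ _
  have := hdiff.add hQd.hasFDerivAt
  convert this using 1
  · ext z; simp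
  · simp

end Jensen

/-! ### Second-order jets and the theorem on sums -/

theorem exists_max_of_le_sub_norm {E : Type*} [NormedAddCommGroup E] [ProperSpace E]
    {g : E → ℝ} (hg : Continuous g) {C c : ℝ}
    (hc : 0 < c) (h : ∀ x, g x ≤ C - c * ‖x‖) : ∃ x, ∀ y, g y ≤ g x := by
  refine hg.exists_forall_ge ?_
  have h1 : Tendsto (fun x : E => C - c * ‖x‖) (cocompact E) atBot := by
    have := (tendsto_norm_cocompact_atTop (E := E)).const_mul_atTop hc
    simpa [sub_eq_add_neg] using
      tendsto_const_nhds.add_atBot (tendsto_neg_atTop_atBot.comp this) (C := C)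
  exact tendsto_atBot_mono h h1

theorem sums_closeness {α η D₀ d e ε r t D z : ℝ} (hα : 0 ≤ α) (hη : 0 < η) (hε : 0 < ε)
    (ht : 0 < t) (hd : 0 ≤ d)
    (hr : r = η * t / 8)
    (hε1 : η ≤ 1 / ε) (hε2 : 16 * (4 * α ^ 2 / η + α / 2) ≤ 1 / ε)
    (hε3 : 64 * α ^ 2 * D₀ ^ 2 / (η * t ^ 2) ≤ 1 / ε)
    (hD : D ≤ D₀ + e) (hz0 : 0 ≤ z) (hz : z ≤ D + d)
    (h : d ^ 2 / (4 * ε) + η * e ^ 2 / 4 ≤ α / 2 * (z ^ 2 - D ^ 2) + r * e) :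
    d ≤ t ∧ e ≤ t := by
  have h1 : α / 2 * (z ^ 2 - D ^ 2) ≤ α * D₀ * d + α * e * d + α / 2 * d ^ 2 := by
    have : z ^ 2 - D ^ 2 ≤ 2 * D₀ * d + 2 * e * d + d ^ 2 := by nlinarith
    nlinarith
  have h2 : α * e * d ≤ η * e ^ 2 / 16 + 4 * α ^ 2 / η * d ^ 2 := by
    have : η * e ^ 2 / 16 + 4 * α ^ 2 / η * d ^ 2 - α * e * d
        = (η * e / 4 - 2 * α * d) ^ 2 / η := by field_simp; ring
    have h0 : 0 ≤ (η * e / 4 - 2 * α * d) ^ 2 / η := by positivity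
    linarith
  have h3 : r * e ≤ η * e ^ 2 / 16 + η * t ^ 2 / 16 := by
    subst hr
    nlinarith [mul_nonneg hη.le (sq_nonneg (e - t))]
  have h4 : α * D₀ * d ≤ d ^ 2 / (16 * ε) + 4 * ε * α ^ 2 * D₀ ^ 2 := by
    have : d ^ 2 / (16 * ε) + 4 * ε * α ^ 2 * D₀ ^ 2 - α * D₀ * d
        = (d / 4 - 2 * ε * α * D₀) ^ 2 / ε := by field_simp; ring
    have h0 : 0 ≤ (d / 4 - 2 * ε * α * D₀) ^ 2 / ε := by positivity
    linarith
  have h5 : 4 * ε * α ^ 2 * D₀ ^ 2 ≤ η * t ^ 2 / 16 := by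
    rw [div_le_div_iff₀ (by positivity) hε] at hε3
    linarith
  have h6 : (4 * α ^ 2 / η + α / 2) * d ^ 2 ≤ d ^ 2 / (16 * ε) := by
    have : d ^ 2 / (16 * ε) = (1 / ε) / 16 * d ^ 2 := by field_simp
    rw [this]
    gcongr
    linarith
  have e1 : d ^ 2 / (4 * ε) = 4 * (d ^ 2 / (16 * ε)) := by field_simp; ring
  have h7 : 2 * (d ^ 2 / (16 * ε)) + η * e ^ 2 / 8 ≤ η * t ^ 2 / 8 := by linarith
  have h8 : η * d ^ 2 ≤ 16 * (d ^ 2 / (16 * ε)) := by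
    have : 16 * (d ^ 2 / (16 * ε)) = (1 / ε) * d ^ 2 := by field_simp
    rw [this]; gcongr
  have hd' : d ^ 2 ≤ t ^ 2 := by
    have : 0 ≤ η * e ^ 2 / 8 := by positivity
    have : η * d ^ 2 ≤ η * t ^ 2 := by linarith
    exact le_of_mul_le_mul_left this hη
  have he' : e ^ 2 ≤ t ^ 2 := by
    have : 0 ≤ 2 * (d ^ 2 / (16 * ε)) := by positivity
    have : η * e ^ 2 ≤ η * t ^ 2 := by linarith
    exact le_of_mul_le_mul_left this hη
  exact ⟨abs_le_of_sq_le_sq' hd' ht.le |>.2, abs_le_of_sq_le_sq' he' ht.le |>.2⟩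

section Jets

variable {E : Type*} [NormedAddCommGroup E] [InnerProductSpace ℝ E]

/-- `(q, X)` is a second-order superjet of `f` at `y`. -/
def Jup (f : E → ℝ) (y q : E) (X : E →L[ℝ] E) : Prop :=
  ∀ η : ℝ, 0 < η → ∀ᶠ h in 𝓝 (0 : E),
    f (y + h) ≤ f y + inner ℝ q h + 1 / 2 * inner ℝ (X h) h + η * ‖h‖ ^ 2

theorem exists_sup_convolution [ProperSpace E] {u : E → ℝ} (hu : Continuous u) {M : ℝ}
    (hub : ∀ x, u x ≤ M) {ε : ℝ} (hε : 0 < ε) (x : E) :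
    ∃ z, ∀ z', u z' - ‖x - z'‖ ^ 2 / (2 * ε) ≤ u z - ‖x - z‖ ^ 2 / (2 * ε) := by
  refine exists_max_of_le_sub_norm (by fun_prop)
    (C := M + ‖x‖ ^ 2 / (2 * ε) + ‖x‖ / ε + 1 / (2 * ε))
    (c := 1 / ε) (by positivity) fun z => ?_
  have h1 := hub z
  have h2 : ‖z‖ ≤ ‖x - z‖ + ‖x‖ := by
    have := norm_sub_le x (x - z); simp at this; linarith
  have h3 : 1 / ε * ‖z‖ ≤ 1 / ε * (‖x - z‖ + ‖x‖) := by gcongr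
  have h4 : ‖x - z‖ ^ 2 / (2 * ε) = 1 / ε * ‖x - z‖ - 1 / (2 * ε)
      + (‖x - z‖ - 1) ^ 2 / (2 * ε) := by field_simp; ring
  have h5 : 0 ≤ (‖x - z‖ - 1) ^ 2 / (2 * ε) := by positivity
  have h6 : 0 ≤ ‖x‖ ^ 2 / (2 * ε) := by positivity
  have h7 : 1 / ε * (‖x - z‖ + ‖x‖) = 1 / ε * ‖x - z‖ + ‖x‖ / ε := by ring
  linarith

end Jets

section Sums

variable {E : Type*} [NormedAddCommGroup E] [InnerProductSpace ℝ E]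

theorem exists_touching_of_sup_convolution [ProperSpace E] {u w : E → ℝ}
    (hu : Continuous u) (hw : Continuous w)
    {M : ℝ} (hub : ∀ x, u x ≤ M) (hwb : ∀ x, w x ≤ M) {α η ε r : ℝ} (hα : 0 ≤ α) (hη : 0 < η)
    (hε : 0 < ε) (hr : 0 ≤ r) (x₁ y₁ a b : E) (ha : ‖a‖ ≤ r) (hb : ‖b‖ ≤ r) :
    ∃ x y z₁ z₂ : E, ∀ x' y' z₁' z₂' : E,
      u z₁' - ‖x' - z₁'‖ ^ 2 / (2 * ε) + (w z₂' - ‖y' - z₂'‖ ^ 2 / (2 * ε))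
        - α / 2 * ‖x' - y'‖ ^ 2 - η / 2 * (‖x' - x₁‖ ^ 2 + ‖y' - y₁‖ ^ 2)
        - (inner ℝ a x' + inner ℝ b y') ≤
      u z₁ - ‖x - z₁‖ ^ 2 / (2 * ε) + (w z₂ - ‖y - z₂‖ ^ 2 / (2 * ε))
        - α / 2 * ‖x - y‖ ^ 2 - η / 2 * (‖x - x₁‖ ^ 2 + ‖y - y₁‖ ^ 2)
        - (inner ℝ a x + inner ℝ b y) := by
  have hbd : ∀ X : (E × E) × (E × E), u X.2.1 - ‖X.1.1 - X.2.1‖ ^ 2 / (2 * ε)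
      + (w X.2.2 - ‖X.1.2 - X.2.2‖ ^ 2 / (2 * ε))
      - α / 2 * ‖X.1.1 - X.1.2‖ ^ 2 - η / 2 * (‖X.1.1 - x₁‖ ^ 2 + ‖X.1.2 - y₁‖ ^ 2)
      - (inner ℝ a X.1.1 + inner ℝ b X.1.2) ≤
      (2 * M + 2 * (r + 2) * (‖x₁‖ + ‖y₁‖) + 2 * ε + (r + 2) ^ 2 / η) - 1 * ‖X‖ := by
    rintro ⟨⟨x, y⟩, ⟨z₁, z₂⟩⟩
    have h1 := hub z₁
    have h2 := hwb z₂
    have sq1 : ∀ s c k : ℝ, 0 < c → k * s - k ^ 2 / (2 * c) ≤ c / 2 * s ^ 2 := by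
      intro s c k hc
      have : c / 2 * s ^ 2 - (k * s - k ^ 2 / (2 * c)) = (c * s - k) ^ 2 / (2 * c) := by
        field_simp; ring
      have h0 : 0 ≤ (c * s - k) ^ 2 / (2 * c) := by positivity
      linarith
    have h3 := sq1 ‖x - x₁‖ η (r + 2) hη
    have h4 := sq1 ‖y - y₁‖ η (r + 2) hη
    have h5 := sq1 ‖x - z₁‖ (1 / ε) 1 (by positivity)
    have h6 := sq1 ‖y - z₂‖ (1 / ε) 1 (by positivity)
    have e5 : 1 / ε / 2 * ‖x - z₁‖ ^ 2 = ‖x - z₁‖ ^ 2 / (2 * ε) := by field_simp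
    have e6 : 1 / ε / 2 * ‖y - z₂‖ ^ 2 = ‖y - z₂‖ ^ 2 / (2 * ε) := by field_simp
    have e7 : (1 : ℝ) ^ 2 / (2 * (1 / ε)) = ε / 2 := by field_simp
    rw [e5, e7] at h5
    rw [e6, e7] at h6
    have e8 : (r + 2) ^ 2 / η = 2 * ((r + 2) ^ 2 / (2 * η)) := by field_simp
    have tri : ∀ p q : E, ‖p‖ ≤ ‖p - q‖ + ‖q‖ := fun p q => by
      simpa using norm_add_le (p - q) q
    have t1 := tri x x₁
    have t2 := tri y y₁
    have t3 : ‖z₁‖ ≤ ‖x - z₁‖ + ‖x‖ := by rw [norm_sub_rev]; exact tri z₁ x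
    have t4 : ‖z₂‖ ≤ ‖y - z₂‖ + ‖y‖ := by rw [norm_sub_rev]; exact tri z₂ y
    have i1 : -(r * ‖x‖) ≤ inner ℝ a x := by
      have := neg_le_of_abs_le (abs_real_inner_le_norm a x)
      have : ‖a‖ * ‖x‖ ≤ r * ‖x‖ := by gcongr
      linarith
    have i2 : -(r * ‖y‖) ≤ inner ℝ b y := by
      have := neg_le_of_abs_le (abs_real_inner_le_norm b y)
      have : ‖b‖ * ‖y‖ ≤ r * ‖y‖ := by gcongr
      linarith
    have m1 : (r + 2) * ‖x‖ ≤ (r + 2) * (‖x - x₁‖ + ‖x₁‖) := by gcongr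
    have m2 : (r + 2) * ‖y‖ ≤ (r + 2) * (‖y - y₁‖ + ‖y₁‖) := by gcongr
    have nX : ‖(((x, y), (z₁, z₂)) : (E × E) × (E × E))‖ ≤ ‖x‖ + ‖y‖ + ‖z₁‖ + ‖z₂‖ := by
      simp only [Prod.norm_mk, sup_le_iff]
      have := norm_nonneg x; have := norm_nonneg y
      have := norm_nonneg z₁; have := norm_nonneg z₂
      refine ⟨⟨?_, ?_⟩, ?_, ?_⟩ <;> linarith
    have p1 : 0 ≤ α / 2 * ‖x - y‖ ^ 2 := by positivity
    have p2 : 0 ≤ (r + 2) * (‖x₁‖ + ‖y₁‖) := by positivity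
    simp only
    nlinarith
  obtain ⟨⟨⟨x, y⟩, ⟨z₁, z₂⟩⟩, h⟩ := exists_max_of_le_sub_norm (by fun_prop) one_pos hbd
  exact ⟨x, y, z₁, z₂, fun x' y' z₁' z₂' => h ((x', y'), (z₁', z₂'))⟩

end Sums

section Sums

variable {E : Type*} [NormedAddCommGroup E] [InnerProductSpace ℝ E]

theorem semiconvex_sup_convolution {u : E → ℝ} {ε : ℝ} {Z : E → E}
    (hZ : ∀ x z', u z' - ‖x - z'‖ ^ 2 / (2 * ε) ≤ u (Z x) - ‖x - Z x‖ ^ 2 / (2 * ε)) (x y : E) :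
    (u (Z x) - ‖x - Z x‖ ^ 2 / (2 * ε)) + inner ℝ (ε⁻¹ • (Z x - x)) (y - x)
      - 1 / ε / 2 * ‖y - x‖ ^ 2 ≤ u (Z y) - ‖y - Z y‖ ^ 2 / (2 * ε) := by
  have h := hZ y (Z x)
  have e : y - Z x = (y - x) - (Z x - x) := by abel
  rw [e, norm_sub_sq_real, real_inner_comm] at h
  rw [real_inner_smul_left, norm_sub_rev x (Z x)]
  have : (‖y - x‖ ^ 2 - 2 * inner ℝ (Z x - x) (y - x) + ‖Z x - x‖ ^ 2) / (2 * ε)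
    = 1 / ε / 2 * ‖y - x‖ ^ 2 - ε⁻¹ * inner ℝ (Z x - x) (y - x) + ‖Z x - x‖ ^ 2 / (2 * ε) := by
    by_cases h : ε = 0
    · simp [h]
    · field_simp
  linarith

theorem jup_of_sup_convolution {u : E → ℝ} {ε : ℝ} {Z : E → E}
    (hZ : ∀ x z', u z' - ‖x - z'‖ ^ 2 / (2 * ε) ≤ u (Z x) - ‖x - Z x‖ ^ 2 / (2 * ε)) {x q : E}
    {X : E →L[ℝ] E} (h : Jup (fun x => u (Z x) - ‖x - Z x‖ ^ 2 / (2 * ε)) x q X) :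
    Jup u (Z x) q X := by
  intro η hη
  filter_upwards [h η hη] with k hk
  have h1 := hZ (x + k) (Z x + k)
  have e : x + k - (Z x + k) = x - Z x := by abel
  rw [e] at h1
  linarith

theorem prod_inner (V W : WithLp 2 (E × E)) :
    inner ℝ V W = inner ℝ V.fst W.fst + inner ℝ V.snd W.snd := WithLp.prod_inner_apply V W

theorem norm_add_sub_sq (a b h k : E) : ‖a + h - (b + k)‖ ^ 2
    = ‖a - b‖ ^ 2 + 2 * inner ℝ (a - b) (h - k) + ‖h - k‖ ^ 2 := by
  rw [← norm_add_sq_real]; congr 2; abel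

set_option maxHeartbeats 1600000 in
/-- The theorem on sums for the quadratic penalization `α / 2 * ‖x - y‖ ^ 2`. -/
theorem exists_jets_of_max [FiniteDimensional ℝ E] {u w : E → ℝ}
    (hu : Continuous u) (hw : Continuous w) {M : ℝ} (hub : ∀ x, u x ≤ M) (hwb : ∀ x, w x ≤ M)
    {α η : ℝ} (hα : 0 ≤ α) (hη : 0 < η) {x₁ y₁ : E}
    (hmax : ∀ x y, u x + w y - α / 2 * ‖x - y‖ ^ 2 ≤ u x₁ + w y₁ - α / 2 * ‖x₁ - y₁‖ ^ 2) :
    ∃ (z₁ z₂ q₁ q₂ : E) (X Y : E →L[ℝ] E), ‖z₁ - x₁‖ < η ∧ ‖z₂ - y₁‖ < η ∧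
      ‖q₁ - α • (x₁ - y₁)‖ < η ∧ ‖q₂ + α • (x₁ - y₁)‖ < η ∧ Jup u z₁ q₁ X ∧ Jup w z₂ q₂ Y ∧
      ∀ ξ ζ : E, inner ℝ (X ξ) ξ + inner ℝ (Y ζ) ζ
        ≤ α * ‖ξ - ζ‖ ^ 2 + η * (‖ξ‖ ^ 2 + ‖ζ‖ ^ 2) := by
  set t : ℝ := η / (4 * (1 + α + η)) with ht
  have ht0 : 0 < t := by positivity
  have ht1 : 4 * t + 4 * (α * t) + 4 * (η * t) = η := by rw [ht]; field_simp
  set r : ℝ := η * t / 8 with hr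
  have hr0 : 0 < r := by positivity
  set D₀ := ‖x₁ - y₁‖ with hD₀
  set Kε : ℝ := η + 16 * (4 * α ^ 2 / η + α / 2) + 64 * α ^ 2 * D₀ ^ 2 / (η * t ^ 2) with hKε
  have p1 : 0 ≤ 16 * (4 * α ^ 2 / η + α / 2) := by positivity
  have p2 : 0 ≤ 64 * α ^ 2 * D₀ ^ 2 / (η * t ^ 2) := by positivity
  have hK0 : 0 < Kε := by linarith
  set ε : ℝ := 1 / Kε with hε
  have hε0 : 0 < ε := by positivity
  have hε1 : 1 / ε = Kε := by rw [hε]; simp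
  choose Zu hZu using fun x => exists_sup_convolution hu hub hε0 x
  choose Zw hZw using fun x => exists_sup_convolution hw hwb hε0 x
  set ue : E → ℝ := fun x => u (Zu x) - ‖x - Zu x‖ ^ 2 / (2 * ε) with hue
  set we : E → ℝ := fun x => w (Zw x) - ‖x - Zw x‖ ^ 2 / (2 * ε) with hwe
  set g : WithLp 2 (E × E) → ℝ := fun V => ue V.fst + we V.snd - α / 2 * ‖V.fst - V.snd‖ ^ 2
    - η / 2 * (‖V.fst - x₁‖ ^ 2 + ‖V.snd - y₁‖ ^ 2) with hg
  set P : WithLp 2 (E × E) → WithLp 2 (E × E) := fun V => WithLp.toLp 2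
    (ε⁻¹ • (Zu V.fst - V.fst) - α • (V.fst - V.snd) - η • (V.fst - x₁),
     ε⁻¹ • (Zw V.snd - V.snd) + α • (V.fst - V.snd) - η • (V.snd - y₁)) with hPdef
  have hP : ∀ V W, g V + inner ℝ (P V) (W - V) - (1 / ε + 2 * α + η) / 2 * ‖W - V‖ ^ 2 ≤ g W := by
    intro V W
    obtain ⟨⟨x, y⟩, rfl⟩ := (WithLp.equiv 2 (E × E)).symm.surjective V
    obtain ⟨⟨x', y'⟩, rfl⟩ := (WithLp.equiv 2 (E × E)).symm.surjective W
    obtain ⟨h, rfl⟩ : ∃ h, x' = x + h := ⟨x' - x, by abel⟩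
    obtain ⟨k, rfl⟩ : ∃ k, y' = y + k := ⟨y' - y, by abel⟩
    have h1 := semiconvex_sup_convolution hZu x (x + h)
    have h2 := semiconvex_sup_convolution hZw y (y + k)
    simp only [hg, hPdef, hue, hwe, prod_inner, WithLp.prod_norm_sq_eq_of_L2,
      WithLp.equiv_symm_apply, WithLp.sub_fst, WithLp.sub_snd, WithLp.toLp_fst,
      WithLp.toLp_snd, add_sub_cancel_left, inner_sub_left, inner_add_left,
      real_inner_smul_left] at h1 h2 ⊢
    have e1 := norm_add_sub_sq x y h k
    have e2 := norm_add_sub_sq x x₁ h 0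
    have e3 := norm_add_sub_sq y y₁ k 0
    have e4 := parallelogram_law_with_norm ℝ h k
    have e5 := mul_nonneg hα (sq_nonneg ‖h + k‖)
    simp only [add_zero, sub_zero, inner_sub_left, inner_sub_right] at e1 e2 e3
    rw [e1, e2, e3]
    linear_combination h1 + h2 + (1 / 2) * e5 + (α / 2) * e4
  obtain ⟨V₀, B, hV1, hV2, hV3⟩ := exists_contact_twice_differentiable
    (by positivity : 0 < 1 / ε + 2 * α + η) hr0 hP (by
      intro Q hQ
      have hQs := WithLp.prod_norm_sq_eq_of_L2 Q
      have hQ1 : ‖Q.fst‖ ≤ r := le_trans (abs_le_of_sq_le_sq' (by nlinarith [sq_nonneg ‖Q.snd‖])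
        (norm_nonneg _) |>.2) hQ
      have hQ2 : ‖Q.snd‖ ≤ r := le_trans (abs_le_of_sq_le_sq' (by nlinarith [sq_nonneg ‖Q.fst‖])
        (norm_nonneg _) |>.2) hQ
      obtain ⟨x, y, z₁, z₂, h⟩ := exists_touching_of_sup_convolution hu hw hub hwb hα hη hε0 hr0.le
        x₁ y₁ Q.fst Q.snd hQ1 hQ2
      refine ⟨WithLp.toLp 2 (x, y), fun W => ?_⟩
      have h1 := h W.fst W.snd (Zu W.fst) (Zw W.snd)
      have h2 := hZu x z₁
      have h3 := hZw y z₂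
      simp only [hg, hue, hwe, prod_inner, WithLp.sub_fst, WithLp.sub_snd,
        WithLp.toLp_fst, WithLp.toLp_snd, inner_sub_right] at h1 ⊢
      linarith)
  obtain ⟨⟨x, y⟩, rfl⟩ := (WithLp.equiv 2 (E × E)).symm.surjective V₀
  have hTay := fun η' (h : 0 < η') => taylor_of_hasFDerivAt hP hV3 (η := η') h
  simp only [WithLp.equiv_symm_apply] at hV1 hV2 hTay
  set V₀ : WithLp 2 (E × E) := WithLp.toLp 2 (x, y) with hV₀
  set a := (P V₀).fst with ha
  set b := (P V₀).snd with hb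
  have hQs := WithLp.prod_norm_sq_eq_of_L2 (P V₀)
  have har : ‖a‖ ≤ r := le_trans (abs_le_of_sq_le_sq' (by nlinarith [sq_nonneg ‖b‖])
    (norm_nonneg _) |>.2) hV1
  have hbr : ‖b‖ ≤ r := le_trans (abs_le_of_sq_le_sq' (by nlinarith [sq_nonneg ‖a‖])
    (norm_nonneg _) |>.2) hV1
  have ha' : a = ε⁻¹ • (Zu x - x) - α • (x - y) - η • (x - x₁) := by simp [ha, hPdef, hV₀]
  have hb' : b = ε⁻¹ • (Zw y - y) + α • (x - y) - η • (y - y₁) := by simp [hb, hPdef, hV₀]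
  have hclose : ‖x - Zu x‖ + ‖y - Zw y‖ ≤ t ∧ ‖x - x₁‖ + ‖y - y₁‖ ≤ t := by
    have h1 := hV2 (WithLp.toLp 2 (x₁, y₁))
    have h2 := hZu x₁ x₁
    have h3 := hZw y₁ y₁
    have h4 := hmax (Zu x) (Zw y)
    simp only [prod_inner, WithLp.sub_fst, WithLp.sub_snd, hV₀, WithLp.toLp_fst,
      WithLp.toLp_snd] at h1
    rw [← ha, ← hb] at h1
    simp only [hg, hue, hwe, hV₀, WithLp.toLp_fst, WithLp.toLp_snd, sub_self, norm_zero,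
      ne_eq, OfNat.ofNat_ne_zero, not_false_eq_true, zero_pow, zero_div, sub_zero, add_zero,
      mul_zero] at h1 h2 h3
    have i1 : inner ℝ a (x₁ - x) ≤ r * ‖x - x₁‖ := by
      rw [norm_sub_rev]; exact (real_inner_le_norm _ _).trans (by gcongr)
    have i2 : inner ℝ b (y₁ - y) ≤ r * ‖y - y₁‖ := by
      rw [norm_sub_rev]; exact (real_inner_le_norm _ _).trans (by gcongr)
    refine sums_closeness hα hη hε0 ht0 (by positivity) hr (by linarith) (by linarith)
      (by linarith) (D₀ := D₀) (D := ‖x - y‖) (z := ‖Zu x - Zw y‖) ?_ (norm_nonneg _) ?_ ?_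
    · have : x - y = (x₁ - y₁) + ((x - x₁) - (y - y₁)) := by abel
      rw [this]
      linarith [norm_add_le (x₁ - y₁) ((x - x₁) - (y - y₁)), norm_sub_le (x - x₁) (y - y₁)]
    · have : Zu x - Zw y = (x - y) - ((x - Zu x) - (y - Zw y)) := by abel
      rw [this]
      linarith [norm_sub_le (x - y) ((x - Zu x) - (y - Zw y)), norm_sub_le (x - Zu x) (y - Zw y)]
    · have s1 : (‖x - Zu x‖ + ‖y - Zw y‖) ^ 2 / (4 * ε)
          ≤ ‖x - Zu x‖ ^ 2 / (2 * ε) + ‖y - Zw y‖ ^ 2 / (2 * ε) := by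
        have : ‖x - Zu x‖ ^ 2 / (2 * ε) + ‖y - Zw y‖ ^ 2 / (2 * ε)
            - (‖x - Zu x‖ + ‖y - Zw y‖) ^ 2 / (4 * ε)
            = (‖x - Zu x‖ - ‖y - Zw y‖) ^ 2 / (4 * ε) := by field_simp; ring
        have h0 : 0 ≤ (‖x - Zu x‖ - ‖y - Zw y‖) ^ 2 / (4 * ε) := by positivity
        linarith
      have s2 : η * (‖x - x₁‖ + ‖y - y₁‖) ^ 2 / 4 ≤ η / 2 * (‖x - x₁‖ ^ 2 + ‖y - y₁‖ ^ 2) := by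
        nlinarith [mul_nonneg hη.le (sq_nonneg (‖x - x₁‖ - ‖y - y₁‖))]
      linarith
  obtain ⟨hc1, hc2⟩ := hclose
  have n1 := norm_nonneg (x - Zu x); have n2 := norm_nonneg (y - Zw y)
  have n3 := norm_nonneg (x - x₁); have n4 := norm_nonneg (y - y₁)
  have ht2 : 0 < α * t + η * t + t := by positivity
  have hαt : 0 ≤ α * t := by positivity
  have hηt : 0 < η * t := by positivity
  have hxy : ‖(x - x₁) - (y - y₁)‖ ≤ t := (norm_sub_le _ _).trans hc2
  have hq1 : ε⁻¹ • (Zu x - x) - α • (x₁ - y₁) = a + α • ((x - x₁) - (y - y₁)) + η • (x - x₁) := by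
    rw [ha']; module
  have hq2 : ε⁻¹ • (Zw y - y) + α • (x₁ - y₁) = b - α • ((x - x₁) - (y - y₁)) + η • (y - y₁) := by
    rw [hb']; module
  have hs1 : ‖α • ((x - x₁) - (y - y₁))‖ ≤ α * t := by
    rw [norm_smul, Real.norm_eq_abs, abs_of_nonneg hα]; gcongr
  have hs2 : ‖η • (x - x₁)‖ ≤ η * t := by
    rw [norm_smul, Real.norm_eq_abs, abs_of_pos hη]; gcongr; linarith
  have hs3 : ‖η • (y - y₁)‖ ≤ η * t := by
    rw [norm_smul, Real.norm_eq_abs, abs_of_pos hη]; gcongr; linarith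
  set ι₁ : E →L[ℝ] WithLp 2 (E × E) :=
    (WithLp.prodContinuousLinearEquiv 2 ℝ E E).symm.toContinuousLinearMap ∘L
      ContinuousLinearMap.inl ℝ E E with hι₁
  set ι₂ : E →L[ℝ] WithLp 2 (E × E) :=
    (WithLp.prodContinuousLinearEquiv 2 ℝ E E).symm.toContinuousLinearMap ∘L
      ContinuousLinearMap.inr ℝ E E with hι₂
  set π₁ : WithLp 2 (E × E) →L[ℝ] E := ContinuousLinearMap.fst ℝ E E ∘L
    (WithLp.prodContinuousLinearEquiv 2 ℝ E E).toContinuousLinearMap with hπ₁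
  set π₂ : WithLp 2 (E × E) →L[ℝ] E := ContinuousLinearMap.snd ℝ E E ∘L
    (WithLp.prodContinuousLinearEquiv 2 ℝ E E).toContinuousLinearMap with hπ₂
  have hι₁a : ∀ ξ, ι₁ ξ = WithLp.toLp 2 (ξ, 0) := fun ξ => rfl
  have hι₂a : ∀ ξ, ι₂ ξ = WithLp.toLp 2 (0, ξ) := fun ξ => rfl
  have hπ₁a : ∀ V, π₁ V = V.fst := fun ξ => rfl
  have hπ₂a : ∀ V, π₂ V = V.snd := fun ξ => rfl
  have hT1 : ∀ η' > 0, ∀ᶠ ξ in 𝓝 (0 : E), |g (WithLp.toLp 2 (x + ξ, y)) - g V₀ - inner ℝ a ξ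
      - 1 / 2 * inner ℝ ((π₁ ∘L B ∘L ι₁) ξ) ξ| ≤ η' * ‖ξ‖ ^ 2 := by
    intro η' hη'
    have h := (ι₁.continuous.tendsto' 0 0 (map_zero _)).eventually (hTay η' hη')
    filter_upwards [h] with ξ h
    have e : V₀ + ι₁ ξ = WithLp.toLp 2 (x + ξ, y) := by
      rw [hι₁a, hV₀, ← WithLp.toLp_add]; simp
    rw [e] at h
    simpa [hι₁a, prod_inner, WithLp.prod_norm_sq_eq_of_L2, ← ha, hπ₁a] using h
  have hT2 : ∀ η' > 0, ∀ᶠ ξ in 𝓝 (0 : E), |g (WithLp.toLp 2 (x, y + ξ)) - g V₀ - inner ℝ b ξ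
      - 1 / 2 * inner ℝ ((π₂ ∘L B ∘L ι₂) ξ) ξ| ≤ η' * ‖ξ‖ ^ 2 := by
    intro η' hη'
    have h := (ι₂.continuous.tendsto' 0 0 (map_zero _)).eventually (hTay η' hη')
    filter_upwards [h] with ξ h
    have e : V₀ + ι₂ ξ = WithLp.toLp 2 (x, y + ξ) := by
      rw [hι₂a, hV₀, ← WithLp.toLp_add]; simp
    rw [e] at h
    simpa [hι₂a, prod_inner, WithLp.prod_norm_sq_eq_of_L2, ← hb, hπ₂a] using h
  set B₁ := π₁ ∘L B ∘L ι₁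
  set B₂ := π₂ ∘L B ∘L ι₂
  have hcross : ∀ ξ ζ, inner ℝ (B₁ ξ) ξ + inner ℝ (B₂ ζ) ζ ≤ - 2 * α * inner ℝ ξ ζ := by
    intro ξ ζ
    refine le_of_forall_pos_le_add fun η₀ hη₀ => ?_
    set η' : ℝ := η₀ / (2 * (‖ξ‖ ^ 2 + ‖ζ‖ ^ 2 + 1)) with hη'
    have hη'0 : 0 < η' := by positivity
    have hη'1 : 2 * η' * (‖ξ‖ ^ 2 + ‖ζ‖ ^ 2) ≤ η₀ := by
      have : 2 * η' * (‖ξ‖ ^ 2 + ‖ζ‖ ^ 2 + 1) = η₀ := by rw [hη']; field_simp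
      nlinarith
    have hc : ∀ v : E, Tendsto (fun s : ℝ => s • v) (𝓝[>] 0) (𝓝 0) := fun v =>
      ((continuous_id.smul continuous_const).tendsto' 0 0 (by simp)).mono_left nhdsWithin_le_nhds
    obtain ⟨s, ⟨h1, h2⟩, hs⟩ := (((hc ξ).eventually (hT1 η' hη'0)).and
      ((hc ζ).eventually (hT2 η' hη'0))|>.and self_mem_nhdsWithin).exists
    have hs0 : (0 : ℝ) < s := hs
    have h3 := hV2 (WithLp.toLp 2 (x + s • ξ, y + s • ζ))
    have e1 := norm_add_sub_sq x y (s • ξ) (s • ζ)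
    have e2 := norm_add_sub_sq x y (s • ξ) 0
    have e3 := norm_add_sub_sq x y 0 (s • ζ)
    have e4 : ‖s • ξ - s • ζ‖ ^ 2 = ‖s • ξ‖ ^ 2 - 2 * (s ^ 2 * inner ℝ ξ ζ) + ‖s • ζ‖ ^ 2 := by
      rw [norm_sub_sq_real, real_inner_smul_left, real_inner_smul_right]; ring
    have m1 : ‖s • ξ‖ ^ 2 = s ^ 2 * ‖ξ‖ ^ 2 := by
      rw [norm_smul, mul_pow, Real.norm_eq_abs, sq_abs]
    have m2 : ‖s • ζ‖ ^ 2 = s ^ 2 * ‖ζ‖ ^ 2 := by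
      rw [norm_smul, mul_pow, Real.norm_eq_abs, sq_abs]
    have h1' := (abs_le.1 h1).1
    have h2' := (abs_le.1 h2).1
    rw [m1] at h1'
    rw [m2] at h2'
    simp only [prod_inner, WithLp.sub_fst, WithLp.sub_snd] at h3
    rw [← ha, ← hb] at h3
    rw [e4] at e1
    simp only [zero_sub, norm_neg, sub_zero, add_zero, inner_sub_right, inner_neg_right] at e1 e2 e3
    simp only [hg, hV₀, WithLp.toLp_fst, WithLp.toLp_snd, map_smul, real_inner_smul_left,
      real_inner_smul_right,
      add_sub_cancel_left, sub_zero] at h1' h2' h3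
    rw [e2] at h1'
    rw [e3] at h2'
    rw [e1] at h3
    simp only [real_inner_smul_right] at h1' h2' h3
    have hfin : s ^ 2 * (1 / 2 * inner ℝ (B₁ ξ) ξ + 1 / 2 * inner ℝ (B₂ ζ) ζ
        + α * inner ℝ ξ ζ - η' * (‖ξ‖ ^ 2 + ‖ζ‖ ^ 2)) ≤ 0 := by
      linarith
    have := nonpos_of_mul_nonpos_right hfin (by positivity)
    linarith
  refine ⟨Zu x, Zw y, ε⁻¹ • (Zu x - x), ε⁻¹ • (Zw y - y),
    B₁ + (α + η) • ContinuousLinearMap.id ℝ E, B₂ + (α + η) • ContinuousLinearMap.id ℝ E,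
    ?_, ?_, ?_, ?_, ?_, ?_, ?_⟩
  · have : Zu x - x₁ = (x - x₁) - (x - Zu x) := by abel
    rw [this]
    linarith [norm_sub_le (x - x₁) (x - Zu x)]
  · have : Zw y - y₁ = (y - y₁) - (y - Zw y) := by abel
    rw [this]
    linarith [norm_sub_le (y - y₁) (y - Zw y)]
  · rw [hq1]
    linarith [norm_add_le (a + α • ((x - x₁) - (y - y₁))) (η • (x - x₁)),
      norm_add_le a (α • ((x - x₁) - (y - y₁)))]
  · rw [hq2]
    linarith [norm_add_le (b - α • ((x - x₁) - (y - y₁))) (η • (y - y₁)),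
      norm_sub_le b (α • ((x - x₁) - (y - y₁)))]
  · refine jup_of_sup_convolution hZu fun η' hη' => ?_
    filter_upwards [hT1 η' hη'] with h hh
    have hh := (abs_le.1 hh).2
    have e2 := norm_add_sub_sq x y h 0
    have e3 := norm_add_sub_sq x x₁ h 0
    simp only [sub_zero, add_zero] at e2 e3
    simp only [hg, hV₀, WithLp.toLp_fst, WithLp.toLp_snd, e2, e3] at hh
    have : inner ℝ a h = inner ℝ (ε⁻¹ • (Zu x - x)) h - α * inner ℝ (x - y) h
        - η * inner ℝ (x - x₁) h := by
      rw [ha', inner_sub_left, inner_sub_left, real_inner_smul_left (x - y),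
        real_inner_smul_left (x - x₁)]
    simp only [_root_.add_apply, _root_.smul_apply, ContinuousLinearMap.id_apply, inner_add_left,
      real_inner_smul_left h, real_inner_self_eq_norm_sq]
    linarith
  · refine jup_of_sup_convolution hZw fun η' hη' => ?_
    filter_upwards [hT2 η' hη'] with h hh
    have hh := (abs_le.1 hh).2
    have e2 := norm_add_sub_sq x y 0 h
    have e3 := norm_add_sub_sq y y₁ h 0
    simp only [sub_zero, add_zero, zero_sub, inner_neg_right, norm_neg] at e2 e3
    simp only [hg, hV₀, WithLp.toLp_fst, WithLp.toLp_snd, e2, e3] at hh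
    have : inner ℝ b h = inner ℝ (ε⁻¹ • (Zw y - y)) h + α * inner ℝ (x - y) h
        - η * inner ℝ (y - y₁) h := by
      rw [hb', inner_sub_left, inner_add_left, real_inner_smul_left (x - y),
        real_inner_smul_left (y - y₁)]
    simp only [_root_.add_apply, _root_.smul_apply, ContinuousLinearMap.id_apply, inner_add_left,
      real_inner_smul_left h, real_inner_self_eq_norm_sq]
    linarith
  · intro ξ ζ
    have h := hcross ξ ζ
    simp only [_root_.add_apply, _root_.smul_apply, ContinuousLinearMap.id_apply, inner_add_left,
      real_inner_smul_left, real_inner_self_eq_norm_sq, norm_sub_sq_real]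
    linarith

end Sums

/-- Sum over the columns `σ i` of the diffusion root of the quadratic form `X`; equals
`tr (σ σᵗ X)`. -/
def colTrace {n : ℕ} (σ : Fin n → Euc n) (X : Euc n →L[ℝ] Euc n) : ℝ :=
  ∑ i, inner ℝ (X (σ i)) (σ i)

/-- Subsolution of `δ v_k - tr(σ_k σ_kᵗ D²v_k) + F_k(Dv_k, v_k - v_j, y) = 0` in terms of second
order superjets. -/
def JetSub {n m : ℕ} (σ : Fin m → Euc n → Fin n → Euc n)
    (F : Fin m → Euc n → (Fin m → ℝ) → Euc n → ℝ) (δ : ℝ) (v : Fin m → Euc n → ℝ) : Prop :=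
  ∀ k y q X, Jup (v k) y q X →
    δ * v k y - colTrace (σ k y) X + F k q (fun j => v k y - v j y) y ≤ 0

/-- Supersolution, tested only with subjets of slope less than `ℓ`. -/
def JetSup {n m : ℕ} (σ : Fin m → Euc n → Fin n → Euc n)
    (F : Fin m → Euc n → (Fin m → ℝ) → Euc n → ℝ) (δ ℓ : ℝ) (v : Fin m → Euc n → ℝ) : Prop :=
  ∀ k y q X, ‖q‖ < ℓ → Jup (fun z => -v k z) y q X →
    0 ≤ δ * v k y + colTrace (σ k y) X + F k (-q) (fun j => v k y - v j y) y

section Taylor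

variable {E : Type*} [NormedAddCommGroup E] [InnerProductSpace ℝ E]

theorem ContDiff.taylor_two {φ : E → ℝ} (hφ : ContDiff ℝ 2 φ) (y : E) {η : ℝ} (hη : 0 < η) :
    ∀ᶠ h in 𝓝 (0 : E), |φ (y + h) - φ y - fderiv ℝ φ y h
      - 1 / 2 * fderiv ℝ (fderiv ℝ φ) y h h| ≤ η * ‖h‖ ^ 2 := by
  have hd : Differentiable ℝ φ := hφ.differentiable (by norm_num)
  have hd2 : DifferentiableAt ℝ (fderiv ℝ φ) y :=
    (hφ.fderiv_right (m := 1) (by norm_num)).differentiable (by norm_num) y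
  have hsym : IsSymmSndFDerivAt ℝ φ y :=
    hφ.contDiffAt.isSymmSndFDerivAt (by simp)
  have h1 := (hasFDerivAt_iff_isLittleO_nhds_zero.1 hd2.hasFDerivAt).def hη
  obtain ⟨ρ, hρ, hball⟩ := Metric.eventually_nhds_iff_ball.1 h1
  filter_upwards [Metric.ball_mem_nhds (0 : E) hρ] with h hh
  set T := fderiv ℝ (fderiv ℝ φ) y with hT
  set g : E → ℝ := fun h => φ (y + h) - fderiv ℝ φ y h - 1 / 2 * T h h with hg
  have hder : ∀ x, HasFDerivAt g (fderiv ℝ φ (y + x) - fderiv ℝ φ y - T x) x := by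
    intro x
    have a1 : HasFDerivAt (fun h => φ (y + h)) (fderiv ℝ φ (y + x)) x :=
      ((hd (y + x)).hasFDerivAt.comp x ((hasFDerivAt_id x).const_add y)).congr_fderiv
        (ContinuousLinearMap.comp_id _)
    have a2 := (fderiv ℝ φ y).hasFDerivAt (x := x)
    have a3 : HasFDerivAt (fun h => T h h) (T x + T.flip x) x := by
      refine (T.hasFDerivAt.clm_apply (hasFDerivAt_id x)).congr_fderiv ?_
      ext z
      simp [T]
    refine ((a1.sub a2).sub (a3.const_mul (1 / 2))).congr_fderiv ?_
    ext z
    have := hsym z x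
    simp only [← hT] at this
    simp [this]
    ring
  have key := (convex_closedBall (0 : E) ‖h‖).norm_image_sub_le_of_norm_hasFDerivWithin_le
    (f := g) (C := η * ‖h‖) (fun x _ => (hder x).hasFDerivWithinAt) (fun x hx => by
      have hx' : ‖x‖ ≤ ‖h‖ := by simpa using hx
      have hxb : x ∈ Metric.ball (0 : E) ρ := by
        simp at hh ⊢; exact lt_of_le_of_lt hx' hh
      have := hball x hxb
      exact this.trans (by gcongr)) (x := 0) (y := h) (by simp) (by simp)
  simp only [hg, sub_zero, add_zero, map_zero, mul_zero, Real.norm_eq_abs] at key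
  calc _ = |φ (y + h) - fderiv ℝ φ y h - 1 / 2 * T h h - φ y| := by ring_nf
    _ ≤ η * ‖h‖ * ‖h‖ := key
    _ = _ := by ring

theorem exists_bilin_of_clm (X : E →L[ℝ] E) :
    ∃ T : E →L[ℝ] E →L[ℝ] ℝ, ∀ a b, T a b = inner ℝ (X a) b :=
  ⟨LinearMap.mkContinuous₂ ((innerₗ E).comp X.toLinearMap) ‖X‖ fun a b => by
      have h1 : |inner ℝ (X a) b| ≤ ‖X a‖ * ‖b‖ := abs_real_inner_le_norm _ _
      have h2 : ‖X a‖ * ‖b‖ ≤ ‖X‖ * ‖a‖ * ‖b‖ := by gcongr; exact X.le_opNorm a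
      simpa using h1.trans h2, fun a b => by simp⟩

theorem quadratic_test (q y : E) (X : E →L[ℝ] E) :
    ContDiff ℝ 2 (fun z => inner ℝ q (z - y) + 1 / 2 * inner ℝ (X (z - y)) (z - y)) ∧
    HasFDerivAt (fun z => inner ℝ q (z - y) + 1 / 2 * inner ℝ (X (z - y)) (z - y))
      (innerSL ℝ q) y ∧
    ∀ h, fderiv ℝ (fderiv ℝ
      (fun z => inner ℝ q (z - y) + 1 / 2 * inner ℝ (X (z - y)) (z - y))) y h h
      = inner ℝ (X h) h := by
  obtain ⟨T, hT⟩ := exists_bilin_of_clm X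
  have hder : ∀ z, HasFDerivAt
      (fun z => inner ℝ q (z - y) + 1 / 2 * inner ℝ (X (z - y)) (z - y))
      (innerSL ℝ q + (1 / 2 : ℝ) • (T (z - y) + T.flip (z - y))) z := by
    intro z
    have a0 : HasFDerivAt (fun z : E => z - y) (ContinuousLinearMap.id ℝ E) z :=
      (hasFDerivAt_id z).sub_const y
    have a1 := ((innerSL ℝ q).hasFDerivAt (x := z - y)).comp z a0
    have a2 : HasFDerivAt (fun z : E => T (z - y)) T z := T.hasFDerivAt.comp z a0
    have a3 : HasFDerivAt (fun z => T (z - y) (z - y)) (T (z - y) + T.flip (z - y)) z := by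
      refine (a2.clm_apply a0).congr_fderiv ?_
      ext w
      simp
    simp only [hT] at a3
    exact a1.add (a3.const_mul (1 / 2))
  refine ⟨?_, ?_, ?_⟩
  · exact (contDiff_const.inner ℝ (contDiff_id.sub contDiff_const)).add
      (contDiff_const.mul ((X.contDiff.comp (contDiff_id.sub contDiff_const)).inner ℝ
        (contDiff_id.sub contDiff_const)))
  · simpa using hder y
  · intro h
    have e := funext fun z => (hder z).fderiv
    rw [e]
    have a0 : HasFDerivAt (fun z : E => z - y) (ContinuousLinearMap.id ℝ E) y :=
      (hasFDerivAt_id y).sub_const y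
    have a1 : HasFDerivAt (fun z : E => innerSL ℝ q + (1 / 2 : ℝ) • (T (z - y) + T.flip (z - y)))
        ((1 / 2 : ℝ) • (T + T.flip)) y := by
      have b1 : HasFDerivAt (fun z : E => T (z - y)) T y := T.hasFDerivAt.comp y a0
      have b2 : HasFDerivAt (fun z : E => T.flip (z - y)) T.flip y := T.flip.hasFDerivAt.comp y a0
      exact ((b1.add b2).const_smul (1 / 2 : ℝ)).const_add _
    rw [a1.fderiv]
    simp [hT]
    ring

end Taylor

section Equivalence

variable {n m : ℕ}

/-- The columns of the diffusion root `Σ_k`. -/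
def sigCol (S : Setting n m) (ω : S.Ω) (k : Fin m) (y : Euc n) (i : Fin n) : Euc n :=
  WithLp.toLp 2 fun a => S.Sig k y ω a i

/-- The Hamiltonian of the approximate macroscopic system as a function of slope, differences and
position. -/
def shiftedHam (S : Setting n m) (p : Euc n) (r : ℝ) (ω : S.Ω) (k : Fin m) (q : Euc n)
    (s : Fin m → ℝ) (y : Euc n) : ℝ :=
  S.H k (p + q) (fun _ => r) s y ω

theorem trace_mul_hess (S : Setting n m) (ω : S.Ω) (k : Fin m) (y : Euc n) (φ : Euc n → ℝ) :
    (S.A k y ω * hess φ y).trace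
      = ∑ i, fderiv ℝ (fderiv ℝ φ) y (sigCol S ω k y i) (sigCol S ω k y i) := by
  set T := fderiv ℝ (fderiv ℝ φ) y with hT
  have hs : ∀ i, sigCol S ω k y i
      = ∑ a, S.Sig k y ω a i • EuclideanSpace.single a (1 : ℝ) := by
    intro i
    ext b
    simp [sigCol, Pi.single_apply]
  have hh : ∀ a b, hess φ y a b
      = T (EuclideanSpace.single a (1 : ℝ)) (EuclideanSpace.single b (1 : ℝ)) := by
    intro a b
    simp [hess, iteratedFDeriv_two_apply, hT]
  simp only [hs, map_sum, map_smul, _root_.sum_apply, _root_.smul_apply,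
    smul_eq_mul, ← hh, S.A_sq]
  simp only [Matrix.trace, Matrix.diag, Matrix.mul_apply, Matrix.transpose_apply,
    Finset.sum_mul, Finset.mul_sum]
  conv_lhs => enter [2, a]; rw [Finset.sum_comm]
  rw [Finset.sum_comm]
  refine Finset.sum_congr rfl fun i _ => ?_
  refine Finset.sum_congr rfl fun a _ => ?_
  refine Finset.sum_congr rfl fun b _ => ?_
  ring

theorem isViscSubOn_of_jetSub {S : Setting n m} {p : Euc n} {r δ : ℝ} {ω : S.Ω}
    {v : Fin m → Euc n → ℝ} (h : JetSub (sigCol S ω) (shiftedHam S p r ω) δ v) :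
    IsViscSubOn (macroOp S p r δ ω) Set.univ v := by
  intro k φ hφ y _ hmax
  have hd : DifferentiableAt ℝ φ y := hφ.differentiable (by norm_num) y
  set T := fderiv ℝ (fderiv ℝ φ) y with hT
  set X : Euc n →L[ℝ] Euc n := InnerProductSpace.continuousLinearMapOfBilin T with hX
  have hXT : ∀ a b, inner ℝ (X a) b = T a b := fun a b =>
    InnerProductSpace.continuousLinearMapOfBilin_apply T a b
  have hj : Jup (v k) y (gradient φ y) X := by
    intro η hη
    have h1 : ∀ᶠ h in 𝓝 (0 : Euc n), v k (y + h) - φ (y + h) ≤ v k y - φ y := by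
      have h2 : ∀ᶠ z in 𝓝 y, v k z - φ z ≤ v k y - φ y := by
        simpa [IsLocalMaxOn, IsMaxFilter] using hmax
      have ht : Tendsto (fun h : Euc n => y + h) (𝓝 0) (𝓝 y) := by
        simpa using (continuous_const.add continuous_id).tendsto (f := fun h : Euc n => y + h) 0
      exact ht.eventually h2
    filter_upwards [h1, hφ.taylor_two y hη] with h h1 h2
    have h3 := (abs_le.1 h2).2
    have h4 : inner ℝ (gradient φ y) h = fderiv ℝ φ y h := by
      simp [gradient]
    rw [h4, hXT]
    linarith
  have := h k y _ X hj
  simp only [macroOp, trace_mul_hess]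
  simpa [colTrace, hXT, shiftedHam] using this

theorem colTrace_neg (σ : Fin n → Euc n) (X : Euc n →L[ℝ] Euc n) :
    colTrace σ (-X) = - colTrace σ X := by
  simp [colTrace]

theorem colTrace_add (σ : Fin n → Euc n) (X Y : Euc n →L[ℝ] Euc n) :
    colTrace σ (X + Y) = colTrace σ X + colTrace σ Y := by
  simp [colTrace, inner_add_left, Finset.sum_add_distrib]

theorem colTrace_smul_id (σ : Fin n → Euc n) (t : ℝ) :
    colTrace σ (t • ContinuousLinearMap.id ℝ (Euc n)) = t * ∑ i, ‖σ i‖ ^ 2 := by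
  simp [colTrace, Finset.mul_sum, real_inner_smul_left]

theorem hess_neg (φ : Euc n → ℝ) (y : Euc n) : hess (fun z => - φ z) y = - hess φ y := by
  ext a b
  simp only [hess, Matrix.neg_apply]
  rw [show (fun z => - φ z) = -φ from rfl, iteratedFDeriv_neg_apply]
  simp

theorem gradient_neg (φ : Euc n → ℝ) (y : Euc n) :
    gradient (fun z => - φ z) y = - gradient φ y := by
  simp [gradient]

theorem isViscSupOn_of_jetSup {S : Setting n m} {p : Euc n} {r δ : ℝ} {ω : S.Ω}
    {v : Fin m → Euc n → ℝ} (h : ∀ ℓ, JetSup (sigCol S ω) (shiftedHam S p r ω) δ ℓ v) :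
    IsViscSupOn (macroOp S p r δ ω) Set.univ v := by
  intro k φ hφ y _ hmin
  have hφ' : ContDiff ℝ 2 (fun z => - φ z) := hφ.neg
  set T := fderiv ℝ (fderiv ℝ (fun z => - φ z)) y with hT
  set X : Euc n →L[ℝ] Euc n := InnerProductSpace.continuousLinearMapOfBilin T with hX
  have hXT : ∀ a b, inner ℝ (X a) b = T a b := fun a b =>
    InnerProductSpace.continuousLinearMapOfBilin_apply T a b
  have hj : Jup (fun z => - v k z) y (gradient (fun z => - φ z) y) X := by
    intro η hη
    have h1 : ∀ᶠ h in 𝓝 (0 : Euc n), v k y - φ y ≤ v k (y + h) - φ (y + h) := by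
      have h2 : ∀ᶠ z in 𝓝 y, v k y - φ y ≤ v k z - φ z := by
        simpa [IsLocalMinOn, IsMinFilter] using hmin
      have ht : Tendsto (fun h : Euc n => y + h) (𝓝 0) (𝓝 y) := by
        simpa using (continuous_const.add continuous_id).tendsto (f := fun h : Euc n => y + h) 0
      exact ht.eventually h2
    filter_upwards [h1, hφ'.taylor_two y hη] with h h1 h2
    have h3 := (abs_le.1 h2).2
    have h4 : inner ℝ (gradient (fun z => - φ z) y) h = fderiv ℝ (fun z => - φ z) y h := by
      simp [gradient]
    rw [h4, hXT]
    linarith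
  have := h (‖gradient (fun z => - φ z) y‖ + 1) k y _ X (by linarith) hj
  have ht : (S.A k y ω * hess φ y).trace = - colTrace (sigCol S ω k y) X := by
    have := trace_mul_hess S ω k y (fun z => - φ z)
    rw [hess_neg, Matrix.mul_neg, Matrix.trace_neg] at this
    simp only [colTrace, hXT]
    linarith
  simp only [macroOp, ht]
  simpa [gradient_neg, shiftedHam] using this

theorem le_zero_of_forall_sub_mul_le {a b : ℝ} (h : ∀ η, 0 < η → a - η * b ≤ 0) : a ≤ 0 := by
  have : Tendsto (fun η : ℝ => a - η * b) (𝓝[>] 0) (𝓝 (a - 0 * b)) :=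
    ((continuous_const.sub (continuous_id.mul continuous_const)).tendsto 0).mono_left
      nhdsWithin_le_nhds
  have := le_of_tendsto this (by filter_upwards [self_mem_nhdsWithin] with η hη using h η hη)
  linarith

/-- A test function realizing a superjet up to a small quadratic term. -/
theorem Jup.test {f : Euc n → ℝ} {y q : Euc n} {X : Euc n →L[ℝ] Euc n} (h : Jup f y q X)
    {η : ℝ} (hη : 0 < η) : ∃ φ : Euc n → ℝ, ContDiff ℝ 2 φ ∧ gradient φ y = q ∧
      (∀ h, fderiv ℝ (fderiv ℝ φ) y h h = inner ℝ (X h) h + η * ‖h‖ ^ 2) ∧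
      ∀ᶠ z in 𝓝 y, f z - φ z ≤ f y - φ y := by
  obtain ⟨h1, h2, h3⟩ := quadratic_test q y (X + η • ContinuousLinearMap.id ℝ (Euc n))
  refine ⟨_, h1, ?_, ?_, ?_⟩
  · rw [gradient, h2.fderiv]
    apply (InnerProductSpace.toDual ℝ (Euc n)).injective
    ext
    simp
  · intro h
    rw [h3 h]
    simp [inner_add_left, real_inner_smul_left]
  · have ht : Tendsto (fun z : Euc n => z - y) (𝓝 y) (𝓝 0) := by
      simpa using (continuous_id.sub continuous_const).tendsto (f := fun z : Euc n => z - y) y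
    filter_upwards [ht.eventually (h (η / 2) (by positivity))] with z hz
    simp only [add_sub_cancel] at hz
    simp only [sub_self, map_zero, inner_zero_right, mul_zero, add_zero, sub_zero,
      _root_.add_apply, _root_.smul_apply, ContinuousLinearMap.id_apply, inner_add_left,
      real_inner_smul_left, real_inner_self_eq_norm_sq]
    linarith

theorem jetSub_of_isViscSubOn {S : Setting n m} {p : Euc n} {r δ : ℝ} {ω : S.Ω}
    {v : Fin m → Euc n → ℝ} (h : IsViscSubOn (macroOp S p r δ ω) Set.univ v) :
    JetSub (sigCol S ω) (shiftedHam S p r ω) δ v := by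
  intro k y q X hj
  refine le_zero_of_forall_sub_mul_le (b := ∑ i, ‖sigCol S ω k y i‖ ^ 2) fun η hη => ?_
  obtain ⟨φ, h1, h2, h3, h4⟩ := hj.test hη
  have := h k φ h1 y trivial (by simpa [IsLocalMaxOn, IsMaxFilter] using h4)
  simp only [macroOp, trace_mul_hess, h3, h2, Finset.sum_add_distrib, ← Finset.mul_sum] at this
  simp only [colTrace, shiftedHam]
  linarith

theorem jetSup_of_isViscSupOn {S : Setting n m} {p : Euc n} {r δ : ℝ} {ω : S.Ω}
    {v : Fin m → Euc n → ℝ} (h : IsViscSupOn (macroOp S p r δ ω) Set.univ v) (ℓ : ℝ) :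
    JetSup (sigCol S ω) (shiftedHam S p r ω) δ ℓ v := by
  intro k y q X _ hj
  rw [← neg_nonpos]
  refine le_zero_of_forall_sub_mul_le (b := ∑ i, ‖sigCol S ω k y i‖ ^ 2) fun η hη => ?_
  obtain ⟨φ, h1, h2, h3, h4⟩ := hj.test hη
  have := h k (fun z => - φ z) h1.neg y trivial (by
    have : ∀ᶠ z in 𝓝 y, v k y - - φ y ≤ v k z - - φ z := by
      filter_upwards [h4] with z hz
      linarith
    simpa [IsLocalMinOn, IsMinFilter] using this)
  simp only [macroOp, hess_neg, Matrix.mul_neg, Matrix.trace_neg, gradient_neg, trace_mul_hess, h3,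
    h2, Finset.sum_add_distrib, ← Finset.mul_sum] at this
  simp only [colTrace, shiftedHam]
  linarith

end Equivalence

/-- Structural constants controlling the coefficients of a system. -/
structure StructBounds where
  c : ℝ
  S : ℝ
  coe : ℝ → ℝ
  bdd : ℝ → ℝ
  lipy : ℝ → ℝ
  lip : ℝ → ℝ
  c_pos : 0 < c
  S_pos : 0 < S
  coe_pos : ∀ a, 0 < coe a
  bdd_pos : ∀ R, 0 < bdd R
  lipy_pos : ∀ R, 0 < lipy R
  lip_pos : ∀ R, 0 < lip R

/-- The coefficients `σ, F` obey the structural constants `K`. -/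
structure Admissible {n m : ℕ} (K : StructBounds) (σ : Fin m → Euc n → Fin n → Euc n)
    (F : Fin m → Euc n → (Fin m → ℝ) → Euc n → ℝ) : Prop where
  sig_bdd : ∀ k y i, ‖σ k y i‖ ≤ K.S
  sig_lip : ∀ k x y i, ‖σ k x i - σ k y i‖ ≤ K.S * ‖x - y‖
  mono : ∀ k q s s' y, s ≤ s' → F k q s y ≤ F k q s' y
  coer : ∀ a, 0 ≤ a → ∀ k q s y, a * ‖q‖ - K.coe a ≤ F k q s y
  coer' : ∀ a, 0 ≤ a → ∀ k q s y i, i ≠ k → a * ‖q‖ + K.c * s i - K.coe a ≤ F k q s y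
  bound : ∀ R k q s y, ‖q‖ ≤ R → ‖s‖ ≤ R → |F k q s y| ≤ K.bdd R
  lip_y : ∀ R k q s y y', ‖s‖ ≤ R → |F k q s y - F k q s y'| ≤ K.lipy R * ‖y - y'‖
  lip_qs : ∀ R k q q' s s' y, ‖q‖ ≤ R → ‖q'‖ ≤ R → ‖s‖ ≤ R → ‖s'‖ ≤ R →
    |F k q s y - F k q' s' y| ≤ K.lip R * (‖q - q'‖ + ‖s - s'‖)

section Structure

variable {n m : ℕ}

theorem Euc.norm_le_of_forall_abs_le {x : Euc n} {C : ℝ} (h : ∀ i, |x i| ≤ C) :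
    ‖x‖ ≤ n * C := by
  have e : x = ∑ a, x a • EuclideanSpace.single a (1 : ℝ) := by
    ext b
    simp [Pi.single_apply]
  calc ‖x‖ = ‖∑ a, x a • EuclideanSpace.single a (1 : ℝ)‖ := by rw [← e]
    _ ≤ ∑ a, ‖x a • EuclideanSpace.single a (1 : ℝ)‖ := norm_sum_le _ _
    _ ≤ ∑ _a : Fin n, C := Finset.sum_le_sum fun a _ => by simpa [norm_smul] using h a
    _ = n * C := by simp

theorem exists_linear_le_rpow {c γ a : ℝ} (hc : 0 < c) (hγ : 1 < γ) (ha : 0 ≤ a) :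
    ∃ C, 0 ≤ C ∧ ∀ t, 0 ≤ t → a * t ≤ c * t ^ γ + C := by
  set T : ℝ := (a / c) ^ (1 / (γ - 1)) with hT
  have hT0 : 0 ≤ T := by positivity
  refine ⟨a * T, by positivity, fun t ht => ?_⟩
  rcases le_total t T with h | h
  · have : a * t ≤ a * T := by gcongr
    have : 0 ≤ c * t ^ γ := by positivity
    linarith
  · have h1 : a / c ≤ t ^ (γ - 1) := by
      calc a / c = T ^ (γ - 1) := by
            rw [hT, ← Real.rpow_mul (by positivity), one_div_mul_cancel (by linarith),
              Real.rpow_one]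
        _ ≤ t ^ (γ - 1) := Real.rpow_le_rpow hT0 h (by linarith)
    have h2 : t ^ γ = t ^ (γ - 1) * t := by
      rcases ht.eq_or_lt with h0 | h0
      · rw [← h0, Real.zero_rpow (by linarith)]; simp
      · rw [Real.rpow_sub_one h0.ne']; field_simp
    have h3 : a ≤ c * t ^ (γ - 1) := by
      rw [div_le_iff₀ hc] at h1; linarith
    have h4 : a * t ≤ c * t ^ (γ - 1) * t := by gcongr
    have : 0 ≤ a * T := by positivity
    rw [h2]; linarith

theorem Setting.H_mono_diff (S : Setting n m) (k : Fin m) (p : Euc n) (r : Fin m → ℝ)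
    {s s' : Fin m → ℝ} (hs : s ≤ s') (y : Euc n) (ω : S.Ω) :
    S.H k p r s y ω ≤ S.H k p r s' y ω := by
  have key : ∀ t : Finset (Fin m), S.H k p r s y ω ≤ S.H k p r (t.piecewise s' s) y ω := by
    intro t
    induction t using Finset.induction_on with
    | empty => simp
    | insert j t hj ih =>
      refine ih.trans ?_
      rw [Finset.piecewise_insert]
      have := S.H_mono_s k p r (t.piecewise s' s) y ω j (t.piecewise s' s j) (s' j) (by
        simpa [hj] using hs j)
      simpa using this
  simpa using key Finset.univ

theorem le_posMaxOff {k i : Fin m} (hi : i ≠ k) (s : Fin m → ℝ) : s i ≤ posMaxOff k s := by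
  have h : (s i).toNNReal ≤ (Finset.univ.erase k).sup fun i => (s i).toNNReal :=
    Finset.le_sup (f := fun i => (s i).toNNReal) (by simp [hi])
  exact (Real.le_coe_toNNReal _).trans (NNReal.coe_le_coe.2 h)

theorem posMaxOff_nonneg (k : Fin m) (s : Fin m → ℝ) : 0 ≤ posMaxOff k s := NNReal.coe_nonneg _

theorem exists_structBounds (S : Setting n m) (p : Euc n) (r : ℝ) :
    ∃ K : StructBounds, ∀ ω, Admissible K (sigCol S ω) (shiftedHam S p r ω) := by
  obtain ⟨Cs, hCs, hsig⟩ := S.Sig_lip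
  obtain ⟨C₁, C₂, C₃, h1, h2, h3, hco⟩ := S.coercive (|r| + 1) (by positivity)
  have hr : ∀ R, 0 ≤ R → ‖(fun _ : Fin m => r)‖ ≤ |r| + 1 + R := fun R hR =>
    (pi_norm_le_iff_of_nonneg (by positivity)).2 fun _ => by
      rw [Real.norm_eq_abs]; linarith
  choose! G hG0 hG using fun (a : ℝ) (ha : 0 ≤ a) (k : Fin m) =>
    exists_linear_le_rpow h1 (S.γ_gt_one k) ha
  choose! B hB0 hB using S.H_bounded
  choose! Q hQ0 hQ using S.H_cont
  set rad : ℝ → ℝ := fun R => |r| + 1 + (|R| + ‖p‖) with hrad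
  have hrad0 : ∀ R, 0 < rad R := fun R => by positivity
  set Γ : ℝ := ∑ k, |S.γ k| with hΓ
  have hbase : ∀ R, (0:ℝ) < 1 + 2 * rad R := fun R => by have := hrad0 R; positivity
  have hcoe : ∀ a, 0 ≤ a → ∀ ω k q s y, a * ‖q‖ + C₂ * posMaxOff k s
      - ((∑ k, G a k) + a * ‖p‖ + C₃) ≤ shiftedHam S p r ω k q s y := by
    intro a ha ω k q s y
    have e1 := hco k (p + q) (fun _ => r) s y ω (by simpa using hr 0 le_rfl)
    have e2 := hG a ha k ‖p + q‖ (norm_nonneg _)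
    have e3 : G a k ≤ ∑ k, G a k :=
      Finset.single_le_sum (f := G a) (fun k _ => hG0 a ha k) (Finset.mem_univ k)
    have e4 : ‖q‖ ≤ ‖p + q‖ + ‖p‖ := by
      have := norm_sub_le (p + q) p
      simpa using this
    have e5 : a * ‖q‖ ≤ a * (‖p + q‖ + ‖p‖) := by gcongr
    simp only [shiftedHam]
    linarith
  have hcle : ∀ a, 0 ≤ a → (∑ k, G a k) + a * ‖p‖ + C₃ ≤ |(∑ k, G a k) + a * ‖p‖ + C₃| + 1 :=
    fun a _ => by linarith [le_abs_self ((∑ k, G a k) + a * ‖p‖ + C₃)]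
  refine ⟨⟨C₂, (n + 1) * Cs, fun a => |(∑ k, G a k) + a * ‖p‖ + C₃| + 1, fun R => B (rad R),
    fun R => Q (rad R), fun R => Q (rad R) * ((1 + 2 * rad R) ^ Γ + 1), h2, by positivity,
    fun a => by positivity, fun R => hB0 _ (hrad0 R), fun R => hQ0 _ (hrad0 R),
    fun R => by have := hQ0 _ (hrad0 R); have := hbase R; positivity⟩, fun ω => ⟨?_, ?_, ?_, ?_,
      ?_, ?_, ?_, ?_⟩⟩
  · intro k y i
    have := Euc.norm_le_of_forall_abs_le (x := sigCol S ω k y i) (C := Cs) fun a =>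
      (hsig k ω a i).1 y
    simp only
    linarith
  · intro k x y i
    have := Euc.norm_le_of_forall_abs_le (x := sigCol S ω k x i - sigCol S ω k y i)
      (C := Cs * ‖x - y‖) fun a => (hsig k ω a i).2 x y
    have : 0 ≤ Cs * ‖x - y‖ := by positivity
    simp only
    linarith
  · intro k q s s' y hs
    exact S.H_mono_diff k _ _ hs y ω
  · intro a ha k q s y
    have e1 := hcoe a ha ω k q s y
    have e2 := mul_nonneg h2.le (posMaxOff_nonneg k s)
    have := hcle a ha
    simp only
    linarith
  · intro a ha k q s y i hi
    have e1 := hcoe a ha ω k q s y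
    have e2 := mul_le_mul_of_nonneg_left (le_posMaxOff hi s) h2.le
    have := hcle a ha
    simp only
    linarith
  · intro R k q s y hq hs
    have hR := (norm_nonneg q).trans hq
    have hR' := abs_of_nonneg hR
    refine hB _ (hrad0 R) _ _ _ _ _ _ ?_ ?_ ?_
    · have := norm_add_le p q
      simp only [hrad]; linarith [abs_nonneg r]
    · exact hr _ (by positivity)
    · simp only [hrad]; linarith [abs_nonneg r, norm_nonneg p]
  · intro R k q s y y' hs
    have hR := (norm_nonneg s).trans hs
    have hR' := abs_of_nonneg hR
    have hs' : ‖s‖ ≤ rad R := by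
      simp only [hrad]; linarith [abs_nonneg r, norm_nonneg p]
    have := hQ _ (hrad0 R) k (p + q) (p + q) (fun _ => r) (fun _ => r) s s y y' ω
      (hr _ (by positivity)) (hr _ (by positivity)) hs' hs'
    simpa [shiftedHam] using this
  · intro R k q q' s s' y hq hq' hs hs'
    have hR := (norm_nonneg q).trans hq
    have hR' := abs_of_nonneg hR
    have hsr : ∀ s : Fin m → ℝ, ‖s‖ ≤ R → ‖s‖ ≤ rad R := fun s hs => by
      simp only [hrad]; linarith [abs_nonneg r, norm_nonneg p]
    have hqr : ∀ q : Euc n, ‖q‖ ≤ R → ‖p + q‖ ≤ rad R := fun q hq => by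
      have := norm_add_le p q
      simp only [hrad]; linarith [abs_nonneg r, norm_nonneg p]
    have e := hQ _ (hrad0 R) k (p + q) (p + q') (fun _ => r) (fun _ => r) s s' y y ω
      (hr _ (by positivity)) (hr _ (by positivity)) (hsr s hs) (hsr s' hs')
    have hpow : (1 + ‖p + q‖ + ‖p + q'‖) ^ (S.γ k - 1) ≤ (1 + 2 * rad R) ^ Γ := by
      calc _ ≤ (1 + 2 * rad R) ^ (S.γ k - 1) := by
            refine Real.rpow_le_rpow (by positivity) ?_ (by linarith [S.γ_gt_one k])
            linarith [hqr q hq, hqr q' hq']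
        _ ≤ _ := by
            refine Real.rpow_le_rpow_of_exponent_le (by linarith [hrad0 R]) ?_
            have : |S.γ k| ≤ Γ := Finset.single_le_sum (f := fun k => |S.γ k|)
              (fun k _ => abs_nonneg _) (Finset.mem_univ k)
            linarith [le_abs_self (S.γ k)]
    have hQ1 := hQ0 _ (hrad0 R)
    have hb := hbase R
    simp only [add_sub_add_left_eq_sub, sub_self, norm_zero, add_zero] at e
    refine e.trans ?_
    rw [mul_assoc]
    refine mul_le_mul_of_nonneg_left ?_ hQ1.le
    have e1 : (1 + ‖p + q‖ + ‖p + q'‖) ^ (S.γ k - 1) * ‖q - q'‖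
        ≤ (1 + 2 * rad R) ^ Γ * ‖q - q'‖ := by gcongr
    have e2 : 0 ≤ (1 + 2 * rad R) ^ Γ * ‖s - s'‖ := by positivity
    nlinarith [norm_nonneg (q - q'), norm_nonneg (s - s')]

end Structure

section Jets

variable {E : Type*} [NormedAddCommGroup E] [InnerProductSpace ℝ E]

theorem norm_add_sq_sub_norm_sq (a h : E) : ‖a + h‖ ^ 2 - ‖a‖ ^ 2 = 2 * inner ℝ a h + ‖h‖ ^ 2 := by
  rw [norm_add_sq_real]; ring

theorem Jup.add_quadratic {f : E → ℝ} {β : ℝ} {a z q : E} {X : E →L[ℝ] E}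
    (h : Jup (fun x => f x - β / 2 * ‖x - a‖ ^ 2) z q X) :
    Jup f z (q + β • (z - a)) (X + β • ContinuousLinearMap.id ℝ E) := by
  intro η hη
  filter_upwards [h η hη] with x hx
  have e := norm_add_sq_sub_norm_sq (z - a) x
  rw [show z - a + x = z + x - a by abel] at e
  simp only [_root_.add_apply, _root_.smul_apply, ContinuousLinearMap.id_apply, inner_add_left,
    real_inner_smul_left, real_inner_self_eq_norm_sq]
  linear_combination hx + β / 2 * e

theorem Jup.of_le {f : E → ℝ} {z : E} (h : ∀ᶠ x in 𝓝 (0 : E), f (z + x) ≤ f z) :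
    Jup f z 0 0 := by
  intro η hη
  filter_upwards [h] with x hx
  have : 0 ≤ η * ‖x‖ ^ 2 := by positivity
  simp only [inner_zero_left, _root_.zero_apply]
  linarith

theorem Jup.of_max_quadratic {f : E → ℝ} {β : ℝ} {a z : E}
    (h : ∀ x, f x - β / 2 * ‖x - a‖ ^ 2 ≤ f z - β / 2 * ‖z - a‖ ^ 2) :
    Jup f z (β • (z - a)) (β • ContinuousLinearMap.id ℝ E) := by
  have := (Jup.of_le (f := fun x => f x - β / 2 * ‖x - a‖ ^ 2) (z := z)
    (Eventually.of_forall fun x => h _)).add_quadratic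
  simpa using this

theorem Jup.of_const_mul {f : E → ℝ} {θ : ℝ} (hθ : 0 < θ) {z q : E} {X : E →L[ℝ] E}
    (h : Jup (fun x => θ⁻¹ * f x) z q X) : Jup f z (θ • q) (θ • X) := by
  intro η hη
  filter_upwards [h (θ⁻¹ * η) (by positivity)] with x hx
  have := mul_le_mul_of_nonneg_left hx hθ.le
  simp only [_root_.smul_apply, real_inner_smul_left]
  field_simp at this
  linarith

theorem Jup.of_touch {f g : E → ℝ} {z q : E} {X : E →L[ℝ] E} (h : Jup g z q X)
    (hfg : ∀ᶠ x in 𝓝 z, f x ≤ g x) (he : g z ≤ f z) : Jup f z q X := by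
  intro η hη
  have ht : Tendsto (fun h : E => z + h) (𝓝 0) (𝓝 z) := by
    simpa using (continuous_const.add continuous_id).tendsto (f := fun h : E => z + h) 0
  filter_upwards [h η hη, ht.eventually hfg] with x h1 h2
  linarith

/-- The regularized norm `√(κ² + ‖z‖²)`. -/
def regNorm (κ : ℝ) (z : E) : ℝ := √(κ ^ 2 + ‖z‖ ^ 2)

theorem regNorm_sq {E : Type*} [NormedAddCommGroup E] (κ : ℝ) (z : E) :
    regNorm κ z ^ 2 = κ ^ 2 + ‖z‖ ^ 2 :=
  Real.sq_sqrt (by positivity)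

theorem regNorm_nonneg {E : Type*} [NormedAddCommGroup E] (κ : ℝ) (z : E) : 0 ≤ regNorm κ z :=
  Real.sqrt_nonneg _

theorem norm_le_regNorm {E : Type*} [NormedAddCommGroup E] (κ : ℝ) (z : E) : ‖z‖ ≤ regNorm κ z :=
  Real.le_sqrt_of_sq_le (by nlinarith [sq_nonneg κ])

theorem le_regNorm {E : Type*} [NormedAddCommGroup E] (κ : ℝ) (z : E) : κ ≤ regNorm κ z :=
  Real.le_sqrt_of_sq_le (by nlinarith [sq_nonneg ‖z‖])

theorem regNorm_le {E : Type*} [NormedAddCommGroup E] {κ : ℝ} (hκ : 0 ≤ κ) (z : E) :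
    regNorm κ z ≤ κ + ‖z‖ :=
  Real.sqrt_le_iff.2 ⟨by positivity, by nlinarith [mul_nonneg hκ (norm_nonneg z)]⟩

theorem regNorm_zero_left {E : Type*} [NormedAddCommGroup E] (z : E) : regNorm 0 z = ‖z‖ := by
  simp [regNorm]

theorem regNorm_add_le (κ : ℝ) (a b : E) : regNorm κ (a + b) ≤ regNorm κ a + ‖b‖ := by
  refine Real.sqrt_le_iff.2 ⟨add_nonneg (regNorm_nonneg _ _) (norm_nonneg _), ?_⟩
  have h1 := regNorm_sq κ a
  have h2 := norm_add_sq_real a b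
  have h3 := real_inner_le_norm a b
  have h4 := mul_le_mul_of_nonneg_right (norm_le_regNorm κ a) (norm_nonneg b)
  nlinarith

theorem continuous_regNorm {E : Type*} [NormedAddCommGroup E] (κ : ℝ) :
    Continuous (regNorm κ : E → ℝ) := by
  unfold regNorm; fun_prop

theorem regNorm_le_quadratic {E : Type*} [NormedAddCommGroup E] {κ c : ℝ} (hc : 0 < c) (z : E) :
    regNorm κ z ≤ c / 2 + (κ ^ 2 + ‖z‖ ^ 2) / (2 * c) := by
  rw [← regNorm_sq]
  have : c / 2 + regNorm κ z ^ 2 / (2 * c) - regNorm κ z = (regNorm κ z - c) ^ 2 / (2 * c) := by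
    field_simp; ring
  have : 0 ≤ (regNorm κ z - c) ^ 2 / (2 * c) := by positivity
  linarith

/-- A penalization by the regularized norm may be replaced by a paraboloid at the maximum point. -/
theorem regNorm_sub_le {κ : ℝ} {w : E} (hc : 0 < regNorm κ w) (z : E) :
    regNorm κ z - regNorm κ w ≤ (regNorm κ w)⁻¹ / 2 * (‖z‖ ^ 2 - ‖w‖ ^ 2) := by
  have h1 := regNorm_le_quadratic (κ := κ) hc z
  have h2 := regNorm_sq κ w
  have : regNorm κ w / 2 + (κ ^ 2 + ‖z‖ ^ 2) / (2 * regNorm κ w) - regNorm κ w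
      = (regNorm κ w)⁻¹ / 2 * (κ ^ 2 + ‖z‖ ^ 2 - regNorm κ w ^ 2) := by
    field_simp; ring
  rw [h2] at this
  linarith

theorem Jup.of_max_regNorm {f : E → ℝ} {κ Λ : ℝ} (hΛ : 0 ≤ Λ) {a z : E}
    (hc : 0 < regNorm κ (z - a))
    (h : ∀ x, f x - Λ * regNorm κ (x - a) ≤ f z - Λ * regNorm κ (z - a)) :
    Jup f z ((Λ / regNorm κ (z - a)) • (z - a))
      ((Λ / regNorm κ (z - a)) • ContinuousLinearMap.id ℝ E) := by
  refine Jup.of_max_quadratic fun x => ?_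
  have h1 := mul_le_mul_of_nonneg_left (regNorm_sub_le hc (x - a)) hΛ
  have h2 := h x
  linear_combination h1 + h2

end Jets

section Bounds

variable {n m : ℕ} {σ : Fin m → Euc n → Fin n → Euc n}
  {F : Fin m → Euc n → (Fin m → ℝ) → Euc n → ℝ} {δ : ℝ} {v : Fin m → Euc n → ℝ} {K : StructBounds}

theorem Admissible.sum_sq_le (hK : Admissible K σ F) (k : Fin m) (y : Euc n) :
    ∑ i, ‖σ k y i‖ ^ 2 ≤ n * K.S ^ 2 := by
  calc ∑ i, ‖σ k y i‖ ^ 2 ≤ ∑ _i : Fin n, K.S ^ 2 := Finset.sum_le_sum fun i _ => by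
        have := hK.sig_bdd k y i
        gcongr
    _ = n * K.S ^ 2 := by simp

theorem exists_max_regNorm_penalty {f : Euc n → ℝ} (hf : Continuous f) {B : ℝ} (hB : ∀ x, f x ≤ B)
    {Λ : ℝ} (hΛ : 0 < Λ) (a : Euc n) :
    ∃ z, ∀ x, f x - Λ * regNorm 1 (x - a) ≤ f z - Λ * regNorm 1 (z - a) := by
  refine exists_max_of_le_sub_norm (C := B + Λ * ‖a‖) (c := Λ)
    (hf.sub (continuous_const.mul ((continuous_regNorm 1).comp
      (continuous_id.sub continuous_const)))) hΛ fun x => ?_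
  have h1 := norm_le_regNorm 1 (x - a)
  have h2 : ‖x‖ ≤ ‖x - a‖ + ‖a‖ := by
    simpa using norm_add_le (x - a) a
  have h3 : Λ * ‖x‖ ≤ Λ * (regNorm 1 (x - a) + ‖a‖) := by gcongr; linarith
  have := hB x
  linarith

theorem one_le_regNorm_one {E : Type*} [NormedAddCommGroup E] [InnerProductSpace ℝ E] (z : E) :
    1 ≤ regNorm 1 z := le_regNorm 1 z

theorem JetSub.mul_le (hv : JetSub σ F δ v) (hK : Admissible K σ F) (hδ : 0 < δ)
    (hc : ∀ k, Continuous (v k)) {B : ℝ} (hB : ∀ k y, v k y ≤ B) (k : Fin m) (y : Euc n) :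
    δ * v k y ≤ K.coe 0 := by
  rw [← sub_nonpos]
  refine le_zero_of_forall_sub_mul_le (b := n * K.S ^ 2 + δ * regNorm 1 (y - 0)) fun η hη => ?_
  obtain ⟨z, hz⟩ := exists_max_regNorm_penalty (hc k) (hB k) hη (0 : Euc n)
  have hc1 := one_le_regNorm_one (z - 0)
  have h1 := hv k z _ _ (Jup.of_max_regNorm hη.le (by linarith) hz)
  rw [colTrace_smul_id] at h1
  have h2 := hK.coer 0 le_rfl k ((η / regNorm 1 (z - 0)) • (z - 0))
    (fun j => v k z - v j z) z
  have h3 : η / regNorm 1 (z - 0) ≤ η := div_le_self hη.le hc1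
  have h4 : η / regNorm 1 (z - 0) * ∑ i, ‖σ k z i‖ ^ 2 ≤ η * (n * K.S ^ 2) :=
    mul_le_mul h3 (hK.sum_sq_le k z) (by positivity) hη.le
  have h5 := mul_le_mul_of_nonneg_left (hz y) hδ.le
  have h6 : 0 ≤ δ * (η * regNorm 1 (z - 0)) := by positivity
  linarith

theorem JetSup.le_mul [NeZero m] {ℓ : ℝ} (hv : JetSup σ F δ ℓ v) (hK : Admissible K σ F)
    (hδ : 0 < δ) (hℓ : 1 ≤ ℓ)
    (hc : ∀ k, Continuous (v k)) {B : ℝ} (hB : ∀ k y, -B ≤ v k y) (j : Fin m) (y : Euc n) :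
    -(K.bdd 1) ≤ δ * v j y := by
  rw [← sub_nonpos]
  have key : ∀ η, 0 < η → η < 1 →
      - K.bdd 1 - δ * v j y - η * (n * K.S ^ 2 + δ * regNorm 1 (y - 0)) ≤ 0 := by
    intro η hη hη1
    choose z hz using fun k => exists_max_regNorm_penalty (f := fun x => - v k x) (hc k).neg
      (B := B) (fun x => by linarith [hB k x]) hη (0 : Euc n)
    obtain ⟨k, hk⟩ := Finite.exists_max fun k => - v k (z k) - η * regNorm 1 (z k - 0)
    have hc1 := one_le_regNorm_one (z k - 0)
    have hq : ‖(η / regNorm 1 (z k - 0)) • (z k - 0)‖ ≤ η := by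
      rw [norm_smul, Real.norm_of_nonneg (by positivity), div_mul_eq_mul_div, div_le_iff₀
        (by linarith)]
      exact mul_le_mul_of_nonneg_left (norm_le_regNorm _ _) hη.le
    have h1 := hv k (z k) _ _ (by linarith) (Jup.of_max_regNorm hη.le (by linarith) (hz k))
    rw [colTrace_smul_id] at h1
    have h2 := hK.mono k (-((η / regNorm 1 (z k - 0)) • (z k - 0)))
      (fun j => v k (z k) - v j (z k)) 0 (z k) (fun j => by
        have := hk j
        have := hz j (z k)
        simp only [Pi.zero_apply]
        linarith)
    have h2' := (abs_le.1 (hK.bound 1 k (-((η / regNorm 1 (z k - 0)) • (z k - 0))) 0 (z k)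
      (by rw [norm_neg]; linarith) (by simp))).2
    have h3 : η / regNorm 1 (z k - 0) ≤ η := div_le_self hη.le hc1
    have h4 : η / regNorm 1 (z k - 0) * ∑ i, ‖σ k (z k) i‖ ^ 2 ≤ η * (n * K.S ^ 2) :=
      mul_le_mul h3 (hK.sum_sq_le k (z k)) (by positivity) hη.le
    have h5 := mul_le_mul_of_nonneg_left ((hz j y).trans (hk j)) hδ.le
    have h6 : 0 ≤ δ * (η * regNorm 1 (z k - 0)) := by positivity
    linarith
  have : Tendsto (fun η : ℝ => - K.bdd 1 - δ * v j y - η * (n * K.S ^ 2 + δ * regNorm 1 (y - 0)))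
      (𝓝[>] 0) (𝓝 (- K.bdd 1 - δ * v j y - 0 * (n * K.S ^ 2 + δ * regNorm 1 (y - 0)))) :=
    ((continuous_const.sub (continuous_id.mul continuous_const)).tendsto 0).mono_left
      nhdsWithin_le_nhds
  have := le_of_tendsto this (by
    filter_upwards [Ioo_mem_nhdsGT (one_pos (α := ℝ))] with η hη using key η hη.1 hη.2)
  linarith

theorem exists_barrier (K : StructBounds) (n : ℕ) {Cb : ℝ} (hCb : 0 ≤ Cb) : ∃ Λ : ℝ, 1 ≤ Λ ∧
    ∀ {m : ℕ} {σ : Fin m → Euc n → Fin n → Euc n}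
      {F : Fin m → Euc n → (Fin m → ℝ) → Euc n → ℝ} {δ : ℝ} {v : Fin m → Euc n → ℝ},
      Admissible K σ F → JetSub σ F δ v → (∀ k, Continuous (v k)) → ∀ B, (∀ k y, v k y ≤ B) →
      (∀ k y, -Cb ≤ δ * v k y) → ∀ k y, ∃ z, ‖z - y‖ ≤ 1 ∧
        ∀ x, v k x - Λ * regNorm 1 (x - y) ≤ v k z - Λ * regNorm 1 (z - y) := by
  obtain ⟨a, ha⟩ : ∃ a : ℝ, a = 2 * (n * K.S ^ 2 + 1) := ⟨_, rfl⟩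
  have ha0 : 0 ≤ a := by rw [ha]; positivity
  have hcoe := K.coe_pos a
  obtain ⟨Λ, hΛ⟩ : ∃ Λ : ℝ, Λ = Cb + K.coe a + 1 := ⟨_, rfl⟩
  refine ⟨Λ, by linarith, ?_⟩
  intro m σ F δ v hK hv hc B hB hb k y
  have hΛ0 : 0 < Λ := by linarith
  obtain ⟨z, hz⟩ := exists_max_regNorm_penalty (hc k) (hB k) hΛ0 y
  refine ⟨z, ?_, hz⟩
  by_contra! hlt
  have hc1 := one_le_regNorm_one (z - y)
  have h1 := hv k z _ _ (Jup.of_max_regNorm hΛ0.le (by linarith) hz)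
  rw [colTrace_smul_id] at h1
  have h2 := hK.coer a ha0 k ((Λ / regNorm 1 (z - y)) • (z - y)) (fun j => v k z - v j z) z
  have h3 : Λ / regNorm 1 (z - y) ≤ Λ := div_le_self hΛ0.le hc1
  have h4 : Λ / regNorm 1 (z - y) * ∑ i, ‖σ k z i‖ ^ 2 ≤ Λ * (n * K.S ^ 2) :=
    mul_le_mul h3 (hK.sum_sq_le k z) (Finset.sum_nonneg fun i _ => sq_nonneg _) hΛ0.le
  have h5 : Λ / 2 ≤ ‖(Λ / regNorm 1 (z - y)) • (z - y)‖ := by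
    rw [norm_smul, Real.norm_of_nonneg (by positivity), div_mul_eq_mul_div,
      div_le_div_iff₀ (by norm_num) (by linarith), mul_assoc]
    refine mul_le_mul_of_nonneg_left ?_ hΛ0.le
    have := regNorm_le (zero_le_one) (z - y)
    linarith
  have h6 := mul_le_mul_of_nonneg_left h5 ha0
  have h7 := hb k z
  have h8 : a * (Λ / 2) = Λ * (n * K.S ^ 2) + Λ := by rw [ha]; ring
  linarith

end Bounds

section Pair

variable {E : Type*} [NormedAddCommGroup E] [InnerProductSpace ℝ E] [FiniteDimensional ℝ E]

theorem exists_jets_of_max_quadratic {u w : E → ℝ} (hu : Continuous u) (hw : Continuous w) {M : ℝ}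
    (hub : ∀ x, u x ≤ M) (hwb : ∀ x, w x ≤ M) {α β β' ε : ℝ} (hα : 0 ≤ α) (hβ : 0 ≤ β)
    (hβ' : 0 ≤ β') (hε : 0 < ε) {x₁ y₁ a b : E}
    (hmax : ∀ x y, u x + w y - α / 2 * ‖x - y‖ ^ 2 - β / 2 * ‖x - a‖ ^ 2 - β' / 2 * ‖y - b‖ ^ 2
      ≤ u x₁ + w y₁ - α / 2 * ‖x₁ - y₁‖ ^ 2 - β / 2 * ‖x₁ - a‖ ^ 2 - β' / 2 * ‖y₁ - b‖ ^ 2) :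
    ∃ z₁ z₂ q₁ q₂ X Y, ‖z₁ - x₁‖ < ε ∧ ‖z₂ - y₁‖ < ε ∧
      ‖q₁ - (α • (x₁ - y₁) + β • (x₁ - a))‖ < ε ∧
      ‖q₂ - (-(α • (x₁ - y₁)) + β' • (y₁ - b))‖ < ε ∧ Jup u z₁ q₁ X ∧ Jup w z₂ q₂ Y ∧
      ∀ ξ ζ, inner ℝ (X ξ) ξ + inner ℝ (Y ζ) ζ
        ≤ α * ‖ξ - ζ‖ ^ 2 + (β + ε) * ‖ξ‖ ^ 2 + (β' + ε) * ‖ζ‖ ^ 2 := by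
  obtain ⟨η, hη⟩ : ∃ η : ℝ, η = ε / (1 + β + β') := ⟨_, rfl⟩
  have hη0 : 0 < η := by rw [hη]; positivity
  have hη1 : η + β * η + β' * η = ε := by rw [hη]; field_simp
  have hb1 : 0 ≤ β * η := by positivity
  have hb2 : 0 ≤ β' * η := by positivity
  obtain ⟨z₁, z₂, q₁, q₂, X, Y, h1, h2, h3, h4, h5, h6, h7⟩ :=
    exists_jets_of_max (u := fun x => u x - β / 2 * ‖x - a‖ ^ 2)
      (w := fun y => w y - β' / 2 * ‖y - b‖ ^ 2) (by fun_prop) (by fun_prop) (M := M)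
      (fun x => by
        have : 0 ≤ β / 2 * ‖x - a‖ ^ 2 := by positivity
        linarith [hub x])
      (fun x => by
        have : 0 ≤ β' / 2 * ‖x - b‖ ^ 2 := by positivity
        linarith [hwb x]) hα hη0 (x₁ := x₁) (y₁ := y₁) (fun x y => by linarith [hmax x y])
  have s1 : ‖β • (z₁ - x₁)‖ ≤ β * η := by
    rw [norm_smul, Real.norm_of_nonneg hβ]; gcongr
  have s2 : ‖β' • (z₂ - y₁)‖ ≤ β' * η := by
    rw [norm_smul, Real.norm_of_nonneg hβ']; gcongr
  refine ⟨z₁, z₂, _, _, _, _, by linarith, by linarith, ?_, ?_, h5.add_quadratic, h6.add_quadratic,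
    ?_⟩
  · rw [show q₁ + β • (z₁ - a) - (α • (x₁ - y₁) + β • (x₁ - a))
      = (q₁ - α • (x₁ - y₁)) + β • (z₁ - x₁) by module]
    linarith [norm_add_le (q₁ - α • (x₁ - y₁)) (β • (z₁ - x₁))]
  · rw [show q₂ + β' • (z₂ - b) - (-(α • (x₁ - y₁)) + β' • (y₁ - b))
      = (q₂ + α • (x₁ - y₁)) + β' • (z₂ - y₁) by module]
    linarith [norm_add_le (q₂ + α • (x₁ - y₁)) (β' • (z₂ - y₁))]
  · intro ξ ζ
    have := h7 ξ ζ
    have e1 : η * (‖ξ‖ ^ 2 + ‖ζ‖ ^ 2) ≤ ε * (‖ξ‖ ^ 2 + ‖ζ‖ ^ 2) := by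
      gcongr; linarith
    simp only [_root_.add_apply, _root_.smul_apply, ContinuousLinearMap.id_apply, inner_add_left,
      real_inner_smul_left, real_inner_self_eq_norm_sq]
    linarith

end Pair

section Osc

theorem colTrace_smul {n : ℕ} (σ : Fin n → Euc n) (X : Euc n →L[ℝ] Euc n) (t : ℝ) :
    colTrace σ (t • X) = t * colTrace σ X := by
  simp [colTrace, Finset.mul_sum, real_inner_smul_left]

theorem colTrace_add_le {n : ℕ} {σ₁ σ₂ : Fin n → Euc n} {X Y : Euc n →L[ℝ] Euc n}
    {α β β' S D t : ℝ} (hα : 0 ≤ α) (hβ : 0 ≤ β) (hβ' : 0 ≤ β')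
    (ht : 0 ≤ t) (h : ∀ ξ ζ, inner ℝ (X ξ) ξ + inner ℝ (Y ζ) ζ
        ≤ α * ‖ξ - ζ‖ ^ 2 + β * ‖ξ‖ ^ 2 + β' * ‖ζ‖ ^ 2)
    (h1 : ∀ i, ‖σ₁ i‖ ≤ S) (h2 : ∀ i, ‖σ₂ i‖ ≤ S) (h3 : ∀ i, ‖σ₁ i - σ₂ i‖ ≤ S * D) :
    (1 + t) ^ 2 * colTrace σ₁ X + colTrace σ₂ Y
      ≤ n * S ^ 2 * (α * (D + t) ^ 2 + β * (1 + t) ^ 2 + β') := by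
  have key : ∀ i, (1 + t) ^ 2 * inner ℝ (X (σ₁ i)) (σ₁ i) + inner ℝ (Y (σ₂ i)) (σ₂ i)
      ≤ S ^ 2 * (α * (D + t) ^ 2 + β * (1 + t) ^ 2 + β') := by
    intro i
    have e := h ((1 + t) • σ₁ i) (σ₂ i)
    rw [map_smul, real_inner_smul_left, real_inner_smul_right] at e
    have e1 : ‖(1 + t) • σ₁ i - σ₂ i‖ ≤ S * (D + t) := by
      rw [show (1 + t) • σ₁ i - σ₂ i = (σ₁ i - σ₂ i) + t • σ₁ i by module]
      refine (norm_add_le _ _).trans ?_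
      rw [norm_smul, Real.norm_of_nonneg ht]
      nlinarith [h3 i, mul_le_mul_of_nonneg_left (h1 i) ht]
    have e2 : ‖(1 + t) • σ₁ i‖ ≤ (1 + t) * S := by
      rw [norm_smul, Real.norm_of_nonneg (by positivity)]
      have := h1 i
      gcongr
    have e3 : α * ‖(1 + t) • σ₁ i - σ₂ i‖ ^ 2 ≤ α * (S * (D + t)) ^ 2 := by gcongr
    have e4 : β * ‖(1 + t) • σ₁ i‖ ^ 2 ≤ β * ((1 + t) * S) ^ 2 := by gcongr
    have e5 : β' * ‖σ₂ i‖ ^ 2 ≤ β' * S ^ 2 := by have := h2 i; gcongr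
    linarith
  have := Finset.sum_le_sum fun i (_ : i ∈ Finset.univ) => key i
  rw [Finset.sum_add_distrib, ← Finset.mul_sum] at this
  simp only [Finset.sum_const, Finset.card_univ, Fintype.card_fin, nsmul_eq_mul] at this
  simp only [colTrace]
  linarith

theorem exists_uniform_radius {n m : ℕ} {v : Fin m → Euc n → ℝ} (hv : ∀ k, Continuous (v k))
    (x : Euc n) {e : ℝ} (he : 0 < e) :
    ∃ ρ > 0, ∀ z, ‖z - x‖ < ρ → ∀ k, |v k z - v k x| ≤ e := by
  have : ∀ᶠ z in 𝓝 x, ∀ k, |v k z - v k x| ≤ e := by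
    refine eventually_all.2 fun k => ?_
    have := (Metric.continuous_iff.1 (hv k)) x e he
    obtain ⟨ρ, hρ, h⟩ := this
    filter_upwards [Metric.ball_mem_nhds x hρ] with z hz
    exact (h z hz).le
  obtain ⟨ρ, hρ, h⟩ := Metric.eventually_nhds_iff_ball.1 this
  exact ⟨ρ, hρ, fun z hz => h z (by simpa [dist_eq_norm] using hz)⟩

/-- Penalty functions for the comparison of `v_k` with `v_j`. -/
def pairPenalty {n m : ℕ} (κ : ℝ) (k j : Fin m) (z : Euc n) : ℝ :=
  regNorm (if k = j then 0 else 1) z + if k = j then 0 else κ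

theorem exists_max_pair {n m : ℕ} [NeZero m] {v : Fin m → Euc n → ℝ} (hv : ∀ k, Continuous (v k))
    {B : ℝ} (hB : ∀ k y, |v k y| ≤ B) {t Λ κ : ℝ} (ht : 0 < t) (hΛ : 1 ≤ Λ) (hκ : 0 ≤ κ)
    (y₀ : Euc n) : ∃ (k j : Fin m) (x y : Euc n), ∀ k' j' x' y',
      t * v k' x' - v j' y' - Λ * regNorm 1 (y' - y₀) - pairPenalty κ k' j' (x' - y')
      ≤ t * v k x - v j y - Λ * regNorm 1 (y - y₀) - pairPenalty κ k j (x - y) := by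
  have hpc : ∀ k j : Fin m, Continuous (pairPenalty (n := n) κ k j) := fun k j =>
    (continuous_regNorm _).add continuous_const
  have h1 : ∀ kj : Fin m × Fin m, ∃ V : Euc n × Euc n, ∀ W : Euc n × Euc n,
      t * v kj.1 W.1 - v kj.2 W.2 - Λ * regNorm 1 (W.2 - y₀) - pairPenalty κ kj.1 kj.2 (W.1 - W.2)
      ≤ t * v kj.1 V.1 - v kj.2 V.2 - Λ * regNorm 1 (V.2 - y₀)
        - pairPenalty κ kj.1 kj.2 (V.1 - V.2) := by
    intro kj
    refine exists_max_of_le_sub_norm (C := t * B + B + ‖y₀‖) (c := 1) ?_ one_pos fun W => ?_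
    · have := hv kj.1
      have := hv kj.2
      have := hpc kj.1 kj.2
      have := continuous_regNorm (E := Euc n) 1
      fun_prop
    · have e1 := mul_le_mul_of_nonneg_left (abs_le.1 (hB kj.1 W.1)).2 ht.le
      have e2 := (abs_le.1 (hB kj.2 W.2)).1
      have e3 := norm_le_regNorm 1 (W.2 - y₀)
      have e4 : ‖W.1 - W.2‖ ≤ pairPenalty κ kj.1 kj.2 (W.1 - W.2) := by
        have := norm_le_regNorm (if kj.1 = kj.2 then 0 else 1) (W.1 - W.2)
        have : 0 ≤ if kj.1 = kj.2 then 0 else κ := by split_ifs <;> linarith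
        unfold pairPenalty; linarith
      have e5 : regNorm 1 (W.2 - y₀) ≤ Λ * regNorm 1 (W.2 - y₀) :=
        le_mul_of_one_le_left (regNorm_nonneg _ _) hΛ
      have e6 : ‖W‖ ≤ ‖W.2‖ + ‖W.1 - W.2‖ := by
        rw [Prod.norm_def]
        refine max_le ?_ (by linarith [norm_nonneg (W.1 - W.2)])
        have := norm_add_le W.2 (W.1 - W.2)
        rwa [add_sub_cancel] at this
      have e7 : ‖W.2‖ ≤ ‖W.2 - y₀‖ + ‖y₀‖ := by
        simpa using norm_add_le (W.2 - y₀) y₀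
      linarith
  choose V hV using h1
  obtain ⟨kj, hkj⟩ := Finite.exists_max fun kj : Fin m × Fin m =>
    t * v kj.1 (V kj).1 - v kj.2 (V kj).2 - Λ * regNorm 1 ((V kj).2 - y₀)
        - pairPenalty κ kj.1 kj.2 ((V kj).1 - (V kj).2)
  exact ⟨kj.1, kj.2, (V kj).1, (V kj).2, fun k' j' x' y' =>
    (hV (k', j') (x', y')).trans (hkj (k', j'))⟩

end Osc

section OscBound

theorem regNorm_neg {E : Type*} [NormedAddCommGroup E] [InnerProductSpace ℝ E] (κ : ℝ) (z : E) :
    regNorm κ (-z) = regNorm κ z := by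
  unfold regNorm; rw [norm_neg]

variable {n m : ℕ} {σ : Fin m → Euc n → Fin n → Euc n}
  {F : Fin m → Euc n → (Fin m → ℝ) → Euc n → ℝ} {δ : ℝ} {v : Fin m → Euc n → ℝ} {K : StructBounds}

theorem Admissible.le_bdd (hK : Admissible K σ F) {R e : ℝ} (he : 0 ≤ e) {k : Fin m} {q : Euc n}
    {s : Fin m → ℝ} (y : Euc n) (hq : ‖q‖ ≤ R) (hs : ∀ i, s i ≤ e) (heR : e ≤ R) :
    F k q s y ≤ K.bdd R := by
  refine (hK.mono k q s (fun _ => e) y hs).trans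
    ((abs_le.1 (hK.bound R k q (fun _ => e) y hq ?_)).2)
  refine (pi_norm_le_iff_of_nonneg (he.trans heR)).2 fun i => ?_
  rwa [Real.norm_of_nonneg he]

theorem eq_and_eq_of_max_pair (hK : Admissible K σ F) (hsub : JetSub σ F δ v)
    (hsup : ∀ ℓ, JetSup σ F δ ℓ v) (hv : ∀ k, Continuous (v k)) {B : ℝ} (hB : ∀ k y, |v k y| ≤ B)
    {Cb Λ κ a θ T : ℝ} (hCb : ∀ k y, |δ * v k y| ≤ Cb) (hCb0 : 0 ≤ Cb) (hΛ : 1 ≤ Λ) (hκ0 : 0 ≤ κ)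
    (hT : T = n * K.S ^ 2 * (Λ + 6)) (hκ : K.c * κ = T + Cb + K.bdd (Λ + 3) + 3)
    (ha : a = 2 * (T + Cb + K.bdd (κ + Λ + 4) + 3))
    (hθ : K.coe a + K.coe 0 + K.c + Cb + 1 ≤ θ) {k j : Fin m} {x₁ y₁ y₀ : Euc n}
    (hmax : ∀ k' j' x' y',
      θ⁻¹ * v k' x' - v j' y' - Λ * regNorm 1 (y' - y₀) - pairPenalty κ k' j' (x' - y')
      ≤ θ⁻¹ * v k x₁ - v j y₁ - Λ * regNorm 1 (y₁ - y₀) - pairPenalty κ k j (x₁ - y₁)) :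
    k = j ∧ x₁ = y₁ := by
  by_contra hne
  have hcoea := K.coe_pos a
  have hcoe0 := K.coe_pos 0
  have hcp := K.c_pos
  have hT0 : 0 ≤ T := by rw [hT]; positivity
  have hbd := K.bdd_pos (κ + Λ + 4)
  have ha0 : 0 ≤ a := by rw [ha]; linarith
  have hθ1 : 1 ≤ θ := by linarith
  have hθ0 : 0 < θ := by linarith
  obtain ⟨κ', hκ'⟩ : ∃ κ' : ℝ, κ' = if k = j then 0 else 1 := ⟨_, rfl⟩
  obtain ⟨c, hcdef⟩ : ∃ c : ℝ, c = regNorm κ' (x₁ - y₁) := ⟨_, rfl⟩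
  have hc : 0 < c := by
    rw [hcdef]
    by_cases hkj : k = j
    · have : x₁ ≠ y₁ := fun h => hne ⟨hkj, h⟩
      have : 0 < ‖x₁ - y₁‖ := norm_pos_iff.2 (sub_ne_zero.2 this)
      exact this.trans_le (norm_le_regNorm _ _)
    · have := le_regNorm κ' (x₁ - y₁)
      rw [hκ', if_neg hkj] at this ⊢
      linarith
  obtain ⟨d, hd⟩ : ∃ d : ℝ, d = regNorm 1 (y₁ - y₀) := ⟨_, rfl⟩
  have hd1 : 1 ≤ d := by rw [hd]; exact one_le_regNorm_one _
  obtain ⟨ρ₁, hρ₁, hr₁⟩ := exists_uniform_radius hv x₁ (e := 1 / 2) (by norm_num)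
  obtain ⟨ρ₂, hρ₂, hr₂⟩ := exists_uniform_radius hv y₁ (e := 1 / 2) (by norm_num)
  obtain ⟨ε, hε⟩ : ∃ ε : ℝ, ε = min (min ρ₁ ρ₂) (min (1 / 2) (c / 2)) := ⟨_, rfl⟩
  have hε0 : 0 < ε := by rw [hε]; positivity
  have hε1 : ε ≤ ρ₁ := hε.le.trans ((min_le_left _ _).trans (min_le_left _ _))
  have hε2 : ε ≤ ρ₂ := hε.le.trans ((min_le_left _ _).trans (min_le_right _ _))
  have hε3 : ε ≤ 1 / 2 := hε.le.trans ((min_le_right _ _).trans (min_le_left _ _))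
  have hε4 : ε ≤ c / 2 := hε.le.trans ((min_le_right _ _).trans (min_le_right _ _))
  have hΛd : 0 ≤ Λ / d := by positivity
  have hB0 : 0 ≤ B := (abs_nonneg _).trans (hB k x₁)
  obtain ⟨z₁, z₂, q₁, q₂, X, Y, h1, h2, h3, h4, h5, h6, h7⟩ :=
    exists_jets_of_max_quadratic (u := fun x => θ⁻¹ * v k x) (w := fun y => - v j y)
      (by have := hv k; fun_prop) (by have := hv j; fun_prop) (M := B)
      (fun x => by
        have e1 := (abs_le.1 (hB k x)).2
        have e2 : θ⁻¹ ≤ 1 := inv_le_one_of_one_le₀ hθ1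
        have e3 : 0 ≤ θ⁻¹ := by positivity
        nlinarith)
      (fun y => by linarith [(abs_le.1 (hB j y)).1])
      (α := c⁻¹) (β := 0) (β' := Λ / d) (ε := ε) (x₁ := x₁) (y₁ := y₁) (a := 0) (b := y₀)
      (by positivity) le_rfl hΛd hε0 (fun x y => by
        have e1 := hmax k j x y
        have e2 := regNorm_sub_le (κ := κ') (w := x₁ - y₁) (by rw [← hcdef]; exact hc) (x - y)
        have e3 := mul_le_mul_of_nonneg_left (regNorm_sub_le (κ := 1) (w := y₁ - y₀)
          (by rw [← hd]; linarith) (y - y₀)) (by linarith : 0 ≤ Λ)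
        rw [← hcdef] at e2
        rw [← hd] at e3
        simp only [pairPenalty, ← hκ', ← hcdef, ← hd] at e1
        rw [div_eq_mul_inv Λ d]
        linear_combination e1 + e2 + e3)
  have hch : ‖x₁ - y₁‖ ≤ c := hcdef ▸ norm_le_regNorm _ _
  have hq₂ : ‖q₂‖ ≤ 2 + Λ := by
    have e1 : ‖-(c⁻¹ • (x₁ - y₁))‖ ≤ 1 := by
      rw [norm_neg, norm_smul, norm_inv, Real.norm_of_nonneg hc.le, inv_mul_le_iff₀ hc]
      linarith
    have e2 : ‖(Λ / d) • (y₁ - y₀)‖ ≤ Λ := by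
      rw [norm_smul, Real.norm_of_nonneg hΛd, div_mul_eq_mul_div, div_le_iff₀ (by linarith)]
      exact mul_le_mul_of_nonneg_left (hd ▸ norm_le_regNorm _ _) (by linarith)
    have e3 := norm_add_le (-(c⁻¹ • (x₁ - y₁))) ((Λ / d) • (y₁ - y₀))
    have e4 := norm_sub_norm_le q₂ (-(c⁻¹ • (x₁ - y₁)) + (Λ / d) • (y₁ - y₀))
    linarith
  have hsig : ∃ D, c⁻¹ * D ^ 2 ≤ 4 ∧ ∀ i, ‖σ k z₁ i - σ j z₂ i‖ ≤ K.S * D := by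
    rcases le_or_gt 1 c with hc1 | hc1
    · refine ⟨2, ?_, fun i => ?_⟩
      · have : c⁻¹ ≤ 1 := inv_le_one_of_one_le₀ hc1
        linarith
      · linarith [norm_sub_le (σ k z₁ i) (σ j z₂ i), hK.sig_bdd k z₁ i, hK.sig_bdd j z₂ i]
    · have hkj : k = j := by
        by_contra hkj
        have := le_regNorm κ' (x₁ - y₁)
        rw [← hcdef, hκ', if_neg hkj] at this
        linarith
      refine ⟨‖z₁ - z₂‖, ?_, fun i => ?_⟩
      · have e1 : ‖z₁ - z₂‖ ≤ 2 * c := by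
          have e2 : z₁ - z₂ = (z₁ - x₁) - (z₂ - y₁) + (x₁ - y₁) := by abel
          have e3 := norm_add_le ((z₁ - x₁) - (z₂ - y₁)) (x₁ - y₁)
          have e4 := norm_sub_le (z₁ - x₁) (z₂ - y₁)
          rw [e2]; linarith
        rw [inv_mul_le_iff₀ hc]
        calc ‖z₁ - z₂‖ ^ 2 ≤ (2 * c) ^ 2 := by gcongr
          _ ≤ c * 4 := by nlinarith
      · rw [hkj]; exact hK.sig_lip j z₁ z₂ i
  obtain ⟨D, hD, hsD⟩ := hsig
  have htr : colTrace (σ k z₁) X + colTrace (σ j z₂) Y ≤ T := by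
    have e1 := colTrace_add_le (σ₁ := σ k z₁) (σ₂ := σ j z₂) (t := 0) (D := D)
      (by positivity : 0 ≤ c⁻¹) (by linarith : 0 ≤ 0 + ε) (by linarith : 0 ≤ Λ / d + ε)
      le_rfl h7 (hK.sig_bdd k z₁) (hK.sig_bdd j z₂) hsD
    have e2 : Λ / d ≤ Λ := div_le_self (by linarith) hd1
    have e3 : n * K.S ^ 2 * (c⁻¹ * (D + 0) ^ 2 + (0 + ε) * (1 + 0) ^ 2 + (Λ / d + ε))
        ≤ n * K.S ^ 2 * (Λ + 6) := by
      refine mul_le_mul_of_nonneg_left ?_ (by positivity)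
      simp only [add_zero]
      linarith
    rw [← hT] at e3
    linarith
  have hs1 := hsub k z₁ _ _ (h5.of_const_mul hθ0)
  rw [colTrace_smul] at hs1
  have hs2 := hsup (‖q₂‖ + 1) j z₂ q₂ Y (by linarith) h6
  have hb1 := (abs_le.1 (hCb k z₁)).1
  have hb2 := (abs_le.1 (hCb j z₂)).2
  have hrr₁ := fun i => abs_le.1 (hr₁ z₁ (by linarith) i)
  have hrr₂ := fun i => abs_le.1 (hr₂ z₂ (by linarith) i)
  have hqn : ‖-q₂‖ ≤ 2 + Λ := by rwa [norm_neg]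
  have hindex : ∀ i, v j y₁ - v i y₁
      ≤ pairPenalty κ k i (x₁ - y₁) - pairPenalty κ k j (x₁ - y₁) := fun i => by
    linarith [hmax k i x₁ y₁]
  have hreg1 : regNorm 1 (x₁ - y₁) ≤ 1 + ‖x₁ - y₁‖ := regNorm_le zero_le_one _
  by_cases hkj : k = j
  · subst hkj
    rw [if_pos rfl] at hκ'
    rw [hκ', regNorm_zero_left] at hcdef
    have hq₁ : 1 / 2 ≤ ‖q₁‖ := by
      have e1 : ‖c⁻¹ • (x₁ - y₁)‖ = 1 := by
        rw [norm_smul, norm_inv, Real.norm_of_nonneg hc.le, ← hcdef, inv_mul_cancel₀ hc.ne']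
      have e2 := norm_sub_norm_le (c⁻¹ • (x₁ - y₁)) q₁
      rw [norm_sub_rev] at e2
      simp only [zero_smul, add_zero] at h3
      linarith
    have hF1 := hK.coer a ha0 k (θ • q₁) (fun j => v k z₁ - v j z₁) z₁
    rw [norm_smul, Real.norm_of_nonneg hθ0.le] at hF1
    have hF2 : F k (-q₂) (fun i => v k z₂ - v i z₂) z₂ ≤ K.bdd (κ + Λ + 4) := by
      refine hK.le_bdd (e := κ + 2) (by linarith) z₂ (by linarith) (fun i => ?_) (by linarith)
      have e1 := hindex i
      have e2 : pairPenalty κ k i (x₁ - y₁) - pairPenalty κ k k (x₁ - y₁) ≤ 1 + κ := by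
        simp only [pairPenalty, if_true, regNorm_zero_left]
        split_ifs <;> (try simp only [regNorm_zero_left]) <;> linarith
      linarith [(hrr₂ k).2, (hrr₂ i).1]
    have hX : θ * (a / 2 - 1) ≤ θ * colTrace (σ k z₁) X := by
      have e1 : a * (θ * (1 / 2)) ≤ a * (θ * ‖q₁‖) := by gcongr
      linarith
    have := le_of_mul_le_mul_left hX hθ0
    linarith
  · rw [if_neg hkj] at hκ'
    rw [hκ'] at hcdef
    have hF1 := hK.coer' 0 le_rfl k (θ • q₁) (fun j => v k z₁ - v j z₁) z₁ j (Ne.symm hkj)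
    have hF2 : F j (-q₂) (fun i => v j z₂ - v i z₂) z₂ ≤ K.bdd (Λ + 3) := by
      refine hK.le_bdd (e := 1) (by linarith) z₂ (by linarith) (fun i => ?_) (by linarith)
      have e1 := hindex i
      have e2 : pairPenalty κ k i (x₁ - y₁) - pairPenalty κ k j (x₁ - y₁) ≤ 0 := by
        unfold pairPenalty
        have := norm_le_regNorm 1 (x₁ - y₁)
        simp only [if_neg hkj]
        split_ifs <;> (try simp only [regNorm_zero_left]) <;> linarith
      linarith [(hrr₂ j).2, (hrr₂ i).1]
    have hX : θ * (K.c * κ - 1) ≤ θ * colTrace (σ k z₁) X := by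
      have e1 : θ * κ ≤ v k x₁ - v j x₁ := by
        have e2 := hmax j j x₁ y₁
        have e3 : κ ≤ pairPenalty κ k j (x₁ - y₁) - pairPenalty κ j j (x₁ - y₁) := by
          unfold pairPenalty
          have := norm_le_regNorm 1 (x₁ - y₁)
          simp only [if_neg hkj, if_true, regNorm_zero_left]
          linarith
        have e4 : κ ≤ θ⁻¹ * (v k x₁ - v j x₁) := by linarith
        rwa [inv_mul_eq_div, le_div_iff₀ hθ0, mul_comm] at e4
      have e5 : K.c * (θ * κ - 1) ≤ K.c * (v k z₁ - v j z₁) :=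
        mul_le_mul_of_nonneg_left (by linarith [(hrr₁ k).1, (hrr₁ j).2]) hcp.le
      linarith
    have := le_of_mul_le_mul_left hX hθ0
    linarith

theorem exists_osc_bound (K : StructBounds) (n : ℕ) {Cb : ℝ} (hCb0 : 0 ≤ Cb) :
    ∃ M₀ Λ : ℝ, 0 ≤ M₀ ∧ 0 ≤ Λ ∧
    ∀ {m : ℕ} {σ : Fin m → Euc n → Fin n → Euc n}
      {F : Fin m → Euc n → (Fin m → ℝ) → Euc n → ℝ} {δ : ℝ} {v : Fin m → Euc n → ℝ},
      Admissible K σ F → JetSub σ F δ v → (∀ ℓ, JetSup σ F δ ℓ v) → (∀ k, Continuous (v k)) →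
      ∀ B, (∀ k y, |v k y| ≤ B) → (∀ k y, |δ * v k y| ≤ Cb) →
      ∀ k j x y, v k x - v j y ≤ M₀ + Λ * regNorm 1 (x - y) := by
  obtain ⟨Λ, hΛ, hbar⟩ := exists_barrier K n hCb0
  obtain ⟨T, hT⟩ : ∃ T : ℝ, T = n * K.S ^ 2 * (Λ + 6) := ⟨_, rfl⟩
  have hT0 : 0 ≤ T := by rw [hT]; positivity
  have hcp := K.c_pos
  obtain ⟨κ, hκ⟩ : ∃ κ : ℝ, κ = (T + Cb + K.bdd (Λ + 3) + 3) / K.c := ⟨_, rfl⟩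
  have hκ0 : 0 ≤ κ := by
    have := K.bdd_pos (Λ + 3)
    rw [hκ]; positivity
  have hκ' : K.c * κ = T + Cb + K.bdd (Λ + 3) + 3 := by rw [hκ]; field_simp
  obtain ⟨a, ha⟩ : ∃ a : ℝ, a = 2 * (T + Cb + K.bdd (κ + Λ + 4) + 3) := ⟨_, rfl⟩
  obtain ⟨θ, hθ⟩ : ∃ θ : ℝ, θ = K.coe a + K.coe 0 + K.c + Cb + 1 := ⟨_, rfl⟩
  have hθ1 : 1 ≤ θ := by linarith [K.coe_pos a, K.coe_pos 0]
  have hθ0 : 0 < θ := by linarith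
  refine ⟨θ * (Λ + 3 + κ) + 3 + κ, Λ, by positivity, by linarith, ?_⟩
  intro m σ F δ v hK hsub hsup hv B hB hCb k₁ j₁ x₁ y₁
  by_contra! hlt
  have : NeZero m := ⟨fun h => by subst h; exact k₁.elim0⟩
  let G : Fin m × Fin m × Euc n × Euc n → ℝ := fun p =>
    v p.1 p.2.2.1 - v p.2.1 p.2.2.2 - Λ * regNorm 1 (p.2.2.1 - p.2.2.2)
  have hne : Nonempty (Fin m × Fin m × Euc n × Euc n) := ⟨(k₁, j₁, x₁, y₁)⟩
  have hbdd : BddAbove (Set.range G) := by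
    refine ⟨2 * B, ?_⟩
    rintro _ ⟨p, rfl⟩
    have e1 := (abs_le.1 (hB p.1 p.2.2.1)).2
    have e2 := (abs_le.1 (hB p.2.1 p.2.2.2)).1
    have e3 : 0 ≤ Λ * regNorm 1 (p.2.2.1 - p.2.2.2) :=
      mul_nonneg (by linarith) (regNorm_nonneg _ _)
    simp only [G]; linarith
  obtain ⟨M, hM⟩ : ∃ M : ℝ, M = ⨆ p, G p := ⟨_, rfl⟩
  have hGM : ∀ k j x y, v k x - v j y - Λ * regNorm 1 (x - y) ≤ M := fun k j x y => by
    rw [hM]; exact le_ciSup hbdd (k, j, x, y)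
  have hMlt := hGM k₁ j₁ x₁ y₁
  obtain ⟨⟨k₀, j₀, x₀, y₀⟩, hp⟩ := exists_lt_of_lt_ciSup (by linarith : M - 1 < ⨆ p, G p)
  simp only [G] at hp
  obtain ⟨z, hz1, hz2⟩ := hbar hK hsub hv B (fun k y => (abs_le.1 (hB k y)).2)
    (fun k y => (abs_le.1 (hCb k y)).1) k₀ y₀
  obtain ⟨k, j, x, y, hmax⟩ := exists_max_pair hv hB (inv_pos.2 hθ0) hΛ hκ0 y₀
  obtain ⟨rfl, rfl⟩ := eq_and_eq_of_max_pair hK hsub hsup hv hB hCb hCb0 hΛ hκ0 hT hκ' ha hθ.ge hmax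
  have e1 := hz2 x₀
  have e2 := hGM k₀ k z x
  have e3 := hmax k₀ j₀ z y₀
  have e4 : pairPenalty κ k₀ j₀ (z - y₀) ≤ 2 + κ := by
    have := regNorm_le zero_le_one (z - y₀)
    unfold pairPenalty
    split_ifs <;> (try simp only [regNorm_zero_left]) <;> linarith
  have e5 : pairPenalty κ k k (x - x) = 0 := by simp [pairPenalty, regNorm]
  have e6 : regNorm 1 (y₀ - y₀) = 1 := by simp [regNorm]
  have e7 : regNorm 1 (z - x) ≤ regNorm 1 (x - y₀) + regNorm 1 (z - y₀) := by
    have h1 := regNorm_add_le 1 (x - y₀) (y₀ - z)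
    have h2 := norm_le_regNorm 1 (z - y₀)
    have h3 : regNorm 1 (z - x) = regNorm 1 (x - y₀ + (y₀ - z)) := by
      rw [show x - y₀ + (y₀ - z) = -(z - x) by abel, regNorm_neg]
    rw [norm_sub_rev] at h2
    rw [h3]
    have h4 : regNorm 1 (z - y₀) = regNorm 1 (y₀ - z) := by
      rw [← neg_sub y₀ z, regNorm_neg]
    rw [h4]
    linarith [norm_le_regNorm 1 (y₀ - z)]
  have e8 := mul_le_mul_of_nonneg_left e7 (by linarith : 0 ≤ Λ)
  have e9 : Λ ≤ Λ * regNorm 1 (z - y₀) :=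
    le_mul_of_one_le_right (by linarith) (one_le_regNorm_one _)
  have e10 : Λ ≤ Λ * regNorm 1 (x - y₀) :=
    le_mul_of_one_le_right (by linarith) (one_le_regNorm_one _)
  rw [e5, e6] at e3
  have e11 : -(Λ + 3 + κ) ≤ θ⁻¹ * (v k x - v k₀ z) := by linarith
  have e12 : -(θ * (Λ + 3 + κ)) ≤ v k x - v k₀ z := by
    have := mul_le_mul_of_nonneg_left e11 hθ0.le
    rw [mul_inv_cancel_left₀ hθ0.ne'] at this
    linarith
  have e13 : θ⁻¹ ≤ 1 := inv_le_one_of_one_le₀ hθ1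
  have e14 : (1 - θ⁻¹) * (-(θ * (Λ + 3 + κ))) ≤ (1 - θ⁻¹) * (v k x - v k₀ z) :=
    mul_le_mul_of_nonneg_left e12 (by linarith)
  have e15 : (1 - θ⁻¹) * (-(θ * (Λ + 3 + κ))) = -((θ - 1) * (Λ + 3 + κ)) := by field_simp
  linarith

end OscBound

section Comparison

variable {n m : ℕ} {σ : Fin m → Euc n → Fin n → Euc n}
  {F : Fin m → Euc n → (Fin m → ℝ) → Euc n → ℝ} {δ : ℝ} {u v : Fin m → Euc n → ℝ}
  {K : StructBounds}

theorem Admissible.sub_le (hK : Admissible K σ F) {R R₁ R' e : ℝ} (he : 0 ≤ e) {k : Fin m}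
    {q q' : Euc n} {s s' : Fin m → ℝ} {z z' : Euc n} (hq : ‖q‖ ≤ R') (hq' : ‖q'‖ ≤ R')
    (hs' : ∀ i, |s' i| ≤ R) (hR : 0 ≤ R) (hR₁ : R + e ≤ R₁) (hRR : R + e ≤ R')
    (hs : ∀ i, s' i - e ≤ s i) :
    F k q' s' z' - F k q s z
      ≤ K.lipy R₁ * ‖z - z'‖ + K.lip R' * (‖q - q'‖ + e) := by
  have hn' : ‖s'‖ ≤ R := (pi_norm_le_iff_of_nonneg hR).2 hs'
  have hn : ‖fun i => s' i - e‖ ≤ R + e :=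
    (pi_norm_le_iff_of_nonneg (by positivity)).2 fun i => by
      have := abs_le.1 (hs' i)
      exact abs_le.2 ⟨by linarith, by linarith⟩
  have hd : ‖(fun i => s' i - e) - s'‖ ≤ e :=
    (pi_norm_le_iff_of_nonneg he).2 fun i => by simp [abs_of_nonneg he]
  have e1 := hK.mono k q (fun i => s' i - e) s z hs
  have e2 := abs_le.1 (hK.lip_y R₁ k q (fun i => s' i - e) z z' (hn.trans hR₁))
  have e3 := abs_le.1 (hK.lip_qs R' k q q' (fun i => s' i - e) s' z' hq hq' (hn.trans hRR)
    (hn'.trans (by linarith)))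
  have e4 : K.lip R' * (‖q - q'‖ + ‖(fun i => s' i - e) - s'‖)
      ≤ K.lip R' * (‖q - q'‖ + e) :=
    mul_le_mul_of_nonneg_left (by linarith) (K.lip_pos _).le
  linarith [e2.1, e3.1]

theorem doubling_arithmetic {h c κ L η N P A A' ly lp δ μ B Cb Ce : ℝ} (hδ : 0 < δ) (hμ : 0 < μ)
    (hκ : 0 < κ) (hη : 0 < η) (hN0 : 0 ≤ N) (hly : 0 ≤ ly) (hlp : 0 ≤ lp) (hCe : 0 ≤ Ce)
    (hCb : 0 ≤ Cb) (hκ1 : κ * (ly + 9 * N * L) ≤ δ * μ / 4)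
    (hη1 : η * (2 * δ + 2 * ly + 4 * lp + N * (2 * (1 + 2 * B) ^ 2 + 1)) ≤ δ * μ / 4)
    (hη3 : η ≤ κ) (hh0 : 0 ≤ h) (hhc : h ≤ c) (hcκ : κ ≤ c) (hch : c ≤ κ + h)
    (hhB : h ≤ 2 * B) (hL : ly + 4 * P + 2 * Ce + 2 * Cb + 1 ≤ L) (hP : P = 16 * N + 1)
    (hsum : δ * μ - η * δ - ly * (h + η) - 3 * η * lp ≤ A + A')
    (hlow : P * (L / c * h - 2) - Ce - Cb ≤ A)
    (htr : ∀ t, 0 ≤ t → (1 + t) ^ 2 * A + A'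
      ≤ N * (L / c * (h + η + t) ^ 2 + 2 * η * (1 + t) ^ 2 + η)) : False := by
  have hc : 0 < c := by linarith
  have hL0 : 0 ≤ L := by linarith
  have hδμ : 0 < δ * μ := by positivity
  have hB0 : 0 ≤ B := by linarith
  have hηlp : 0 ≤ η * lp := by positivity
  have hηly : 0 ≤ η * ly := by positivity
  have hηδ : 0 < η * δ := by positivity
  rcases lt_or_ge h κ with hlt | hge
  · have e1 := htr 0 le_rfl
    have e2 : L / c * (h + η + 0) ^ 2 ≤ 9 * L * κ := by
      rw [div_mul_eq_mul_div, div_le_iff₀ hc]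
      have f1 : (h + η + 0) ^ 2 ≤ (2 * κ) ^ 2 := by gcongr; linarith
      have f2 : (2 * κ) ^ 2 ≤ 9 * κ * c := by nlinarith
      calc L * (h + η + 0) ^ 2 ≤ L * (9 * κ * c) := by gcongr; linarith
        _ = 9 * L * κ * c := by ring
    have e3 : N * (L / c * (h + η + 0) ^ 2) ≤ N * (9 * L * κ) := by gcongr
    have e4 : ly * h ≤ ly * κ := by gcongr
    have e5 : η * N * 1 ≤ η * N * (1 + 2 * B) ^ 2 := by
      gcongr; nlinarith
    linarith
  · have e1 := htr h hh0
    have hh1 : 0 < h := hκ.trans_le hge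
    have e2 : L / c * (h + η + h) ^ 2 ≤ 16 * L * h := by
      rw [div_mul_eq_mul_div, div_le_iff₀ hc]
      have f1 : (h + η + h) ^ 2 ≤ (4 * h) ^ 2 := by gcongr; linarith
      have f2 : (4 * h) ^ 2 ≤ 16 * h * c := by nlinarith
      calc L * (h + η + h) ^ 2 ≤ L * (16 * h * c) := by gcongr; linarith
        _ = 16 * L * h * c := by ring
    have e3 : N * (L / c * (h + η + h) ^ 2) ≤ N * (16 * L * h) := by gcongr
    have e4 : N * (2 * η * (1 + h) ^ 2) ≤ N * (2 * η * (1 + 2 * B) ^ 2) := by gcongr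
    have e5 : L / 2 ≤ L / c * h := by
      rw [div_mul_eq_mul_div, div_le_div_iff₀ (by norm_num) hc]
      nlinarith
    have e6 : P * (L / 2 - 2) ≤ P * (L / c * h - 2) :=
      mul_le_mul_of_nonneg_left (by linarith) (by linarith)
    have e7 : P * (L / 2 - 2) - Ce - Cb ≤ A := by linarith
    have hPL : P * L = 16 * (N * L) + L := by rw [hP]; ring
    have e8 : 8 * (N * L) + ly / 2 + 1 / 2 ≤ A := by linarith
    have e9 : 0 ≤ h ^ 2 * A := mul_nonneg (sq_nonneg _) (by
      have : 0 ≤ N * L := mul_nonneg hN0 hL0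
      linarith)
    have e10 : 2 * h * (8 * (N * L) + ly / 2 + 1 / 2) ≤ 2 * h * A := by gcongr
    linarith

theorem not_exists_doubling_max (hK : Admissible K σ F) {ℓ : ℝ} (hδ : 0 < δ)
    (hsub : JetSub σ F δ u) (hsup : JetSup σ F δ ℓ v) (hu : ∀ k, Continuous (u k))
    (hv : ∀ k, Continuous (v k)) {B : ℝ} (hB : ∀ k y, |u k y| ≤ B) (hB' : ∀ k y, |v k y| ≤ B)
    {R Cb L P μ κ η : ℝ} (hR0 : 0 ≤ R) (hCb0 : 0 ≤ Cb) (hCb : ∀ k y, -Cb ≤ δ * u k y)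
    (hR : ∀ k j y, |v k y - v j y| ≤ R) (hP : P = 16 * (n * K.S ^ 2) + 1)
    (hL : K.lipy (R + 1) + 4 * P + 2 * K.coe P + 2 * Cb + 1 ≤ L) (hℓ : L + 1 ≤ ℓ)
    (hμ : 0 < μ) (hκ : 0 < κ) (hη : 0 < η)
    (hκ1 : κ * (K.lipy (R + 1) + 9 * (n * K.S ^ 2) * L) ≤ δ * μ / 4)
    (hη1 : η * (2 * δ + 2 * K.lipy (R + 1) + 4 * K.lip (L + R + 3)
      + n * K.S ^ 2 * (2 * (1 + 2 * B) ^ 2 + 1)) ≤ δ * μ / 4)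
    (hη2 : η ≤ 1) (hη3 : η ≤ κ) (k : Fin m) (x y : Euc n)
    (hmax : ∀ k' x' y', u k' x' - v k' y' - L * regNorm κ (x' - y') - η * regNorm 1 (x' - 0)
      ≤ u k x - v k y - L * regNorm κ (x - y) - η * regNorm 1 (x - 0))
    (hval : μ ≤ u k x - v k y - L * regNorm κ (x - y) - η * regNorm 1 (x - 0)) : False := by
  have hN0 : 0 ≤ n * K.S ^ 2 := by positivity
  obtain ⟨N, hN⟩ : ∃ N : ℝ, N = n * K.S ^ 2 := ⟨_, rfl⟩
  have hly := K.lipy_pos (R + 1)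
  have hlp := K.lip_pos (L + R + 3)
  have hcP := K.coe_pos P
  have hP1 : 1 ≤ P := by linarith
  have hL1 : 1 ≤ L := by linarith
  obtain ⟨c, hcdef⟩ : ∃ c : ℝ, c = regNorm κ (x - y) := ⟨_, rfl⟩
  have hcκ : κ ≤ c := hcdef ▸ le_regNorm _ _
  have hc : 0 < c := by linarith
  obtain ⟨h, hh⟩ : ∃ h : ℝ, h = ‖x - y‖ := ⟨_, rfl⟩
  have hh0 : 0 ≤ h := hh ▸ norm_nonneg _
  have hhc : h ≤ c := by rw [hh, hcdef]; exact norm_le_regNorm _ _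
  have hch : c ≤ κ + h := by rw [hh, hcdef]; exact regNorm_le hκ.le _
  obtain ⟨d, hd⟩ : ∃ d : ℝ, d = regNorm 1 (x - 0) := ⟨_, rfl⟩
  have hd1 : 1 ≤ d := by rw [hd]; exact one_le_regNorm_one _
  rw [← hcdef, ← hd] at hval
  have hηd : 0 ≤ η * d := by positivity
  have hLc : h ≤ L * c := hhc.trans (le_mul_of_one_le_left hc.le hL1)
  have hhB : h ≤ 2 * B := by
    have e1 := (abs_le.1 (hB k x)).2
    have e2 := (abs_le.1 (hB' k y)).1
    linarith
  have hdiff : μ ≤ u k x - v k y := by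
    have : 0 ≤ L * c := by positivity
    linarith
  obtain ⟨ρ₁, hρ₁, hr₁⟩ := exists_uniform_radius hu x (e := η / 4) (by positivity)
  obtain ⟨ρ₂, hρ₂, hr₂⟩ := exists_uniform_radius hv y (e := η / 4) (by positivity)
  obtain ⟨ε, hε⟩ : ∃ ε : ℝ, ε = min (min ρ₁ ρ₂) (η / 2) := ⟨_, rfl⟩
  have hε0 : 0 < ε := by rw [hε]; positivity
  have hε1 : ε ≤ ρ₁ := hε.le.trans ((min_le_left _ _).trans (min_le_left _ _))
  have hε2 : ε ≤ ρ₂ := hε.le.trans ((min_le_left _ _).trans (min_le_right _ _))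
  have hε3 : ε ≤ η / 2 := hε.le.trans (min_le_right _ _)
  have hβ0 : 0 ≤ η / d := by positivity
  have hβ1 : η / d ≤ η := div_le_self hη.le hd1
  obtain ⟨z₁, z₂, q₁, q₂, X, Y, h1, h2, h3, h4, h5, h6, h7⟩ :=
    exists_jets_of_max_quadratic (hu k) (w := fun y => - v k y)
      (by have := hv k; fun_prop) (M := B) (fun x => (abs_le.1 (hB k x)).2)
      (fun y => by linarith [(abs_le.1 (hB' k y)).1])
      (α := L / c) (β := η / d) (β' := 0) (ε := ε) (x₁ := x) (y₁ := y) (a := 0) (b := 0)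
      (by positivity) hβ0 le_rfl hε0 (fun x' y' => by
        have e1 := hmax k x' y'
        have e2 := mul_le_mul_of_nonneg_left (regNorm_sub_le (κ := κ) (w := x - y)
          (by rw [← hcdef]; exact hc) (x' - y')) (by linarith : 0 ≤ L)
        have e3 := mul_le_mul_of_nonneg_left (regNorm_sub_le (κ := 1) (w := x - 0)
          (by rw [← hd]; linarith) (x' - 0)) hη.le
        rw [← hcdef] at e2 e1
        rw [← hd] at e3 e1
        rw [div_eq_mul_inv η d, div_eq_mul_inv L c]
        linear_combination e1 + e2 + e3)
  have hα : ‖(L / c) • (x - y)‖ = L / c * h := by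
    rw [norm_smul, Real.norm_of_nonneg (by positivity), hh]
  have hα' : L / c * h ≤ L := by
    rw [div_mul_eq_mul_div, div_le_iff₀ hc]; gcongr
  have hβ : ‖(η / d) • (x - 0)‖ ≤ η := by
    rw [norm_smul, Real.norm_of_nonneg hβ0, div_mul_eq_mul_div, div_le_iff₀ (by linarith)]
    exact mul_le_mul_of_nonneg_left (hd ▸ norm_le_regNorm _ _) hη.le
  simp only [zero_smul, add_zero] at h4
  have hq₂ : ‖q₂‖ < L + ε := by
    have e1 := norm_sub_norm_le q₂ (-((L / c) • (x - y)))
    rw [norm_neg, hα] at e1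
    linarith
  have hq₁ : ‖q₁‖ ≤ L + 2 := by
    have e1 := norm_sub_norm_le q₁ ((L / c) • (x - y) + (η / d) • (x - 0))
    have e2 := norm_add_le ((L / c) • (x - y)) ((η / d) • (x - 0))
    linarith
  have hq₁' : L / c * h - 2 ≤ ‖q₁‖ := by
    have e1 := norm_sub_norm_le ((L / c) • (x - y)) q₁
    have e2 : (L / c) • (x - y) - q₁
      = (η / d) • (-(x - 0)) - (q₁ - ((L / c) • (x - y) + (η / d) • (x - 0))) := by module
    have e3 := norm_sub_le ((η / d) • (-(x - 0)))
      (q₁ - ((L / c) • (x - y) + (η / d) • (x - 0)))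
    rw [← e2, smul_neg, norm_neg] at e3
    linarith
  have hqq : ‖q₁ - -q₂‖ ≤ 2 * η := by
    have e2 : q₁ - -q₂ = (q₁ - ((L / c) • (x - y) + (η / d) • (x - 0)))
      + (q₂ - -((L / c) • (x - y))) + (η / d) • (x - 0) := by abel
    rw [e2]
    have e3 := norm_add₃_le (a := q₁ - ((L / c) • (x - y) + (η / d) • (x - 0)))
      (b := q₂ - -((L / c) • (x - y))) (c := (η / d) • (x - 0))
    linarith
  have hzz : ‖z₁ - z₂‖ ≤ h + η := by
    have e2 : z₁ - z₂ = (z₁ - x) - (z₂ - y) + (x - y) := by abel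
    have e3 := norm_add_le ((z₁ - x) - (z₂ - y)) (x - y)
    have e4 := norm_sub_le (z₁ - x) (z₂ - y)
    rw [e2]; linarith
  have hrr₁ := fun i => abs_le.1 (hr₁ z₁ (by linarith) i)
  have hrr₂ := fun i => abs_le.1 (hr₂ z₂ (by linarith) i)
  have hs1 := hsub k z₁ _ _ h5
  have hs2 := hsup k z₂ q₂ Y (by linarith) h6
  have hF := hK.sub_le (R := R) (R₁ := R + 1) (R' := L + R + 3) (e := η) (k := k)
    (q := q₁) (q' := -q₂)
    (s := fun i => u k z₁ - u i z₁) (s' := fun i => v k z₂ - v i z₂) (z := z₁) (z' := z₂)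
    hη.le (by linarith) (by rw [norm_neg]; linarith) (fun i => hR k i z₂) hR0 (by linarith)
    (by linarith)
    (fun i => by
      have := hmax i x y
      linarith [(hrr₁ k).1, (hrr₁ i).2, (hrr₂ k).2, (hrr₂ i).1])
  have hsum : δ * μ - η * δ - K.lipy (R + 1) * (h + η) - 3 * η * K.lip (L + R + 3)
      ≤ colTrace (σ k z₁) X + colTrace (σ k z₂) Y := by
    have e1 : δ * (μ - η) ≤ δ * (u k z₁ - v k z₂) :=
      mul_le_mul_of_nonneg_left (by linarith [(hrr₁ k).1, (hrr₂ k).2]) hδ.le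
    have e2 : K.lipy (R + 1) * ‖z₁ - z₂‖ ≤ K.lipy (R + 1) * (h + η) := by gcongr
    have e3 : K.lip (L + R + 3) * (‖q₁ - -q₂‖ + η) ≤ K.lip (L + R + 3) * (2 * η + η) := by gcongr
    linarith
  have hlow : P * (L / c * h - 2) - K.coe P - Cb ≤ colTrace (σ k z₁) X := by
    have e1 := hK.coer P (by linarith) k q₁ (fun i => u k z₁ - u i z₁) z₁
    have e2 : P * (L / c * h - 2) ≤ P * ‖q₁‖ := by gcongr
    linarith [hCb k z₁]
  have htr : ∀ t, 0 ≤ t → (1 + t) ^ 2 * colTrace (σ k z₁) X + colTrace (σ k z₂) Y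
      ≤ N * (L / c * (h + η + t) ^ 2 + 2 * η * (1 + t) ^ 2 + η) := fun t ht => by
    have e1 := colTrace_add_le (σ₁ := σ k z₁) (σ₂ := σ k z₂) (t := t) (D := ‖z₁ - z₂‖)
      (by positivity : 0 ≤ L / c) (by linarith : 0 ≤ η / d + ε) (by linarith : 0 ≤ 0 + ε)
      ht h7 (hK.sig_bdd k z₁) (hK.sig_bdd k z₂) (hK.sig_lip k z₁ z₂)
    rw [hN]
    refine e1.trans (mul_le_mul_of_nonneg_left ?_ hN0)
    have e2 : L / c * (‖z₁ - z₂‖ + t) ^ 2 ≤ L / c * (h + η + t) ^ 2 := by gcongr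
    have e3 : (η / d + ε) * (1 + t) ^ 2 ≤ 2 * η * (1 + t) ^ 2 := by gcongr; linarith
    linarith
  rw [← hN] at hN0 hP hκ1 hη1
  exact doubling_arithmetic hδ hμ hκ hη hN0 hly.le hlp.le hcP.le hCb0 hκ1 hη1 hη3 hh0 hhc hcκ
    hch hhB hL hP hsum hlow htr

theorem exists_comparison (K : StructBounds) (n : ℕ) {R Cb : ℝ} (hR0 : 0 ≤ R) (hCb0 : 0 ≤ Cb) :
    ∃ L : ℝ, 1 ≤ L ∧ ∀ {m : ℕ} {σ : Fin m → Euc n → Fin n → Euc n}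
      {F : Fin m → Euc n → (Fin m → ℝ) → Euc n → ℝ} {δ : ℝ} {u v : Fin m → Euc n → ℝ} {ℓ : ℝ},
      Admissible K σ F → 0 < δ → JetSub σ F δ u → JetSup σ F δ ℓ v → L + 1 ≤ ℓ →
      (∀ k, Continuous (u k)) → (∀ k, Continuous (v k)) → ∀ B, (∀ k y, |u k y| ≤ B) →
      (∀ k y, |v k y| ≤ B) → (∀ k y, -Cb ≤ δ * u k y) → (∀ k j y, |v k y - v j y| ≤ R) →
      ∀ k x y, u k x - v k y ≤ L * ‖x - y‖ := by
  obtain ⟨P, hP⟩ : ∃ P : ℝ, P = 16 * (n * K.S ^ 2) + 1 := ⟨_, rfl⟩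
  have hP0 : 1 ≤ P := by
    have : 0 ≤ 16 * (n * K.S ^ 2) := by positivity
    linarith
  obtain ⟨L, hL⟩ : ∃ L : ℝ, L = K.lipy (R + 1) + 4 * P + 2 * K.coe P + 2 * Cb + 1 := ⟨_, rfl⟩
  have hly := K.lipy_pos (R + 1)
  have hcP := K.coe_pos P
  have hL1 : 1 ≤ L := by linarith
  have hL0 : 0 < L := by linarith
  refine ⟨L, hL1, ?_⟩
  intro m σ F δ u v ℓ hK hδ hsub hsup hℓ hu hv B hB hB' hCb hR k₀ x₀ y₀
  by_contra! hlt
  obtain ⟨μ, hμ⟩ : ∃ μ : ℝ, 4 * μ = u k₀ x₀ - v k₀ y₀ - L * ‖x₀ - y₀‖ :=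
    ⟨(u k₀ x₀ - v k₀ y₀ - L * ‖x₀ - y₀‖) / 4, by ring⟩
  have hμ0 : 0 < μ := by linarith
  obtain ⟨G, hG⟩ : ∃ G : ℝ, G = K.lipy (R + 1) + 9 * (n * K.S ^ 2) * L := ⟨_, rfl⟩
  have hG0 : 0 < G := by rw [hG]; positivity
  obtain ⟨κ, hκ⟩ : ∃ κ : ℝ, κ = min (μ / L) (δ * μ / 4 / G) := ⟨_, rfl⟩
  have hκ0 : 0 < κ := by rw [hκ]; positivity
  have hκ1 : κ * L ≤ μ := (le_div_iff₀ hL0).1 (hκ.le.trans (min_le_left _ _))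
  have hκ2 : κ * G ≤ δ * μ / 4 := (le_div_iff₀ hG0).1 (hκ.le.trans (min_le_right _ _))
  obtain ⟨Q, hQ⟩ : ∃ Q : ℝ, Q = 2 * δ + 2 * K.lipy (R + 1) + 4 * K.lip (L + R + 3)
      + n * K.S ^ 2 * (2 * (1 + 2 * B) ^ 2 + 1) := ⟨_, rfl⟩
  have hQ0 : 0 < Q := by
    have := K.lip_pos (L + R + 3)
    rw [hQ]; positivity
  obtain ⟨d, hd⟩ : ∃ d : ℝ, d = regNorm 1 (x₀ - 0) := ⟨_, rfl⟩
  have hd1 : 1 ≤ d := by rw [hd]; exact one_le_regNorm_one _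
  obtain ⟨η, hη⟩ : ∃ η : ℝ, η = min (min 1 κ) (min (μ / d) (δ * μ / 4 / Q)) := ⟨_, rfl⟩
  have hη0 : 0 < η := by rw [hη]; positivity
  have hη1 : η ≤ 1 := hη.le.trans ((min_le_left _ _).trans (min_le_left _ _))
  have hη2 : η ≤ κ := hη.le.trans ((min_le_left _ _).trans (min_le_right _ _))
  have hη3 : η * d ≤ μ := (le_div_iff₀ (by linarith)).1
    (hη.le.trans ((min_le_right _ _).trans (min_le_left _ _)))
  have hη4 : η * Q ≤ δ * μ / 4 := (le_div_iff₀ hQ0).1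
    (hη.le.trans ((min_le_right _ _).trans (min_le_right _ _)))
  have hex : ∀ k, ∃ V : Euc n × Euc n, ∀ W : Euc n × Euc n,
      u k W.1 - v k W.2 - L * regNorm κ (W.1 - W.2) - η * regNorm 1 (W.1 - 0)
      ≤ u k V.1 - v k V.2 - L * regNorm κ (V.1 - V.2) - η * regNorm 1 (V.1 - 0) := by
    intro k
    refine exists_max_of_le_sub_norm (C := 2 * B) (c := η / 2) ?_ (by positivity) fun W => ?_
    · have := hu k
      have := hv k
      have := continuous_regNorm (E := Euc n) 1
      have := continuous_regNorm (E := Euc n) κ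
      fun_prop
    · have e1 := (abs_le.1 (hB k W.1)).2
      have e2 := (abs_le.1 (hB' k W.2)).1
      have e3 := norm_le_regNorm 1 (W.1 - 0)
      rw [sub_zero] at e3 ⊢
      have e4 := norm_le_regNorm κ (W.1 - W.2)
      have e6 : ‖W‖ ≤ 2 * ‖W.1‖ + ‖W.1 - W.2‖ := by
        have e5 := norm_sub_le W.1 (W.1 - W.2)
        rw [sub_sub_cancel] at e5
        rw [Prod.norm_def]
        exact max_le (by linarith [norm_nonneg (W.1 - W.2), norm_nonneg W.1])
          (by linarith [norm_nonneg W.1])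
      have e7 : η / 2 * ‖W‖ ≤ η / 2 * (2 * ‖W.1‖ + ‖W.1 - W.2‖) := by gcongr
      have e8 : η * ‖W.1‖ ≤ η * regNorm 1 W.1 := by gcongr
      have e9 : η / 2 * ‖W.1 - W.2‖ ≤ L * regNorm κ (W.1 - W.2) := by
        gcongr; linarith
      linarith
  choose V hV using hex
  have : Nonempty (Fin m) := ⟨k₀⟩
  obtain ⟨k, hk⟩ := Finite.exists_max fun k =>
    u k (V k).1 - v k (V k).2 - L * regNorm κ ((V k).1 - (V k).2) - η * regNorm 1 ((V k).1 - 0)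
  have hmax : ∀ k' x' y', u k' x' - v k' y' - L * regNorm κ (x' - y') - η * regNorm 1 (x' - 0)
      ≤ u k (V k).1 - v k (V k).2 - L * regNorm κ ((V k).1 - (V k).2)
        - η * regNorm 1 ((V k).1 - 0) := fun k' x' y' => (hV k' (x', y')).trans (hk k')
  refine not_exists_doubling_max hK hδ hsub hsup hu hv hB hB' hR0 hCb0 hCb hR hP hL.ge hℓ hμ0 hκ0
    hη0 (hG ▸ hκ2) (hQ ▸ hη4) hη1 hη2 k _ _ hmax ?_
  have e1 := hmax k₀ x₀ y₀
  have e2 : L * regNorm κ (x₀ - y₀) ≤ L * (κ + ‖x₀ - y₀‖) := by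
    gcongr; exact regNorm_le hκ0.le _
  rw [← hd] at e1
  linarith

end Comparison

section QuadPoly

variable {E : Type*} [NormedAddCommGroup E] [InnerProductSpace ℝ E]

/-- The quadratic polynomial with value `a`, gradient `p` and Hessian form `Z` at the origin. -/
def quadPoly (a : ℝ) (p : E) (Z : E →L[ℝ] E) (h : E) : ℝ :=
  a + inner ℝ p h + 1 / 2 * inner ℝ (Z h) h

theorem quadPoly_zero (a : ℝ) (p : E) (Z : E →L[ℝ] E) : quadPoly a p Z 0 = a := by
  simp [quadPoly]

theorem continuous_quadPoly (a : ℝ) (p : E) (Z : E →L[ℝ] E) : Continuous (quadPoly a p Z) := by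
  unfold quadPoly; fun_prop

theorem quadPoly_sub_le (a : ℝ) (p : E) (Z : E →L[ℝ] E) {r : ℝ} {h h' : E} (hh : ‖h‖ ≤ r)
    (hh' : ‖h'‖ ≤ r) :
    quadPoly a p Z h - quadPoly a p Z h' ≤ (‖p‖ + ‖Z‖ * r) * ‖h - h'‖ := by
  have e1 : quadPoly a p Z h - quadPoly a p Z h'
      = inner ℝ p (h - h') + 1 / 2 * (inner ℝ (Z (h - h')) h + inner ℝ (Z h') (h - h')) := by
    simp only [quadPoly, map_sub, inner_sub_left, inner_sub_right]
    ring
  have e2 := real_inner_le_norm p (h - h')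
  have e3 : inner ℝ (Z (h - h')) h ≤ ‖Z‖ * ‖h - h'‖ * r :=
    (real_inner_le_norm _ _).trans (by gcongr; exact Z.le_opNorm _)
  have e4 : inner ℝ (Z h') (h - h') ≤ ‖Z‖ * r * ‖h - h'‖ :=
    (real_inner_le_norm _ _).trans (by
      gcongr; exact (Z.le_opNorm _).trans (by gcongr))
  rw [e1]
  linarith

theorem abs_quadPoly_sub_le (a : ℝ) (p : E) (Z : E →L[ℝ] E) {r : ℝ} {h : E} (hh : ‖h‖ ≤ r) :
    |quadPoly a p Z h - a| ≤ (‖p‖ + ‖Z‖ * r) * r := by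
  have hr : 0 ≤ r := (norm_nonneg _).trans hh
  have e1 := quadPoly_sub_le a p Z hh (h' := 0) (by simpa using hr)
  have e2 := quadPoly_sub_le a p Z (h := 0) (by simpa using hr) hh
  rw [quadPoly_zero] at e1 e2
  rw [sub_zero] at e1
  rw [zero_sub, norm_neg] at e2
  have e3 : (‖p‖ + ‖Z‖ * r) * ‖h‖ ≤ (‖p‖ + ‖Z‖ * r) * r := by gcongr
  exact abs_le.2 ⟨by linarith, by linarith⟩

theorem Jup.eq_and_le_of_quadratic_le {f : E → ℝ} {y p q : E} {X Z : E →L[ℝ] E} (h : Jup f y q X)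
    (hf : ∀ᶠ k in 𝓝 (0 : E), f y + inner ℝ p k + 1 / 2 * inner ℝ (Z k) k ≤ f (y + k)) :
    q = p ∧ ∀ k, inner ℝ (Z k) k ≤ inner ℝ (X k) k := by
  have key : ∀ η, 0 < η → ∀ k, ∀ᶠ t in 𝓝 (0 : ℝ), t * inner ℝ (p - q) k
      ≤ t ^ 2 * (1 / 2 * (inner ℝ (X k) k - inner ℝ (Z k) k) + η * ‖k‖ ^ 2) := by
    intro η hη k
    have ht : Tendsto (fun t : ℝ => t • k) (𝓝 0) (𝓝 0) := by
      have : Continuous fun t : ℝ => t • k := by fun_prop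
      simpa using this.tendsto 0
    filter_upwards [ht.eventually (h η hη), ht.eventually hf] with t h1 h2
    simp only [map_smul, real_inner_smul_left, real_inner_smul_right, norm_smul, mul_pow,
      Real.norm_eq_abs, sq_abs] at h1 h2
    rw [inner_sub_left]
    linarith
  have hpq : q = p := by
    rw [← sub_eq_zero, ← neg_eq_zero, neg_sub, ← norm_eq_zero]
    by_contra hne
    have hpos : 0 < ‖p - q‖ := (norm_nonneg _).lt_of_ne' hne
    have h1 := key 1 one_pos (p - q)
    rw [real_inner_self_eq_norm_sq] at h1
    obtain ⟨C, hC⟩ : ∃ C : ℝ, C = 1 / 2 * (inner ℝ (X (p - q)) (p - q)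
      - inner ℝ (Z (p - q)) (p - q)) + 1 * ‖p - q‖ ^ 2 := ⟨_, rfl⟩
    rw [← hC] at h1
    have h2 : ∀ᶠ t in 𝓝 (0 : ℝ), t * C < ‖p - q‖ ^ 2 := by
      have : Tendsto (fun t : ℝ => t * C) (𝓝 0) (𝓝 0) := by
        have : Continuous fun t : ℝ => t * C := by fun_prop
        simpa using this.tendsto 0
      exact this.eventually_lt_const (by positivity)
    obtain ⟨t, ⟨ht1, ht2⟩, ht0⟩ := (((h1.and h2).filter_mono nhdsWithin_le_nhds).and
      (self_mem_nhdsWithin (a := (0 : ℝ)) (s := Set.Ioi 0))).exists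
    have ht0' : 0 < t := ht0
    have := mul_lt_mul_of_pos_left ht2 ht0'
    nlinarith
  refine ⟨hpq, fun k => ?_⟩
  rw [← sub_nonpos]
  refine le_zero_of_forall_sub_mul_le (b := 2 * ‖k‖ ^ 2) fun η hη => ?_
  have h1 := key η hη k
  obtain ⟨t, ht1, ht0⟩ := ((h1.filter_mono nhdsWithin_le_nhds).and
      (self_mem_nhdsWithin (a := (0 : ℝ)) (s := Set.Ioi 0))).exists
  have ht0' : 0 < t := ht0
  rw [hpq, sub_self, inner_zero_left, mul_zero] at ht1
  have := nonneg_of_mul_nonneg_right ht1 (by positivity)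
  linarith

variable [CompleteSpace E]

/-- The gradient of `quadPoly a p Z` at `h`. -/
def quadGrad (p : E) (Z : E →L[ℝ] E) (h : E) : E :=
  p + (1 / 2 : ℝ) • (Z h + ContinuousLinearMap.adjoint Z h)

theorem quadPoly_add (a : ℝ) (p : E) (Z : E →L[ℝ] E) (h k : E) :
    quadPoly a p Z (h + k)
      = quadPoly a p Z h + inner ℝ (quadGrad p Z h) k + 1 / 2 * inner ℝ (Z k) k := by
  simp only [quadPoly, quadGrad, map_add, inner_add_left, inner_add_right, real_inner_smul_left,
    ContinuousLinearMap.adjoint_inner_left]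
  rw [real_inner_comm (Z k) h]
  ring

theorem norm_quadGrad_sub_le (p : E) (Z : E →L[ℝ] E) (h : E) :
    ‖quadGrad p Z h - p‖ ≤ ‖Z‖ * ‖h‖ := by
  have e1 := Z.le_opNorm h
  have e2 := (ContinuousLinearMap.adjoint Z).le_opNorm h
  rw [LinearIsometryEquiv.norm_map] at e2
  have e3 := norm_add_le (Z h) (ContinuousLinearMap.adjoint Z h)
  rw [quadGrad, add_sub_cancel_left, norm_smul, Real.norm_of_nonneg (by norm_num)]
  linarith

end QuadPoly

section ColTrace

variable {n : ℕ}

theorem colTrace_mono (σ : Fin n → Euc n) {X Z : Euc n →L[ℝ] Euc n}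
    (h : ∀ k, inner ℝ (Z k) k ≤ inner ℝ (X k) k) : colTrace σ Z ≤ colTrace σ X :=
  Finset.sum_le_sum fun i _ => h (σ i)

theorem colTrace_sub_le {σ₁ σ₂ : Fin n → Euc n} (X : Euc n →L[ℝ] Euc n) {S D : ℝ}
    (h1 : ∀ i, ‖σ₁ i‖ ≤ S) (h2 : ∀ i, ‖σ₂ i‖ ≤ S) (h3 : ∀ i, ‖σ₁ i - σ₂ i‖ ≤ D) :
    colTrace σ₁ X - colTrace σ₂ X ≤ n * (2 * S * ‖X‖ * D) := by
  rw [colTrace, colTrace, ← Finset.sum_sub_distrib]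
  calc ∑ i, (inner ℝ (X (σ₁ i)) (σ₁ i) - inner ℝ (X (σ₂ i)) (σ₂ i))
      ≤ ∑ _i : Fin n, 2 * S * ‖X‖ * D := Finset.sum_le_sum fun i _ => by
        have e1 : inner ℝ (X (σ₁ i)) (σ₁ i) - inner ℝ (X (σ₂ i)) (σ₂ i)
            = inner ℝ (X (σ₁ i - σ₂ i)) (σ₁ i) + inner ℝ (X (σ₂ i)) (σ₁ i - σ₂ i) := by
          simp only [map_sub, inner_sub_left, inner_sub_right]; ring
        have hS : 0 ≤ S := (norm_nonneg _).trans (h1 i)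
        have hD : 0 ≤ D := (norm_nonneg _).trans (h3 i)
        have e2 : inner ℝ (X (σ₁ i - σ₂ i)) (σ₁ i) ≤ ‖X‖ * D * S :=
          (real_inner_le_norm _ _).trans (mul_le_mul ((X.le_opNorm _).trans
            (mul_le_mul_of_nonneg_left (h3 i) (norm_nonneg _))) (h1 i) (norm_nonneg _)
            (by positivity))
        have e3 : inner ℝ (X (σ₂ i)) (σ₁ i - σ₂ i) ≤ ‖X‖ * S * D :=
          (real_inner_le_norm _ _).trans (mul_le_mul ((X.le_opNorm _).trans
            (mul_le_mul_of_nonneg_left (h2 i) (norm_nonneg _))) (h3 i) (norm_nonneg _)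
            (by positivity))
        rw [e1]; linarith
    _ = n * (2 * S * ‖X‖ * D) := by simp

theorem le_zero_of_forall_le_mul {a b : ℝ} (h : ∀ e, 0 < e → e ≤ 1 → a ≤ e * b) : a ≤ 0 := by
  by_contra! ha
  have hb : 0 < b := by
    have := h 1 one_pos le_rfl
    linarith
  have h1 := h (min 1 (a / 2 / b)) (by positivity) (min_le_left _ _)
  have h2 : min 1 (a / 2 / b) * b ≤ a / 2 := by
    rw [← le_div_iff₀ hb]; exact min_le_right _ _
  linarith

end ColTrace

section Perron

theorem Jup.of_quadPoly {E : Type*} [NormedAddCommGroup E] [InnerProductSpace ℝ E]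
    [CompleteSpace E] {f : E → ℝ} {a : ℝ} {p y h : E} {Z : E →L[ℝ] E}
    (hf : ∀ᶠ k in 𝓝 (0 : E), f (y + h + k) ≤ f (y + h) + (quadPoly a p Z (h + k)
      - quadPoly a p Z h)) : Jup f (y + h) (quadGrad p Z h) Z := by
  intro η hη
  filter_upwards [hf] with k hk
  rw [quadPoly_add] at hk
  have : 0 ≤ η * ‖k‖ ^ 2 := by positivity
  linarith

variable {n m : ℕ} {σ : Fin m → Euc n → Fin n → Euc n}
  {F : Fin m → Euc n → (Fin m → ℝ) → Euc n → ℝ} {δ : ℝ} {V : Fin m → Euc n → ℝ}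
  {K : StructBounds}

theorem norm_add_smul_id_le (X : Euc n →L[ℝ] Euc n) {t : ℝ} (ht : |t| ≤ 4) :
    ‖X + t • ContinuousLinearMap.id ℝ (Euc n)‖ ≤ ‖X‖ + 4 := by
  refine (norm_add_le _ _).trans ?_
  gcongr
  rw [norm_smul, Real.norm_eq_abs]
  have := ContinuousLinearMap.norm_id_le (𝕜 := ℝ) (E := Euc n)
  calc |t| * ‖ContinuousLinearMap.id ℝ (Euc n)‖ ≤ |t| * 1 := by gcongr
    _ ≤ 4 := by linarith

theorem quadPoly_add_smul_id (a : ℝ) (p : Euc n) (X : Euc n →L[ℝ] Euc n) (t : ℝ) (h : Euc n) :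
    quadPoly a p (X + t • ContinuousLinearMap.id ℝ (Euc n)) h
      = a + inner ℝ p h + 1 / 2 * inner ℝ (X h) h + t / 2 * ‖h‖ ^ 2 := by
  simp only [quadPoly, _root_.add_apply, _root_.smul_apply, ContinuousLinearMap.id_apply,
    inner_add_left, real_inner_smul_left, real_inner_self_eq_norm_sq]
  ring

theorem JetSub.of_sup (hK : Admissible K σ F) (hδ : 0 < δ) {ℓ B : ℝ} (hℓ : 0 ≤ ℓ)
    {W : Set (Fin m → Euc n → ℝ)} (hW : ∀ w ∈ W, (∀ k, Continuous (w k)) ∧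
      (∀ k x y, w k x - w k y ≤ ℓ * ‖x - y‖) ∧ JetSub σ F δ w ∧ ∀ k y, w k y ≤ V k y)
    (hV : ∀ k x y, V k x - V k y ≤ ℓ * ‖x - y‖) (hB : ∀ k y, |V k y| ≤ B)
    (hsup : ∀ k y ν, 0 < ν → ∃ w ∈ W, V k y - ν < w k y) : JetSub σ F δ V := by
  intro k y q X hX
  obtain ⟨A, hA⟩ : ∃ A : ℝ, A = ‖X‖ + 4 := ⟨_, rfl⟩
  have hA0 : 0 ≤ A := by rw [hA]; positivity
  have hB0 : 0 ≤ B := (abs_nonneg _).trans (hB k y)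
  have hS := K.S_pos
  have hly := K.lipy_pos (2 * B + (1 + 2 * ℓ))
  have hlp := K.lip_pos (‖q‖ + A + (2 * B + (1 + 2 * ℓ)))
  refine le_zero_of_forall_le_mul (b := δ * (1 + ℓ) + n * (2 * K.S * ‖X‖ * K.S)
    + 4 * (n * K.S ^ 2) + K.lipy (2 * B + (1 + 2 * ℓ))
    + K.lip (‖q‖ + A + (2 * B + (1 + 2 * ℓ))) * (A + (1 + 2 * ℓ))) fun e he he1 => ?_
  obtain ⟨ρ, hρ, hball⟩ := Metric.eventually_nhds_iff_ball.1 (hX e he)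
  obtain ⟨r, hr⟩ : ∃ r : ℝ, r = min (ρ / 2) e := ⟨_, rfl⟩
  have hr0 : 0 < r := by rw [hr]; positivity
  have hre : r ≤ e := hr.le.trans (min_le_right _ _)
  have hrρ : r < ρ := (hr.le.trans (min_le_left _ _)).trans_lt (by linarith)
  obtain ⟨w, hwW, hw⟩ := hsup k y (e * r ^ 2) (by positivity)
  obtain ⟨hwc, hwl, hws, hwV⟩ := hW w hwW
  obtain ⟨Z, hZ⟩ : ∃ Z : Euc n →L[ℝ] Euc n, Z = X + (4 * e) • ContinuousLinearMap.id ℝ (Euc n) :=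
    ⟨_, rfl⟩
  have hZn : ‖Z‖ ≤ A := by
    rw [hZ, hA]
    exact norm_add_smul_id_le X (by rw [abs_of_pos (by positivity)]; linarith)
  obtain ⟨h, hh, hmax⟩ := (isCompact_closedBall (0 : Euc n) r).exists_isMaxOn
    ⟨0, by simpa using hr0.le⟩
    (f := fun h => w k (y + h) - quadPoly 0 q Z h) (by
      have := hwc k
      have := continuous_quadPoly 0 q Z
      exact Continuous.continuousOn (by fun_prop))
  rw [mem_closedBall_zero_iff] at hh
  have hhr : ‖h‖ < r := by
    have e1 : w k (y + 0) - quadPoly 0 q Z 0 ≤ w k (y + h) - quadPoly 0 q Z h :=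
      hmax (by simpa using hr0.le)
    have e2 := hball h (by simpa using hh.trans_lt hrρ)
    have e3 := hwV k (y + h)
    rw [add_zero, quadPoly_zero, hZ, quadPoly_add_smul_id] at e1
    have e4 : e * ‖h‖ ^ 2 < e * r ^ 2 := by linarith
    exact lt_of_pow_lt_pow_left₀ 2 hr0.le (lt_of_mul_lt_mul_left e4 he.le)
  have hjet : Jup (w k) (y + h) (quadGrad q Z h) Z := by
    refine Jup.of_quadPoly (a := 0) ?_
    filter_upwards [Metric.ball_mem_nhds (0 : Euc n) (sub_pos.2 hhr)] with x hx
    have e1 : w k (y + (h + x)) - quadPoly 0 q Z (h + x) ≤ w k (y + h) - quadPoly 0 q Z h :=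
      hmax (by
        rw [mem_ball_zero_iff] at hx
        rw [mem_closedBall_zero_iff]
        linarith [norm_add_le h x])
    rw [add_assoc]
    linarith
  have hg := norm_quadGrad_sub_le q Z h
  have hg' : ‖quadGrad q Z h - q‖ ≤ A * e :=
    hg.trans (by gcongr; linarith)
  have h1 := hws k (y + h) _ _ hjet
  have hyh : ‖y - (y + h)‖ ≤ e := by
    rw [sub_add_cancel_left, norm_neg]; linarith
  have hyh' : ‖y + h - y‖ ≤ e := by rwa [norm_sub_rev]
  have hr2 : e * r ^ 2 ≤ e := by
    have : r ^ 2 ≤ 1 := pow_le_one₀ hr0.le (by linarith)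
    nlinarith
  have hwk : V k y - (1 + ℓ) * e ≤ w k (y + h) := by
    have e1 := hwl k y (y + h)
    have e2 : ℓ * ‖y - (y + h)‖ ≤ ℓ * e := by gcongr
    linarith
  have hwj : ∀ j, w j (y + h) ≤ V j y + ℓ * e := fun j => by
    have e1 := hV j (y + h) y
    have e2 : ℓ * ‖y + h - y‖ ≤ ℓ * e := by gcongr
    linarith [hwV j (y + h)]
  have hee : (1 + 2 * ℓ) * e ≤ 1 + 2 * ℓ := mul_le_of_le_one_right (by linarith) he1
  have hAe : A * e ≤ A := mul_le_of_le_one_right hA0 he1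
  have hF := hK.sub_le (R := 2 * B) (R₁ := 2 * B + (1 + 2 * ℓ))
    (R' := ‖q‖ + A + (2 * B + (1 + 2 * ℓ))) (e := (1 + 2 * ℓ) * e) (k := k)
    (q := quadGrad q Z h) (q' := q) (s := fun j => w k (y + h) - w j (y + h))
    (s' := fun j => V k y - V j y) (z := y + h) (z' := y) (by positivity)
    (by linarith [norm_sub_norm_le (quadGrad q Z h) q]) (by linarith)
    (fun i => by
      have e1 := abs_le.1 (hB k y)
      have e2 := abs_le.1 (hB i y)
      exact abs_le.2 ⟨by linarith, by linarith⟩) (by linarith) (by linarith)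
    (by linarith [norm_nonneg q]) (fun i => by linarith [hwj i])
  have htr : colTrace (σ k (y + h)) Z - colTrace (σ k y) X
      ≤ n * (2 * K.S * ‖X‖ * (K.S * e)) + 4 * e * (n * K.S ^ 2) := by
    have e1 := colTrace_sub_le X (hK.sig_bdd k (y + h)) (hK.sig_bdd k y)
      (D := K.S * e) (fun i => (hK.sig_lip k (y + h) y i).trans (by gcongr))
    have e2 : 4 * e * ∑ i, ‖σ k (y + h) i‖ ^ 2 ≤ 4 * e * (n * K.S ^ 2) :=
      mul_le_mul_of_nonneg_left (hK.sum_sq_le k (y + h)) (by linarith)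
    rw [hZ, colTrace_add, colTrace_smul_id]
    linarith
  have hδw := mul_le_mul_of_nonneg_left hwk hδ.le
  have hf1 : K.lipy (2 * B + (1 + 2 * ℓ)) * ‖y + h - y‖ ≤ K.lipy (2 * B + (1 + 2 * ℓ)) * e := by
    gcongr
  have hf2 : K.lip (‖q‖ + A + (2 * B + (1 + 2 * ℓ))) * (‖quadGrad q Z h - q‖ + (1 + 2 * ℓ) * e)
      ≤ K.lip (‖q‖ + A + (2 * B + (1 + 2 * ℓ))) * (A * e + (1 + 2 * ℓ) * e) := by gcongr
  linarith

theorem exists_bump {ℓ B : ℝ} (hK : Admissible K σ F)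
    (hV : ∀ k x y, V k x - V k y ≤ ℓ * ‖x - y‖) (hB : ∀ k y, V k y ≤ B) (hsub : JetSub σ F δ V)
    {k : Fin m} {y₀ p : Euc n} {Z : Euc n →L[ℝ] Euc n} {r κ : ℝ} (hr : 0 < r)
    (hsphere : ∀ h, ‖h‖ = r → quadPoly (V k y₀) p Z h + κ ≤ V k (y₀ + h))
    (hpZ : ‖p‖ + ‖Z‖ * r ≤ ℓ)
    (hsol : ∀ h, ‖h‖ < r → V k (y₀ + h) < quadPoly (V k y₀) p Z h + κ →
      δ * (quadPoly (V k y₀) p Z h + κ) - colTrace (σ k (y₀ + h)) Z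
        + F k (quadGrad p Z h)
          (fun j => if j = k then 0 else quadPoly (V k y₀) p Z h + κ - V j (y₀ + h)) (y₀ + h) ≤ 0) :
    ∃ w : Fin m → Euc n → ℝ, (∀ k x y, w k x - w k y ≤ ℓ * ‖x - y‖) ∧ JetSub σ F δ w ∧
      (∀ k y, V k y ≤ w k y) ∧ (∃ B', ∀ k y, w k y ≤ B') ∧ V k y₀ + κ ≤ w k y₀ := by
  classical
  obtain ⟨ψ, hψ⟩ : ∃ ψ : Euc n → ℝ, ∀ x, ψ x = quadPoly (V k y₀) p Z (x - y₀) + κ :=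
    ⟨_, fun _ => rfl⟩
  obtain ⟨b, hbin, hbout, hbor⟩ : ∃ b : Euc n → ℝ, (∀ x, ‖x - y₀‖ ≤ r → b x = max (V k x) (ψ x)) ∧
      (∀ x, r ≤ ‖x - y₀‖ → b x = V k x) ∧
      (∀ x, b x = V k x ∨ ‖x - y₀‖ < r ∧ V k x < ψ x ∧ b x = ψ x) := by
    have hs : ∀ x, ‖x - y₀‖ = r → ψ x ≤ V k x := fun x hx => by
      have := hsphere (x - y₀) hx
      rwa [← hψ, add_sub_cancel] at this
    refine ⟨fun x => if ‖x - y₀‖ ≤ r then max (V k x) (ψ x) else V k x, fun x hx => if_pos hx,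
      fun x hx => ?_, fun x => ?_⟩
    · rcases hx.eq_or_lt with h | h
      · simp only [h.symm.le, if_true]
        exact max_eq_left (hs x h.symm)
      · simp only [not_le.2 h, if_false]
    · by_cases hx : ‖x - y₀‖ ≤ r
      · simp only [hx, if_true]
        rcases le_or_gt (ψ x) (V k x) with h | h
        · exact Or.inl (max_eq_left h)
        · refine Or.inr ⟨hx.lt_of_ne fun hxr => ?_, h, max_eq_right h.le⟩
          linarith [hs x hxr]
      · simp only [hx, if_false, true_or]
  have hVb : ∀ x, V k x ≤ b x := fun x => by
    rcases hbor x with h | ⟨-, h1, h2⟩ <;> linarith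
  have hψl : ∀ x y, ‖x - y₀‖ ≤ r → ‖y - y₀‖ ≤ r → ψ x - ψ y ≤ ℓ * ‖x - y‖ := fun x y hx hy => by
    have e1 := quadPoly_sub_le (V k y₀) p Z hx hy
    rw [sub_sub_sub_cancel_right] at e1
    have e2 : (‖p‖ + ‖Z‖ * r) * ‖x - y‖ ≤ ℓ * ‖x - y‖ := by gcongr
    rw [hψ, hψ]
    linarith
  have hbl : ∀ x y, b x - b y ≤ ℓ * ‖x - y‖ := by
    intro x y
    rcases hbor x with h | ⟨hx, -, h⟩
    · linarith [hVb y, hV k x y]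
    · rcases le_or_gt ‖y - y₀‖ r with hy | hy
      · have := hbin y hy
        linarith [le_max_right (V k y) (ψ y), hψl x y hx.le hy]
      · obtain ⟨t, ⟨ht0, ht1⟩, ht⟩ := intermediate_value_Icc (zero_le_one (α := ℝ))
          (f := fun t : ℝ => ‖x + t • (y - x) - y₀‖)
          (Continuous.continuousOn (by fun_prop)) (show r ∈ Set.Icc _ _ by
            simp only [zero_smul, add_zero, one_smul, add_sub_cancel]
            exact ⟨hx.le, hy.le⟩)
        have e1 := hψl x (x + t • (y - x)) hx.le ht.le
        have e2 := hV k (x + t • (y - x)) y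
        have e3 : ψ (x + t • (y - x)) ≤ V k (x + t • (y - x)) := by
          rw [← hbout _ (le_of_eq ht.symm), hbin _ ht.le]; exact le_max_right _ _
        have e4 : ‖x - (x + t • (y - x))‖ = t * ‖x - y‖ := by
          rw [show x - (x + t • (y - x)) = t • (x - y) by module, norm_smul,
            Real.norm_of_nonneg ht0]
        have e5 : ‖x + t • (y - x) - y‖ = (1 - t) * ‖x - y‖ := by
          rw [show x + t • (y - x) - y = (1 - t) • (x - y) by module, norm_smul,
            Real.norm_of_nonneg (by linarith)]
        have e6 := hbout y hy.le
        rw [e4] at e1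
        rw [e5] at e2
        linarith
  have hbB : ∃ B', ∀ x, b x ≤ B' := by
    refine ⟨max B (V k y₀ + ℓ * r + κ), fun x => ?_⟩
    rcases hbor x with h | ⟨hx, -, h⟩
    · exact h.le.trans ((hB k x).trans (le_max_left _ _))
    · refine le_trans ?_ (le_max_right _ _)
      have e1 := (abs_le.1 (abs_quadPoly_sub_le (V k y₀) p Z hx.le)).2
      have e2 : (‖p‖ + ‖Z‖ * r) * r ≤ ℓ * r := by gcongr
      rw [h, hψ]
      linarith
  refine ⟨Function.update V k b, fun i x y => ?_, fun i y q X hX => ?_, fun i y => ?_, ?_, ?_⟩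
  · rcases eq_or_ne i k with rfl | hi
    · simpa using hbl x y
    · simpa [hi] using hV i x y
  · have hmono : ∀ j, V j y ≤ Function.update V k b j y := fun j => by
      rcases eq_or_ne j k with rfl | hj
      · simpa using hVb y
      · simp [hj]
    have hcase : Function.update V k b i y = V i y → Jup (V i) y q X →
        δ * Function.update V k b i y - colTrace (σ i y) X
          + F i q (fun j => Function.update V k b i y - Function.update V k b j y) y ≤ 0 := by
      intro h hJ
      have e1 := hsub i y q X hJ
      have e2 := hK.mono i q (fun j => Function.update V k b i y - Function.update V k b j y)
        (fun j => V i y - V j y) y (fun j => by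
          have := hmono j
          simp only
          linarith)
      rw [h] at e2 ⊢
      linarith
    rcases eq_or_ne i k with rfl | hi
    · rw [Function.update_self] at hX
      rcases hbor y with h | ⟨hy, hVy, h⟩
      · refine hcase (by rw [Function.update_self, h]) ?_
        exact hX.of_touch (Eventually.of_forall hVb) h.le
      · have hev : ∀ᶠ h in 𝓝 (0 : Euc n), b y + inner ℝ (quadGrad p Z (y - y₀)) h
            + 1 / 2 * inner ℝ (Z h) h ≤ b (y + h) := by
          have hc : ∀ᶠ h in 𝓝 (0 : Euc n), ‖y + h - y₀‖ < r := by
            have : Continuous fun h : Euc n => ‖y + h - y₀‖ := by fun_prop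
            exact this.continuousAt.eventually_lt continuousAt_const (by simpa using hy)
          filter_upwards [hc] with h' hh'
          have e1 := hbin _ hh'.le
          have e2 := le_max_right (V i (y + h')) (ψ (y + h'))
          rw [← e1, hψ, show y + h' - y₀ = (y - y₀) + h' by abel, quadPoly_add] at e2
          rw [hψ] at h
          linarith
        obtain ⟨hq, hZ⟩ := hX.eq_and_le_of_quadratic_le hev
        have e1 := hsol (y - y₀) hy
        rw [add_sub_cancel, ← hψ] at e1
        have e2 := e1 hVy
        have e3 := colTrace_mono (σ i y) hZ
        have e4 : (fun j => Function.update V i b i y - Function.update V i b j y)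
            = fun j => if j = i then 0 else ψ y - V j y := by
          ext j
          rcases eq_or_ne j i with rfl | hj
          · simp
          · simp [hj, h]
        rw [e4, hq, Function.update_self, h]
        linarith
    · rw [Function.update_of_ne hi] at hX
      exact hcase (by rw [Function.update_of_ne hi]) hX
  · rcases eq_or_ne i k with rfl | hi
    · simpa using hVb y
    · simp [hi]
  · obtain ⟨B', hB'⟩ := hbB
    refine ⟨max B B', fun i y => ?_⟩
    rcases eq_or_ne i k with rfl | hi
    · simpa using Or.inr (hB' y)
    · simpa [hi] using Or.inl (hB i y)
  · have e1 := hbin y₀ (by simpa using hr.le)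
    have e2 := le_max_right (V k y₀) (ψ y₀)
    rw [← e1, hψ, sub_self, quadPoly_zero] at e2
    simpa using e2

end Perron

section Maximal

variable {n m : ℕ} {K : StructBounds} {σ : Fin m → Euc n → Fin n → Euc n}
  {F : Fin m → Euc n → (Fin m → ℝ) → Euc n → ℝ} {δ : ℝ} {V : Fin m → Euc n → ℝ}

/-- A maximal Lipschitz subsolution is a supersolution at gradients below the Lipschitz bound. -/
theorem JetSub.jetSup_of_maximal {ℓ B : ℝ} (hK : Admissible K σ F) (hδ : 0 < δ) (hℓ : 0 ≤ ℓ)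
    (hV : ∀ k x y, V k x - V k y ≤ ℓ * ‖x - y‖) (hB : ∀ k y, |V k y| ≤ B) (hsub : JetSub σ F δ V)
    (hmax : ∀ w : Fin m → Euc n → ℝ, (∀ k x y, w k x - w k y ≤ ℓ * ‖x - y‖) → JetSub σ F δ w →
      (∀ k y, V k y ≤ w k y) → (∃ B', ∀ k y, w k y ≤ B') → ∀ k y, w k y ≤ V k y) :
    JetSup σ F δ ℓ V := by
  intro k y q X hq hX
  obtain ⟨C, hC⟩ : ∃ C : ℝ, C = ‖X‖ + 4 := ⟨_, rfl⟩
  have hX0 := norm_nonneg X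
  have hC0 : 0 < C := by linarith
  have hB0 : 0 ≤ B := (abs_nonneg _).trans (hB k y)
  obtain ⟨R, hR⟩ : ∃ R : ℝ, R = 2 * B + ℓ + 1 := ⟨_, rfl⟩
  obtain ⟨R₁, hR₁⟩ : ∃ R₁ : ℝ, R₁ = R + 2 * ℓ + 1 := ⟨_, rfl⟩
  obtain ⟨R', hR'⟩ : ∃ R' : ℝ, R' = R₁ + ℓ := ⟨_, rfl⟩
  have hly := K.lipy_pos R₁
  have hlp := K.lip_pos R'
  obtain ⟨M, hM⟩ : ∃ M : ℝ, M = δ * (ℓ + 1) + n * (2 * K.S * ‖X‖ * K.S) + 4 * (n * K.S ^ 2)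
    + K.lipy R₁ + K.lip R' * (C + (2 * ℓ + 1)) := ⟨_, rfl⟩
  obtain ⟨G, hG⟩ : ∃ G : ℝ, G = δ * V k y + colTrace (σ k y) X
    + F k (-q) (fun j => V k y - V j y) y := ⟨_, rfl⟩
  obtain ⟨t, ht⟩ : ∃ t : ℝ, t = min 1 ((ℓ - ‖q‖) / C) := ⟨_, rfl⟩
  have ht0 : 0 < t := by
    rw [ht]; exact lt_min one_pos (div_pos (by linarith) hC0)
  have ht1 : t ≤ 1 := ht.le.trans (min_le_left _ _)
  have ht2 : t * C ≤ ℓ - ‖q‖ := (le_div_iff₀ hC0).1 (ht.le.trans (min_le_right _ _))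
  have key : ∀ e : ℝ, 0 < e → e ≤ 1 → ‖q‖ + C * e ≤ ℓ → -G ≤ e * M := by
    intro e he0 he1 hqe
    by_contra! hlt
    obtain ⟨ρ, hρ, hball⟩ := Metric.eventually_nhds_iff_ball.1 (hX e he0)
    obtain ⟨r, hr⟩ : ∃ r : ℝ, r = min (ρ / 2) e := ⟨_, rfl⟩
    have hr0 : 0 < r := by rw [hr]; positivity
    have hre : r ≤ e := hr.le.trans (min_le_right _ _)
    have hrρ : r < ρ := (hr.le.trans (min_le_left _ _)).trans_lt (by linarith)
    obtain ⟨Z, hZ⟩ : ∃ Z : Euc n →L[ℝ] Euc n,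
        Z = -X + (-4 * e) • ContinuousLinearMap.id ℝ (Euc n) := ⟨_, rfl⟩
    have hZC : ‖Z‖ ≤ C := by
      have := norm_add_smul_id_le (-X) (t := -4 * e) (by
        rw [abs_mul, abs_of_pos he0]; norm_num; linarith)
      rwa [norm_neg, ← hZ, ← hC] at this
    have hquad : ∀ h, quadPoly (V k y) (-q) Z h
        = V k y - inner ℝ q h - 1 / 2 * inner ℝ (X h) h - 2 * e * ‖h‖ ^ 2 := fun h => by
      simp only [quadPoly, hZ, _root_.add_apply, _root_.smul_apply, _root_.neg_apply,
        ContinuousLinearMap.id_apply, inner_add_left,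
        inner_neg_left, real_inner_smul_left, real_inner_self_eq_norm_sq]
      ring
    have hκ : 0 < e * r ^ 2 := by positivity
    have hκe : e * r ^ 2 ≤ e := by
      have : r ^ 2 ≤ 1 := pow_le_one₀ hr0.le (hre.trans he1)
      nlinarith
    have hpZ : ‖-q‖ + ‖Z‖ * r ≤ ℓ := by
      have : ‖Z‖ * r ≤ C * e := by gcongr
      rw [norm_neg]; linarith
    obtain ⟨w, hw1, hw2, hw3, hw4, hw5⟩ := exists_bump (k := k) (y₀ := y) (p := -q) (Z := Z)
      (r := r) (κ := e * r ^ 2) hK hV (fun k y => (le_abs_self _).trans (hB k y)) hsub hr0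
      (fun h hh => by
        have := hball h (by simpa [hh] using hrρ)
        rw [hquad, hh]
        rw [hh] at this
        linarith) hpZ (fun h hh _ => by
        obtain ⟨T, hT⟩ : ∃ T : ℝ, T = quadPoly (V k y) (-q) Z h + e * r ^ 2 := ⟨_, rfl⟩
        rw [← hT]
        have hhe : ‖h‖ ≤ e := hh.le.trans hre
        have hTV : |T - V k y| ≤ (ℓ + 1) * e := by
          have e1 := abs_quadPoly_sub_le (V k y) (-q) Z hh.le
          have e2 : (‖-q‖ + ‖Z‖ * r) * r ≤ ℓ * e := by gcongr
          rw [hT]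
          rw [abs_le] at e1 ⊢
          constructor <;> linarith
        rw [abs_le] at hTV
        have d1 : δ * T ≤ δ * V k y + δ * ((ℓ + 1) * e) := by
          rw [← mul_add]; gcongr; linarith
        have d2 : colTrace (σ k (y + h)) X - colTrace (σ k y) X
            ≤ n * (2 * K.S * ‖X‖ * K.S) * e := by
          have := colTrace_sub_le X (hK.sig_bdd k (y + h)) (hK.sig_bdd k y) (D := K.S * e)
            (fun i => (hK.sig_lip k (y + h) y i).trans (by
              have := K.S_pos
              rw [add_sub_cancel_left]; gcongr))
          linarith
        have d3 : colTrace (σ k (y + h)) Z = - colTrace (σ k (y + h)) X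
            + (-4 * e) * ∑ i, ‖σ k (y + h) i‖ ^ 2 := by
          rw [hZ, colTrace_add, colTrace_neg, colTrace_smul_id]
        have d4 := mul_le_mul_of_nonneg_left (hK.sum_sq_le k (y + h)) he0.le
        have hg : ‖quadGrad (-q) Z h - -q‖ ≤ C * e :=
          (norm_quadGrad_sub_le _ _ _).trans (by gcongr)
        have hVh : ∀ i, |V i y - V i (y + h)| ≤ ℓ * e := fun i => by
          have e1 := hV i y (y + h)
          have e2 := hV i (y + h) y
          have e3 : ℓ * ‖h‖ ≤ ℓ * e := by gcongr
          rw [sub_add_cancel_left, norm_neg] at e1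
          rw [add_sub_cancel_left] at e2
          rw [abs_le]; constructor <;> linarith
        have hℓe : ℓ * e ≤ ℓ := by nlinarith
        have d5 := hK.sub_le (R := R) (R₁ := R₁) (R' := R') (e := (2 * ℓ + 1) * e) (k := k)
          (q := -q) (q' := quadGrad (-q) Z h) (s := fun j => V k y - V j y)
          (s' := fun j => if j = k then 0 else T - V j (y + h)) (z := y) (z' := y + h)
          (by positivity) (by rw [norm_neg]; linarith)
          (by
            have := norm_le_norm_add_norm_sub' (quadGrad (-q) Z h) (-q)
            rw [norm_neg] at this
            linarith)
          (fun i => by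
            rcases eq_or_ne i k with rfl | hi
            · simp only [if_true, abs_zero]; linarith
            · simp only [hi, if_false]
              have e1 := abs_le.1 (hB i (y + h))
              have e2 := abs_le.1 (hB k y)
              rw [abs_le]
              constructor <;> linarith)
          (by linarith) (by linarith) (by linarith)
          (fun i => by
            have hp : 0 ≤ (2 * ℓ + 1) * e := by positivity
            rcases eq_or_ne i k with rfl | hi
            · simp only [if_true, sub_self]; linarith
            · simp only [hi, if_false]
              have e1 := abs_le.1 (hVh i)
              linarith)
        have d6 : K.lipy R₁ * ‖y - (y + h)‖ ≤ K.lipy R₁ * e := by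
          rw [sub_add_cancel_left, norm_neg]; gcongr
        have d7 : K.lip R' * (‖-q - quadGrad (-q) Z h‖ + (2 * ℓ + 1) * e)
            ≤ K.lip R' * (C * e + (2 * ℓ + 1) * e) := by
          rw [norm_sub_rev]; gcongr
        have d8 : e * M = δ * ((ℓ + 1) * e) + n * (2 * K.S * ‖X‖ * K.S) * e
            + 4 * (e * (n * K.S ^ 2)) + K.lipy R₁ * e
            + K.lip R' * (C * e + (2 * ℓ + 1) * e) := by rw [hM]; ring
        linarith)
    have := hmax w hw1 hw2 hw3 hw4 k y
    linarith
  have := le_zero_of_forall_le_mul (a := -G) (b := t * M) fun e he0 he1 => by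
    have h1 : e * t * C ≤ ℓ - ‖q‖ := by
      have : e * (t * C) ≤ 1 * (t * C) := by gcongr
      linarith
    have := key (e * t) (by positivity) (mul_le_one₀ he1 ht0.le ht1) (by linarith)
    linarith
  linarith

end Maximal

section Existence

variable {n m : ℕ} {K : StructBounds} {σ : Fin m → Euc n → Fin n → Euc n}
  {F : Fin m → Euc n → (Fin m → ℝ) → Euc n → ℝ} {δ : ℝ}

theorem continuous_of_forall_sub_le {f : Euc n → ℝ} {ℓ : ℝ}
    (h : ∀ x y, f x - f y ≤ ℓ * ‖x - y‖) : Continuous f := by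
  refine (LipschitzWith.of_le_add_mul' ℓ fun x y => ?_).continuous
  rw [dist_eq_norm]
  linarith [h x y]

theorem Jup.norm_le_of_lipschitz {f : Euc n → ℝ} {L : ℝ} {y q : Euc n} {X : Euc n →L[ℝ] Euc n}
    (h : Jup f y q X) (hL : 0 ≤ L) (hf : ∀ z, f y - f z ≤ L * ‖y - z‖) : ‖q‖ ≤ L := by
  have hc : Tendsto (fun t : ℝ => -t • q) (𝓝 0) (𝓝 0) := by
    have : Continuous fun t : ℝ => -t • q := by fun_prop
    simpa using this.tendsto 0
  have ht : Tendsto (fun t : ℝ => t * (1 / 2 * inner ℝ (X q) q + ‖q‖ ^ 2)) (𝓝[>] 0) (𝓝 0) := by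
    have : Continuous fun t : ℝ => t * (1 / 2 * inner ℝ (X q) q + ‖q‖ ^ 2) := by fun_prop
    simpa using (this.tendsto 0).mono_left nhdsWithin_le_nhds
  have key : ‖q‖ ^ 2 - L * ‖q‖ ≤ 0 := by
    refine ge_of_tendsto ht ?_
    filter_upwards [(hc.eventually (h 1 one_pos)).filter_mono nhdsWithin_le_nhds,
      self_mem_nhdsWithin] with t h1 h2
    have h2 : 0 < t := h2
    have h3 := hf (y + -t • q)
    have e1 : ‖y - (y + -t • q)‖ = t * ‖q‖ := by
      rw [sub_add_cancel_left, norm_neg, norm_smul, norm_neg, Real.norm_of_nonneg h2.le]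
    rw [e1] at h3
    simp only [map_smul, inner_smul_left, inner_smul_right, norm_smul, norm_neg,
      Real.norm_of_nonneg h2.le, real_inner_self_eq_norm_sq, RCLike.conj_to_real] at h1
    have h4 : t * (‖q‖ ^ 2 - L * ‖q‖) ≤ t * (t * (1 / 2 * inner ℝ (X q) q + ‖q‖ ^ 2)) := by
      nlinarith
    exact le_of_mul_le_mul_left h4 h2
  by_contra! hlt
  nlinarith

theorem Admissible.jetSub_const (hK : Admissible K σ F) {b : ℝ} (hb : δ * b ≤ -(K.bdd 1)) :
    JetSub σ F δ fun _ _ => b := by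
  intro k y q X hX
  obtain ⟨hq, hZ⟩ := Jup.eq_and_le_of_quadratic_le (p := 0) (Z := 0) hX (by simp)
  have e1 := colTrace_mono (σ k y) hZ
  have e2 : colTrace (σ k y) 0 = 0 := by simp [colTrace]
  have e3 := (abs_le.1 (hK.bound 1 k 0 0 y (by simp) (by simp))).2
  have e4 : (fun _ : Fin m => b - b) = 0 := by ext; simp
  simp only [hq, e4]
  linarith

theorem Admissible.exists_solution [NeZero m] (hK : Admissible K σ F) (hδ : 0 < δ) :
    ∃ (V : Fin m → Euc n → ℝ) (L B : ℝ), (∀ k x y, V k x - V k y ≤ L * ‖x - y‖) ∧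
      (∀ k y, |V k y| ≤ B) ∧ JetSub σ F δ V ∧ ∀ ℓ, JetSup σ F δ ℓ V := by
  have hcoe := K.coe_pos 0
  have hbdd := K.bdd_pos 1
  obtain ⟨Cb, hCb⟩ : ∃ Cb : ℝ, Cb = K.coe 0 + K.bdd 1 := ⟨_, rfl⟩
  have hCb0 : 0 < Cb := by linarith
  obtain ⟨B, hB⟩ : ∃ B : ℝ, B = Cb / δ := ⟨_, rfl⟩
  have hB0 : 0 < B := by rw [hB]; positivity
  have hδB : δ * B = Cb := by rw [hB]; field_simp
  obtain ⟨L, hL1, hL⟩ := exists_comparison K n (R := 2 * B) (Cb := Cb) (by positivity) hCb0.le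
  obtain ⟨ℓ, hℓ⟩ : ∃ ℓ : ℝ, ℓ = L + 1 := ⟨_, rfl⟩
  have hℓ0 : 0 ≤ ℓ := by linarith
  obtain ⟨W, hW⟩ : ∃ W : Set (Fin m → Euc n → ℝ), W = {w | (∀ k x y, w k x - w k y ≤ ℓ * ‖x - y‖) ∧
    (∀ k y, |w k y| ≤ B) ∧ JetSub σ F δ w} := ⟨_, rfl⟩
  have hmem : (fun _ _ => -B) ∈ W := by
    rw [hW]
    refine ⟨fun k x y => ?_, fun k y => by rw [abs_neg, abs_of_pos hB0],
      hK.jetSub_const (by linarith)⟩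
    rw [sub_self]; positivity
  obtain ⟨V, hV⟩ : ∃ V : Fin m → Euc n → ℝ, ∀ k y, IsLUB ((fun w => w k y) '' W) (V k y) := by
    refine ⟨fun k y => sSup ((fun w => w k y) '' W), fun k y => isLUB_csSup
      ⟨_, Set.mem_image_of_mem _ hmem⟩ ⟨B, ?_⟩⟩
    rintro _ ⟨w, hw, rfl⟩
    rw [hW] at hw
    exact (le_abs_self _).trans (hw.2.1 k y)
  have hwV : ∀ w ∈ W, ∀ k y, w k y ≤ V k y := fun w hw k y =>
    (hV k y).1 (Set.mem_image_of_mem _ hw)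
  have hVB : ∀ k y, |V k y| ≤ B := fun k y => by
    rw [abs_le]
    refine ⟨hwV _ hmem k y, (hV k y).2 ?_⟩
    rintro _ ⟨w, hw, rfl⟩
    rw [hW] at hw
    exact (le_abs_self _).trans (hw.2.1 k y)
  have hVl : ∀ k x y, V k x - V k y ≤ ℓ * ‖x - y‖ := fun k x y => by
    rw [sub_le_iff_le_add]
    refine (hV k x).2 ?_
    rintro _ ⟨w, hw, rfl⟩
    have e1 := hwV w hw k y
    rw [hW] at hw
    have e2 := hw.1 k x y
    simp only
    linarith
  have hsub : JetSub σ F δ V := by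
    refine JetSub.of_sup hK hδ hℓ0 (W := W) (fun w hw => ?_) hVl hVB fun k y ν hν => ?_
    · have hw' := hw
      rw [hW] at hw'
      exact ⟨fun k => continuous_of_forall_sub_le (hw'.1 k), hw'.1, hw'.2.2, hwV w hw⟩
    · obtain ⟨_, ⟨w, hw, rfl⟩, h⟩ := (hV k y).exists_between_sub_self hν
      exact ⟨w, hw, h.1⟩
  have hVc : ∀ k, Continuous (V k) := fun k => continuous_of_forall_sub_le (hVl k)
  have hsup : JetSup σ F δ ℓ V := by
    refine hsub.jetSup_of_maximal hK hδ hℓ0 hVl hVB fun w hw1 hw2 hw3 ⟨B', hB'⟩ => ?_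
    have hwW : w ∈ W := by
      rw [hW]
      refine ⟨hw1, fun k y => abs_le.2 ⟨(abs_le.1 (hVB k y)).1.trans (hw3 k y), ?_⟩, hw2⟩
      have := hw2.mul_le hK hδ (fun k => continuous_of_forall_sub_le (hw1 k)) hB' k y
      rw [← mul_le_mul_iff_right₀ hδ, hδB]
      linarith
    exact hwV w hwW
  have hVL : ∀ k x y, V k x - V k y ≤ L * ‖x - y‖ :=
    hL hK hδ hsub hsup hℓ.ge hVc hVc B hVB hVB
      (fun k y => by
        have : δ * -B ≤ δ * V k y := by gcongr; exact (abs_le.1 (hVB k y)).1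
        linarith)
      (fun k j y => by
        have e1 := abs_le.1 (hVB k y)
        have e2 := abs_le.1 (hVB j y)
        rw [abs_le]; constructor <;> linarith)
  refine ⟨V, L, B, hVL, hVB, hsub, fun ℓ' k y q X _ hX => hsup k y q X ?_ hX⟩
  have := Jup.norm_le_of_lipschitz hX (L := L) (by linarith) fun z => by
    have := hVL k z y
    rw [norm_sub_rev] at this
    linarith
  linarith

end Existence

section Translation

variable {n m : ℕ}

theorem gradient_comp_sub_const (φ : Euc n → ℝ) (z x : Euc n) :
    gradient (fun x => φ (x - z)) x = gradient φ (x - z) := by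
  simp only [gradient, fderiv_comp_sub]

theorem hess_comp_sub_const (φ : Euc n → ℝ) (z x : Euc n) :
    hess (fun x => φ (x - z)) x = hess φ (x - z) := by
  ext i j
  simp only [hess, iteratedFDeriv_comp_sub]

theorem macroOp_add (S : Setting n m) (p : Euc n) (r δ : ℝ) (ω : S.Ω) (k : Fin m) (y z : Euc n)
    (vals : Fin m → ℝ) (q : Euc n) (X : Matrix (Fin n) (Fin n) ℝ) :
    macroOp S p r δ ω k (y + z) vals q X = macroOp S p r δ (S.τ z ω) k y vals q X := by
  simp only [macroOp, S.A_stat, S.H_stat]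

theorem IsMacroSoln.translate {S : Setting n m} {p : Euc n} {r δ : ℝ} {ω : S.Ω}
    {v : Fin m → Euc n → ℝ} (h : IsMacroSoln S p r δ ω v) (z : Euc n) :
    IsMacroSoln S p r δ (S.τ z ω) fun k y => v k (y + z) := by
  obtain ⟨hc, ⟨B, hB⟩, ⟨L, hL⟩, hsub, hsup⟩ := h
  have hc' : ∀ y, Tendsto (fun x : Euc n => x - z) (𝓝 (y + z)) (𝓝 y) := fun y => by
    have : Continuous fun x : Euc n => x - z := by fun_prop
    simpa using this.tendsto (y + z)
  have hφ' : ∀ φ : Euc n → ℝ, ContDiff ℝ 2 φ → ContDiff ℝ 2 fun x => φ (x - z) := fun φ hφ =>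
    hφ.comp (contDiff_id.sub contDiff_const)
  refine ⟨fun k => (hc k).comp (by fun_prop), ⟨B, fun k y => hB k _⟩, ⟨L, fun k => ?_⟩, ?_, ?_⟩
  · refine LipschitzWith.of_dist_le_mul fun x y => ?_
    simpa using (hL k).dist_le_mul (x + z) (y + z)
  · intro k φ hφ y _ hmax
    have := hsub k (fun x => φ (x - z)) (hφ' φ hφ) (y + z) trivial (by
      rw [isLocalMaxOn_univ_iff] at hmax ⊢
      filter_upwards [(hc' y).eventually hmax] with x hx
      simpa using hx)
    rwa [macroOp_add, gradient_comp_sub_const, hess_comp_sub_const, add_sub_cancel_right] at this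
  · intro k φ hφ y _ hmin
    have := hsup k (fun x => φ (x - z)) (hφ' φ hφ) (y + z) trivial (by
      rw [isLocalMinOn_univ_iff] at hmin ⊢
      filter_upwards [(hc' y).eventually hmin] with x hx
      simpa using hx)
    rwa [macroOp_add, gradient_comp_sub_const, hess_comp_sub_const, add_sub_cancel_right] at this

end Translation

section Wellposedness

variable {n m : ℕ} {S : Setting n (m + 1)} {p : Euc n} {r δ : ℝ} {ω : S.Ω}

theorem IsMacroSoln.le_of_admissible {K : StructBounds} {u v : Fin (m + 1) → Euc n → ℝ}
    (hK : Admissible K (sigCol S ω) (shiftedHam S p r ω)) (hδ : 0 < δ)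
    (hu : IsMacroSoln S p r δ ω u) (hv : IsMacroSoln S p r δ ω v) (k : Fin (m + 1)) (y : Euc n) :
    u k y ≤ v k y := by
  obtain ⟨huc, ⟨B₁, hB₁⟩, -, husub, -⟩ := hu
  obtain ⟨hvc, ⟨B₂, hB₂⟩, -, -, hvsup⟩ := hv
  have h1 : B₁ ≤ max B₁ B₂ := le_max_left _ _
  have h2 : B₂ ≤ max B₁ B₂ := le_max_right _ _
  have hB0 : 0 ≤ max B₁ B₂ := ((abs_nonneg _).trans (hB₁ k y)).trans h1
  obtain ⟨L, -, hL⟩ := exists_comparison K n (R := 2 * max B₁ B₂) (Cb := δ * max B₁ B₂)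
    (by positivity) (by positivity)
  have := hL hK hδ (jetSub_of_isViscSubOn husub) (jetSup_of_isViscSupOn hvsup (L + 1)) le_rfl huc
    hvc (max B₁ B₂) (fun k y => (hB₁ k y).trans h1) (fun k y => (hB₂ k y).trans h2)
    (fun k y => by
      have e := (abs_le.1 (hB₁ k y)).1
      have : δ * -max B₁ B₂ ≤ δ * u k y := by gcongr; linarith
      linarith)
    (fun k j y => by
      have e1 := abs_le.1 (hB₂ k y)
      have e2 := abs_le.1 (hB₂ j y)
      rw [abs_le]; constructor <;> linarith) k y y
  simpa using this

theorem IsMacroSoln.unique {u v : Fin (m + 1) → Euc n → ℝ} (hδ : 0 < δ)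
    (hu : IsMacroSoln S p r δ ω u) (hv : IsMacroSoln S p r δ ω v) : u = v := by
  obtain ⟨K, hK⟩ := exists_structBounds S p r
  ext k y
  exact le_antisymm (hu.le_of_admissible (hK ω) hδ hv k y) (hv.le_of_admissible (hK ω) hδ hu k y)

theorem exists_isMacroSoln (S : Setting n (m + 1)) (p : Euc n) (r : ℝ) (hδ : 0 < δ) (ω : S.Ω) :
    ∃ v, IsMacroSoln S p r δ ω v := by
  obtain ⟨K, hK⟩ := exists_structBounds S p r
  obtain ⟨V, L, B, hL, hB, hsub, hsup⟩ := (hK ω).exists_solution hδ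
  exact ⟨V, fun k => continuous_of_forall_sub_le (hL k), ⟨B, hB⟩,
    ⟨L.toNNReal, fun k => LipschitzWith.of_le_add_mul' L fun x y => by
      rw [dist_eq_norm]; linarith [hL k x y]⟩,
    isViscSubOn_of_jetSub hsub, isViscSupOn_of_jetSup hsup⟩

theorem IsMacroSoln.abs_mul_le {K : StructBounds} {v : Fin (m + 1) → Euc n → ℝ}
    (hK : Admissible K (sigCol S ω) (shiftedHam S p r ω)) (hδ : 0 < δ)
    (hv : IsMacroSoln S p r δ ω v) (k : Fin (m + 1)) (y : Euc n) :
    |δ * v k y| ≤ K.coe 0 + K.bdd 1 := by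
  obtain ⟨hc, ⟨B, hB⟩, -, hsub, hsup⟩ := hv
  have e1 := (jetSub_of_isViscSubOn hsub).mul_le hK hδ hc (fun k y => (abs_le.1 (hB k y)).2) k y
  have e2 := (jetSup_of_isViscSupOn hsup 1).le_mul hK hδ le_rfl hc
    (fun k y => (abs_le.1 (hB k y)).1) k y
  have := K.coe_pos 0
  have := K.bdd_pos 1
  rw [abs_le]
  constructor <;> linarith

theorem exists_abs_sub_le (S : Setting n (m + 1)) (p : Euc n) (r : ℝ) {K : StructBounds}
    (hK : ∀ ω, Admissible K (sigCol S ω) (shiftedHam S p r ω)) :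
    ∃ R, 0 < R ∧ ∀ δ, 0 < δ → ∀ (ω : S.Ω) (v : Fin (m + 1) → Euc n → ℝ),
      IsMacroSoln S p r δ ω v → ∀ j k y, |v k y - v j y| ≤ R := by
  have h0 := K.coe_pos 0
  have h1 := K.bdd_pos 1
  obtain ⟨M, Λ, hM, hΛ, h⟩ := exists_osc_bound K n (Cb := K.coe 0 + K.bdd 1) (by positivity)
  have key : ∀ δ, 0 < δ → ∀ (ω : S.Ω) (v : Fin (m + 1) → Euc n → ℝ),
      IsMacroSoln S p r δ ω v → ∀ j k y, v k y - v j y ≤ M + Λ + 1 := by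
    intro δ hδ ω v hv j k y
    have hb := hv.abs_mul_le (hK ω) hδ
    obtain ⟨hc, ⟨B, hB⟩, -, hsub, hsup⟩ := hv
    have := h (hK ω) (jetSub_of_isViscSubOn hsub) (jetSup_of_isViscSupOn hsup) hc B hB hb k j y y
    simp [regNorm] at this
    linarith
  refine ⟨M + Λ + 1, by positivity, fun δ hδ ω v hv j k y => abs_le.2 ⟨?_, key δ hδ ω v hv j k y⟩⟩
  linarith [key δ hδ ω v hv k j y]

theorem exists_abs_sub_le_mul (S : Setting n (m + 1)) (p : Euc n) (r : ℝ) {K : StructBounds}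
    (hK : ∀ ω, Admissible K (sigCol S ω) (shiftedHam S p r ω)) :
    ∃ L, 0 < L ∧ ∀ δ, 0 < δ → ∀ (ω : S.Ω) (v : Fin (m + 1) → Euc n → ℝ),
      IsMacroSoln S p r δ ω v → ∀ k x y, |v k x - v k y| ≤ L * ‖x - y‖ := by
  have h0 := K.coe_pos 0
  have h1 := K.bdd_pos 1
  obtain ⟨R, hR, hRv⟩ := exists_abs_sub_le S p r hK
  obtain ⟨L, hL1, hL⟩ := exists_comparison K n (R := R) (Cb := K.coe 0 + K.bdd 1) hR.le
    (by positivity)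
  refine ⟨L, by linarith, fun δ hδ ω v hv => ?_⟩
  have hb := hv.abs_mul_le (hK ω) hδ
  have hd := hRv δ hδ ω v hv
  obtain ⟨hc, ⟨B, hB⟩, -, hsub, hsup⟩ := hv
  have := hL (hK ω) hδ (jetSub_of_isViscSubOn hsub) (jetSup_of_isViscSupOn hsup (L + 1)) le_rfl
    hc hc B hB hB (fun k y => (abs_le.1 (hb k y)).1) (fun k j y => hd j k y)
  intro k x y
  refine abs_sub_le_iff.2 ⟨this k x y, ?_⟩
  rw [norm_sub_rev]
  exact this k y x

end Wellposedness

/-- Well-posedness, uniform estimates and stationarity for the approximate macroscopic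
system. -/
theorem stmt0 {n m : ℕ} (S : Setting n (m + 1)) (p : Euc n) (r : ℝ) :
    (∀ δ : ℝ, 0 < δ → ∀ ω : S.Ω, ∃! vδ : Fin (m + 1) → Euc n → ℝ, IsMacroSoln S p r δ ω vδ) ∧
    (∃ C : ℝ, 0 < C ∧ ∀ δ : ℝ, 0 < δ → ∀ ω : S.Ω,
      ∀ vδ : Fin (m + 1) → Euc n → ℝ, IsMacroSoln S p r δ ω vδ →
        (∀ k y, |δ * vδ k y| ≤ C) ∧ ∀ k y₁ y₂, |vδ k y₁ - vδ k y₂| ≤ C * ‖y₁ - y₂‖) ∧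
    (∀ R : ℝ, 0 < R → ∃ C : ℝ, 0 < C ∧ ∀ δ : ℝ, 0 < δ → ∀ ω : S.Ω,
      ∀ vδ : Fin (m + 1) → Euc n → ℝ, IsMacroSoln S p r δ ω vδ →
        ∀ j k : Fin (m + 1), ∀ y : Euc n, ‖y‖ ≤ R → |vδ k y - vδ j y| ≤ C) ∧
    (∀ δ : ℝ, 0 < δ → ∀ V : S.Ω → Fin (m + 1) → Euc n → ℝ,
      (∀ ω, IsMacroSoln S p r δ ω (V ω)) →
        ∀ (ω : S.Ω) (y z : Euc n) (k : Fin (m + 1)), V ω k (y + z) = V (S.τ z ω) k y) := by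
  obtain ⟨K, hK⟩ := exists_structBounds S p r
  refine ⟨fun δ hδ ω => ?_, ?_, fun R _ => ?_, fun δ hδ V hV ω y z k => ?_⟩
  · obtain ⟨v, hv⟩ := exists_isMacroSoln S p r hδ ω
    exact ⟨v, hv, fun u hu => hu.unique hδ hv⟩
  · obtain ⟨L, hL0, hL⟩ := exists_abs_sub_le_mul S p r hK
    have h0 := K.coe_pos 0
    have h1 := K.bdd_pos 1
    refine ⟨K.coe 0 + K.bdd 1 + L, by positivity, fun δ hδ ω v hv => ⟨fun k y => ?_,
      fun k x y => (hL δ hδ ω v hv k x y).trans ?_⟩⟩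
    · linarith [hv.abs_mul_le (hK ω) hδ k y]
    · gcongr
      linarith
  · obtain ⟨C, hC0, hC⟩ := exists_abs_sub_le S p r hK
    exact ⟨C, hC0, fun δ hδ ω v hv j k y _ => hC δ hδ ω v hv j k y⟩
  · exact congrFun (congrFun (((hV ω).translate z).unique hδ (hV (S.τ z ω))) k) y
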